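/- arXiv:2209.01201 — 2 statements merged into one kernel-verified Lean document; each statement's English description precedes it below -/
import Mathlib

section
/- Let K be a field and G a connected odd unicyclic finite simple graph on [n], i.e., a connected graph with exactly one cycle and that cycle has odd length. Then the projective dimension of S/𝓘_G over S, where 𝓘_G is the parity binomial edge ideal of G, equals n: pd(S/𝓘_G) = n. -/
open MvPolynomial

noncomputable section

/-- The parity binomial edge ideal of a simple graph `G` on vertex set `V`:
`𝓘_G = (x_i x_j - y_i y_j : {i,j} ∈ E(G))` in
`K[x_v, y_v : v ∈ V] = MvPolynomial (V ⊕ V) K`. -/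
def parityBinomialEdgeIdeal (K : Type) [Field K] {V : Type} (G : SimpleGraph V) :
    Ideal (MvPolynomial (V ⊕ V) K) :=
  Ideal.span {f | ∃ i j, G.Adj i j ∧
    f = X (Sum.inl i) * X (Sum.inl j) - X (Sum.inr i) * X (Sum.inr j)}

/-- A minimal graded free resolution of the quotient `S/I`. -/
structure MinimalGradedFreeResolutionOfQuotient {σ K : Type} [Field K]
    (I : Ideal (MvPolynomial σ K)) where
  rank : ℕ → ℕ
  twist : (i : ℕ) → Fin (rank i) → ℕ
  gen : Fin (rank 0) → MvPolynomial σ K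
  diff : (i : ℕ) → Matrix (Fin (rank i)) (Fin (rank (i + 1))) (MvPolynomial σ K)
  gen_homog : ∀ e, (gen e).IsHomogeneous (twist 0 e)
  gen_span : ∀ g : MvPolynomial σ K,
    ∃ c : Fin (rank 0) → MvPolynomial σ K, g - ∑ e, c e * gen e ∈ I
  diff_homog : ∀ i r c, diff i r c = 0 ∨
    (twist i r ≤ twist (i + 1) c ∧
      (diff i r c).IsHomogeneous (twist (i + 1) c - twist i r))
  minimal : ∀ i r c, constantCoeff (diff i r c) = 0
  exact_zero : ∀ v : Fin (rank 0) → MvPolynomial σ K,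
    (∑ e, v e * gen e ∈ I) ↔ ∃ w, v = (diff 0).mulVec w
  exact_succ : ∀ i (v : Fin (rank (i + 1)) → MvPolynomial σ K),
    (diff i).mulVec v = 0 ↔ ∃ w, v = (diff (i + 1)).mulVec w
  fin_length : ∃ N, ∀ i, N ≤ i → rank i = 0

/-- The projective dimension read off from a minimal graded free resolution:
the largest homological degree in which the resolution is nonzero. -/
def MinimalGradedFreeResolutionOfQuotient.projDim {σ K : Type} [Field K]
    {I : Ideal (MvPolynomial σ K)}
    (F : MinimalGradedFreeResolutionOfQuotient I) : ℕ :=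
  sSup {i : ℕ | F.rank i ≠ 0}


open CategoryTheory in
def PDL (R : Type) [CommRing R] (M : Type) [AddCommGroup M] [Module R M] (n : ℕ) : Prop :=
  HasProjectiveDimensionLT (ModuleCat.of R M) n

namespace PDL
variable {R : Type} [CommRing R] {M N P : Type} [AddCommGroup M] [Module R M]
  [AddCommGroup N] [Module R N] [AddCommGroup P] [Module R P]

open CategoryTheory

theorem mono {m n : ℕ} (h : PDL R M m) (hmn : m ≤ n) : PDL R M n := by
  unfold PDL at *
  exact hasProjectiveDimensionLT_of_ge _ m n hmn

theorem equiv {n : ℕ} (e : M ≃ₗ[R] N) (h : PDL R M n) : PDL R N n := by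
  unfold PDL at *
  exact hasProjectiveDimensionLT_of_iso e.toModuleIso n

theorem of_projective [Module.Projective R M] : PDL R M 1 := by
  unfold PDL
  rw [← projective_iff_hasProjectiveDimensionLT_one, ← IsProjective.iff_projective]
  infer_instance

theorem projective (h : PDL R M 1) : Module.Projective R M := by
  unfold PDL at h
  rwa [← projective_iff_hasProjectiveDimensionLT_one, ← IsProjective.iff_projective] at h

theorem se (f : M →ₗ[R] N) (g : N →ₗ[R] P) (hf : Function.Injective f)
    (hg : Function.Surjective g) (h : Function.Exact f g) :
    ∃ S : ShortComplex (ModuleCat.{0} R), S.ShortExact ∧ S.X₁ = ModuleCat.of R M ∧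
      S.X₂ = ModuleCat.of R N ∧ S.X₃ = ModuleCat.of R P := by
  refine ⟨ShortComplex.mk (ModuleCat.ofHom f) (ModuleCat.ofHom g) ?_, ?_, rfl, rfl, rfl⟩
  · ext x
    exact h.apply_apply_eq_zero x
  · exact ModuleCat.shortComplex_shortExact _ h hf hg

theorem ses2 {n : ℕ} (f : M →ₗ[R] N) (g : N →ₗ[R] P) (hf : Function.Injective f)
    (hg : Function.Surjective g) (h : Function.Exact f g) (h1 : PDL R M n) (h3 : PDL R P n) :
    PDL R N n := by
  obtain ⟨S, hS, e1, e2, e3⟩ := se f g hf hg h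
  unfold PDL at *
  rw [← e1] at h1; rw [← e3] at h3; rw [← e2]
  exact hS.hasProjectiveDimensionLT_X₂ n h1 h3

theorem ses3 {n : ℕ} (f : M →ₗ[R] N) (g : N →ₗ[R] P) (hf : Function.Injective f)
    (hg : Function.Surjective g) (h : Function.Exact f g) (h1 : PDL R M n)
    (h2 : PDL R N (n + 1)) : PDL R P (n + 1) := by
  obtain ⟨S, hS, e1, e2, e3⟩ := se f g hf hg h
  unfold PDL at *
  rw [← e1] at h1; rw [← e2] at h2; rw [← e3]
  exact hS.hasProjectiveDimensionLT_X₃ n h1 h2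

theorem ses1 {n : ℕ} (f : M →ₗ[R] N) (g : N →ₗ[R] P) (hf : Function.Injective f)
    (hg : Function.Surjective g) (h : Function.Exact f g) (h2 : PDL R N n)
    (h3 : PDL R P (n + 1)) : PDL R M n := by
  obtain ⟨S, hS, e1, e2, e3⟩ := se f g hf hg h
  unfold PDL at *
  rw [← e3] at h3; rw [← e2] at h2; rw [← e1]
  exact hS.hasProjectiveDimensionLT_X₁ n h2 h3

theorem prod {n : ℕ} (h1 : PDL R M n) (h2 : PDL R N n) : PDL R (M × N) n :=
  ses2 (LinearMap.inl R M N) (LinearMap.snd R M N) LinearMap.inl_injective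
    LinearMap.snd_surjective Function.Exact.inl_snd h1 h2

/-- data of the cyclic step -/
theorem cyc (N : Submodule R M) (z : M) (I : Ideal R) (h : ∀ g : R, g • z ∈ N ↔ g ∈ I) :
    ∃ (f : (R ⧸ I) →ₗ[R] (M ⧸ N)) (g : (M ⧸ N) →ₗ[R] (M ⧸ (N ⊔ Submodule.span R {z}))),
      Function.Injective f ∧ Function.Surjective g ∧ Function.Exact f g := by
  refine ⟨Submodule.mapQ I N (LinearMap.toSpanSingleton R M z) ?_,
    Submodule.factor le_sup_left, ?_, ?_, ?_⟩
  · intro g hg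
    simpa using (h g).2 hg
  · rw [← LinearMap.ker_eq_bot, Submodule.ker_mapQ, eq_bot_iff]
    rintro _ ⟨g, hg, rfl⟩
    have : g ∈ I := (h g).1 (by simpa using hg)
    simpa [Submodule.Quotient.mk_eq_zero] using (Ideal.Quotient.eq_zero_iff_mem.2 this)
  · exact Submodule.factor_surjective _
  · intro x
    obtain ⟨m, rfl⟩ := Submodule.Quotient.mk_surjective _ x
    constructor
    · intro hx
      have hx : m ∈ N ⊔ Submodule.span R {z} := by
        simpa [Submodule.factor, Submodule.Quotient.mk_eq_zero] using hx
      obtain ⟨a, ha, b, hb, rfl⟩ := Submodule.mem_sup.1 hx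
      obtain ⟨r, rfl⟩ := Submodule.mem_span_singleton.1 hb
      refine ⟨Submodule.Quotient.mk r, ?_⟩
      simp only [Submodule.mapQ_apply, LinearMap.toSpanSingleton_apply]
      rw [Submodule.Quotient.eq]
      simpa using ha
    · rintro ⟨y, hy⟩
      obtain ⟨r, rfl⟩ := Submodule.Quotient.mk_surjective _ y
      rw [← hy]
      simp only [Submodule.mapQ_apply, LinearMap.toSpanSingleton_apply, Submodule.factor]
      rw [Submodule.Quotient.mk_eq_zero]
      exact Submodule.mem_sup_right (Submodule.smul_mem _ _ (Submodule.mem_span_singleton_self z))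

theorem cyc3 {n : ℕ} (N : Submodule R M) (z : M) (I : Ideal R) (h : ∀ g : R, g • z ∈ N ↔ g ∈ I)
    (h1 : PDL R (R ⧸ I) n) (h2 : PDL R (M ⧸ N) (n + 1)) :
    PDL R (M ⧸ (N ⊔ Submodule.span R {z})) (n + 1) := by
  obtain ⟨f, g, hf, hg, e⟩ := cyc N z I h
  exact ses3 f g hf hg e h1 h2

theorem cyc1 {n : ℕ} (N : Submodule R M) (z : M) (I : Ideal R) (h : ∀ g : R, g • z ∈ N ↔ g ∈ I)
    (h2 : PDL R (M ⧸ N) n) (h3 : PDL R (M ⧸ (N ⊔ Submodule.span R {z})) (n + 1)) :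
    PDL R (R ⧸ I) n := by
  obtain ⟨f, g, hf, hg, e⟩ := cyc N z I h
  exact ses1 f g hf hg e h2 h3

theorem mv {n : ℕ} (J A B : Submodule R M) (hJ : J = A ⊓ B) (h1 : PDL R (M ⧸ A) n)
    (h2 : PDL R (M ⧸ B) n) (h3 : PDL R (M ⧸ (A ⊔ B)) (n + 1)) : PDL R (M ⧸ J) n := by
  have hA : J ≤ A := hJ ▸ inf_le_left
  have hB : J ≤ B := hJ ▸ inf_le_right
  have cA : A ≤ A ⊔ B := le_sup_left
  have cB : B ≤ A ⊔ B := le_sup_right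
  refine ses1 (N := (M ⧸ A) × (M ⧸ B)) (P := M ⧸ (A ⊔ B))
    ((Submodule.factor hA).prod (Submodule.factor hB))
    ((Submodule.factor cA).coprod (-(Submodule.factor cB))) ?_ ?_ ?_ (prod h1 h2) h3
  · rw [← LinearMap.ker_eq_bot, eq_bot_iff]
    intro x hx
    obtain ⟨r, rfl⟩ := Submodule.Quotient.mk_surjective _ x
    have hx : (Submodule.Quotient.mk r : M ⧸ A) = 0 ∧ (Submodule.Quotient.mk r : M ⧸ B) = 0 :=
      Prod.ext_iff.1 hx
    rw [Submodule.Quotient.mk_eq_zero, Submodule.Quotient.mk_eq_zero] at hx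
    rw [Submodule.mem_bot, Submodule.Quotient.mk_eq_zero, hJ]
    exact hx
  · intro x
    obtain ⟨r, rfl⟩ := Submodule.Quotient.mk_surjective _ x
    refine ⟨(Submodule.Quotient.mk r, 0), ?_⟩
    simp [Submodule.factor]
  · rintro ⟨x, y⟩
    obtain ⟨a, rfl⟩ := Submodule.Quotient.mk_surjective _ x
    obtain ⟨b, rfl⟩ := Submodule.Quotient.mk_surjective _ y
    constructor
    · intro h
      have h : a - b ∈ A ⊔ B := by
        rw [← Submodule.Quotient.mk_eq_zero (A ⊔ B), Submodule.Quotient.mk_sub]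
        simpa [Submodule.factor, sub_eq_add_neg] using h
      obtain ⟨u, hu, v, hv, huv⟩ := Submodule.mem_sup.1 h
      refine ⟨Submodule.Quotient.mk (a - u), ?_⟩
      refine Prod.ext ?_ ?_
      · show (Submodule.Quotient.mk (a - u) : M ⧸ A) = Submodule.Quotient.mk a
        rw [Submodule.Quotient.eq]
        simpa using hu
      · show (Submodule.Quotient.mk (a - u) : M ⧸ B) = Submodule.Quotient.mk b
        rw [Submodule.Quotient.eq]
        have : a - u - b = v := by
          rw [sub_right_comm, ← huv, add_sub_cancel_left]
        rwa [this]
    · rintro ⟨y, hy⟩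
      obtain ⟨r, rfl⟩ := Submodule.Quotient.mk_surjective _ y
      rw [← hy]
      simp [Submodule.factor]

theorem zero_quot : PDL R (R ⧸ (⊥ : Ideal R)) 1 :=
  equiv (Submodule.quotEquivOfEqBot _ rfl).symm of_projective

theorem ideal_sup {n : ℕ} (I : Ideal R) (hI : I.IsPrime) (z : R) (hz : z ∉ I)
    (h : PDL R (R ⧸ I) n) : PDL R (R ⧸ (I ⊔ Ideal.span {z})) (n + 1) := by
  refine cyc3 (M := R) I z I (fun g => ?_) h (h.mono (Nat.le_succ n))
  constructor
  · intro hg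
    exact (hI.mem_or_mem hg).resolve_right hz
  · intro hg
    exact I.mul_mem_right _ hg

end PDL

namespace Seg
variable {V L σ : Type} {K : Type} [Field K] (τ : V × Bool ≃ σ)

def xx (K : Type) [Field K] (i : V) : MvPolynomial σ K := X (τ (i, true))
def yy (K : Type) [Field K] (i : V) : MvPolynomial σ K := X (τ (i, false))
def DD (K : Type) [Field K] (i j : V) : MvPolynomial σ K :=
  xx τ K i * yy τ K j - xx τ K j * yy τ K i

def PC (K : Type) [Field K] (c : V → L) : Ideal (MvPolynomial σ K) :=
  Ideal.span {f | ∃ i j, c i = c j ∧ f = DD τ K i j}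

def phi (K : Type) [Field K] (c : V → L) :
    MvPolynomial σ K →ₐ[K] MvPolynomial (V ⊕ (L × Bool)) K :=
  aeval (fun z => X (Sum.inl (τ.symm z).1) * X (Sum.inr (c (τ.symm z).1, (τ.symm z).2)))

theorem phi_DD (c : V → L) (i j : V) : phi τ K c (DD τ K i j) =
    X (Sum.inl i) * X (Sum.inl j) * (X (Sum.inr (c i, true)) * X (Sum.inr (c j, false))
      - X (Sum.inr (c j, true)) * X (Sum.inr (c i, false))) := by
  simp [phi, DD, xx, yy]; ring

def psi (c : V → L) : (σ →₀ ℕ) →+ ((V ⊕ (L × Bool)) →₀ ℕ) :=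
  Finsupp.liftAddHom (fun z => multiplesHom _
     (Finsupp.single (Sum.inl (τ.symm z).1) 1 +
      Finsupp.single (Sum.inr (c (τ.symm z).1, (τ.symm z).2)) 1))

theorem psi_single (c : V → L) (z : σ) : psi τ c (Finsupp.single z 1) =
    Finsupp.single (Sum.inl (τ.symm z).1) 1 + 
      Finsupp.single (Sum.inr (c (τ.symm z).1, (τ.symm z).2)) 1 := by
  simp [psi]

theorem phi_monomial (c : V → L) (m : σ →₀ ℕ) :
    phi τ K c (monomial m 1) = monomial (psi τ c m) 1 := by
  induction m using Finsupp.induction_linear with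
  | zero => simp
  | add f g hf hg =>
    rw [map_add, ← one_mul (1 : K), ← monomial_mul, map_mul, hf, hg, monomial_mul]
  | single z k =>
    induction k with
    | zero => simp
    | succ k ih =>
      rw [Finsupp.single_add, map_add, ← one_mul (1 : K), ← monomial_mul, map_mul, ih,
        ← monomial_mul, psi_single]
      congr 1
      rw [← one_mul (1 : K), ← monomial_mul]
      simp only [one_mul]
      change phi τ K c (X z) = X _ * X _
      simp [phi]

theorem exists_inl (c : V → L) (m : σ →₀ ℕ) (i : V) (h : psi τ c m (Sum.inl i) ≠ 0) :
    ∃ z, m z ≠ 0 ∧ (τ.symm z).1 = i := by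
  contrapose! h
  rw [psi, Finsupp.liftAddHom_apply, Finsupp.sum, Finsupp.finsetSum_apply]
  refine Finset.sum_eq_zero fun z hz => ?_
  have := h z (by simpa using hz)
  simp [this]

theorem exists_inr (c : V → L) (m : σ →₀ ℕ) (l : L) (b : Bool)
    (h : psi τ c m (Sum.inr (l, b)) ≠ 0) :
    ∃ z, m z ≠ 0 ∧ c (τ.symm z).1 = l ∧ (τ.symm z).2 = b := by
  contrapose! h
  rw [psi, Finsupp.liftAddHom_apply, Finsupp.sum, Finsupp.finsetSum_apply]
  refine Finset.sum_eq_zero fun z hz => ?_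
  have := h z (by simpa using hz)
  simp only [multiplesHom_apply, smul_add, Finsupp.smul_single, Finsupp.add_apply]
  rw [Finsupp.single_eq_of_ne (by simp), Finsupp.single_eq_of_ne]
  · simp
  · intro h; simp at h; exact this h.1.symm h.2.symm

theorem split1 (m : σ →₀ ℕ) (z : σ) (h : m z ≠ 0) : ∃ m0, m = m0 + Finsupp.single z 1 :=
  ⟨m - Finsupp.single z 1, by
    rw [tsub_add_cancel_of_le]
    rw [Finsupp.single_le_iff]; omega⟩

theorem toric (c : V → L) : ∀ (d : ℕ) (m m' : σ →₀ ℕ), m.degree = d → psi τ c m = psi τ c m' →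
    (monomial m (1 : K) - monomial m' 1) ∈ PC τ K c := by
  classical
  intro d
  induction d with
  | zero =>
    intro m m' hd h
    have : m = 0 := (Finsupp.degree_eq_zero_iff m).1 hd
    subst this
    have : m' = 0 := by
      by_contra h0
      obtain ⟨z, hz⟩ := Finsupp.ne_iff.1 h0
      obtain ⟨m0, rfl⟩ := split1 m' z hz
      have := DFunLike.congr_fun h (Sum.inl (τ.symm z).1)
      rw [map_add, psi_single] at this
      simp at this
    subst this
    simp
  | succ d ih =>
    intro m m' hd h
    -- cancelling
    have key : ∀ (m m' : σ →₀ ℕ) (z : σ), m.degree = d + 1 → psi τ c m = psi τ c m' →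
        m z ≠ 0 → m' z ≠ 0 → (monomial m (1 : K) - monomial m' 1) ∈ PC τ K c := by
      intro m m' z hd h hz hz'
      obtain ⟨m0, rfl⟩ := split1 m z hz
      obtain ⟨m1, rfl⟩ := split1 m' z hz'
      have h2 : m0.degree = d := by simpa [map_add] using hd
      have h3 : psi τ c m0 = psi τ c m1 := by
        rw [map_add, map_add] at h
        exact add_right_cancel h
      have := ih m0 m1 h2 h3
      have e : ∀ m : σ →₀ ℕ, monomial (m + Finsupp.single z 1) (1 : K) = monomial m 1 * X z := by
        intro m; rw [← one_mul (1 : K), ← monomial_mul, one_mul]; rfl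
      rw [e, e, ← sub_mul]
      exact Ideal.mul_mem_right _ _ this
    have : m ≠ 0 := by rintro rfl; simp at hd
    obtain ⟨z, hz⟩ := Finsupp.ne_iff.1 this
    by_cases hz' : m' z = 0
    swap
    · exact key m m' z hd h hz hz'
    have hl : psi τ c m (Sum.inl (τ.symm z).1) ≠ 0 ∧
        psi τ c m (Sum.inr (c (τ.symm z).1, (τ.symm z).2)) ≠ 0 := by
      obtain ⟨m0, rfl⟩ := split1 m z hz
      rw [map_add, psi_single]
      simp
    rw [h] at hl
    obtain ⟨z1, hz1, h1⟩ := exists_inl τ c m' _ hl.1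
    obtain ⟨z2, hz2, h2, h2'⟩ := exists_inr τ c m' _ _ hl.2
    obtain ⟨⟨i, b⟩, rfl⟩ := τ.surjective z
    obtain ⟨⟨i1, b1⟩, rfl⟩ := τ.surjective z1
    obtain ⟨⟨j, b2⟩, rfl⟩ := τ.surjective z2
    simp only [Equiv.symm_apply_apply] at h1 h2 h2'
    subst h1 h2'
    have hb : b1 = !b2 := by
      by_contra hb
      have : b1 = b2 := by cases b1 <;> cases b2 <;> simp_all
      subst this; exact hz1 hz'
    subst hb
    obtain ⟨m1, rfl⟩ := split1 m' _ hz2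
    have hz1' : m1 (τ (i1, !b2)) ≠ 0 := by
      intro h0
      apply hz1
      simp [h0]
    obtain ⟨m2, rfl⟩ := split1 m1 _ hz1'
    have hk := key m (m2 + Finsupp.single (τ (i1, b2)) 1 + Finsupp.single (τ (j, !b2)) 1)
      (τ (i1, b2)) hd ?_ hz (by simp)
    swap
    · rw [h]
      simp only [map_add, psi_single, Equiv.symm_apply_apply, h2]
      abel
    have : monomial m (1 : K) - monomial (m2 + Finsupp.single (τ (i1, !b2)) 1 + Finsupp.single (τ (j, b2)) 1) 1
       = (monomial m (1 : K) - monomial (m2 + Finsupp.single (τ (i1, b2)) 1 + Finsupp.single (τ (j, !b2)) 1) 1) +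
         monomial m2 1 * (X (τ (i1, b2)) * X (τ (j, !b2)) - X (τ (i1, !b2)) * X (τ (j, b2))) := by
      simp only [X, mul_sub, monomial_mul, one_mul, add_assoc]
      ring
    rw [this]
    refine Ideal.add_mem _ hk (Ideal.mul_mem_left _ _ ?_)
    cases b2
    · refine Ideal.subset_span ⟨j, i1, h2, ?_⟩
      simp [DD, xx, yy]; ring
    · refine Ideal.subset_span ⟨i1, j, h2.symm, ?_⟩
      simp [DD, xx, yy]; ring

theorem PC_eq_ker (c : V → L) : PC τ K c = RingHom.ker (phi τ K c) := by
  classical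
  apply le_antisymm
  · rw [PC, Ideal.span_le]
    rintro f ⟨i, j, h, rfl⟩
    rw [SetLike.mem_coe, RingHom.mem_ker, phi_DD, h]; ring
  · intro g hg
    let s : ((V ⊕ (L × Bool)) →₀ ℕ) → (σ →₀ ℕ) := Function.invFun (psi τ c)
    let ps : MvPolynomial (V ⊕ (L × Bool)) K →ₗ[K] MvPolynomial σ K :=
      (MvPolynomial.basisMonomials _ K).constr K (fun t => monomial (s t) 1)
    have : ∀ g : MvPolynomial σ K, g - ps (phi τ K c g) ∈ PC τ K c := by
      intro g
      induction g using MvPolynomial.monomial_add_induction_on with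
      | C a =>
        have h1 : (C a : MvPolynomial σ K) = a • monomial 0 1 := by
          rw [smul_monomial, smul_eq_mul, mul_one]; rfl
        rw [h1, map_smul, map_smul, ← smul_sub, phi_monomial]
        refine Submodule.smul_of_tower_mem _ _ ?_
        have : ps (monomial (psi τ c 0) 1) = monomial (s (psi τ c 0)) 1 := by
          have := (MvPolynomial.basisMonomials (V ⊕ (L × Bool)) K).constr_basis K
            (fun t => monomial (s t) (1 : K)) (psi τ c 0)
          simpa using this
        rw [this]
        exact toric τ c _ _ _ rfl (Function.invFun_eq ⟨_, rfl⟩).symm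
      | monomial_add m a f h1 h2 hf =>
        have h1 : (monomial m a : MvPolynomial σ K) = a • monomial m 1 := by
          simp [smul_monomial]
        rw [map_add, map_add, add_sub_add_comm]
        refine Ideal.add_mem _ ?_ hf
        rw [h1, map_smul, map_smul, ← smul_sub, phi_monomial]
        refine Submodule.smul_of_tower_mem _ _ ?_
        have : ps (monomial (psi τ c m) 1) = monomial (s (psi τ c m)) 1 := by
          have := (MvPolynomial.basisMonomials (V ⊕ (L × Bool)) K).constr_basis K
            (fun t => monomial (s t) (1 : K)) (psi τ c m)
          simpa using this
        rw [this]
        exact toric τ c _ _ _ rfl (Function.invFun_eq ⟨_, rfl⟩).symm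
    have h := this g
    rw [RingHom.mem_ker] at hg
    rw [hg, map_zero, sub_zero] at h
    exact h

theorem PC_prime (c : V → L) : (PC τ K c).IsPrime := by
  rw [PC_eq_ker]; exact RingHom.ker_isPrime _

theorem xx_notMem (c : V → L) (i : V) : xx τ K i ∉ PC τ K c := by
  rw [PC_eq_ker, RingHom.mem_ker]
  simp [phi, xx]

theorem yy_notMem (c : V → L) (i : V) : yy τ K i ∉ PC τ K c := by
  rw [PC_eq_ker, RingHom.mem_ker]
  simp [phi, yy]

theorem X_notMem (c : V → L) (z : σ) : (X z : MvPolynomial σ K) ∉ PC τ K c := by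
  rw [PC_eq_ker, RingHom.mem_ker]
  simp [phi]

theorem DD_notMem (c : V → L) (i j : V) (h : c i ≠ c j) : DD τ K i j ∉ PC τ K c := by
  rw [PC_eq_ker, RingHom.mem_ker, phi_DD]
  refine mul_ne_zero (mul_ne_zero (X_ne_zero _) (X_ne_zero _)) ?_
  classical
  intro h0
  have := congrArg (MvPolynomial.eval (fun z => if z = Sum.inr (c i, true) ∨ z = Sum.inr (c j, false) then (1 : K) else 0)) h0
  simp [h, Ne.symm h] at this

end Seg

namespace Seg
variable {V σ : Type} {K : Type} [Field K] (τ : V × Bool ≃ σ)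

open Classical in
def rho (K : Type) [Field K] (Z : Set σ) : MvPolynomial σ K →ₐ[K] MvPolynomial σ K :=
  aeval (fun z => if z ∈ Z then 0 else X z)

def KZ (K : Type) [Field K] (Z : Set σ) : Ideal (MvPolynomial σ K) :=
  Ideal.span (X '' Z)

theorem rho_X_mem {Z : Set σ} {z : σ} (h : z ∈ Z) : rho K Z (X z) = 0 := by simp [rho, h]
theorem rho_X_notMem {Z : Set σ} {z : σ} (h : z ∉ Z) : rho K Z (X z) = X z := by simp [rho, h]

theorem sub_rho (Z : Set σ) (g : MvPolynomial σ K) : g - rho K Z g ∈ KZ K Z := by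
  induction g using MvPolynomial.induction_on with
  | C a => simp [rho]
  | add p q hp hq => rw [map_add, add_sub_add_comm]; exact Ideal.add_mem _ hp hq
  | mul_X p z hp =>
    rw [map_mul]
    by_cases hz : z ∈ Z
    · rw [rho_X_mem hz, mul_zero, sub_zero]
      exact Ideal.mul_mem_left _ _ (Ideal.subset_span ⟨z, hz, rfl⟩)
    · rw [rho_X_notMem hz, ← sub_mul]
      exact Ideal.mul_mem_right _ _ hp

theorem rho_KZ (Z : Set σ) (g : MvPolynomial σ K) (hg : g ∈ KZ K Z) : rho K Z g = 0 := by
  have : KZ K Z ≤ RingHom.ker (rho K Z) := by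
    rw [KZ, Ideal.span_le]
    rintro _ ⟨z, hz, rfl⟩
    exact rho_X_mem hz
  exact this hg

theorem sup_KZ (I : Ideal (MvPolynomial σ K)) (Z : Set σ) (h : ∀ g ∈ I, rho K Z g ∈ I) :
    I ⊔ KZ K Z = I.comap (rho K Z) := by
  apply le_antisymm
  · refine sup_le (fun g hg => h g hg) (fun g hg => ?_)
    rw [Ideal.mem_comap, rho_KZ Z g hg]; exact I.zero_mem
  · intro g hg
    have := Ideal.add_mem (I ⊔ KZ K Z) (Ideal.mem_sup_left hg) (Ideal.mem_sup_right (sub_rho Z g))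
    simpa using this

theorem sup_KZ_prime (I : Ideal (MvPolynomial σ K)) (hI : I.IsPrime) (Z : Set σ)
    (h : ∀ g ∈ I, rho K Z g ∈ I) : (I ⊔ KZ K Z).IsPrime := by
  rw [sup_KZ I Z h]; exact Ideal.comap_isPrime _ _

theorem sup_KZ_notMem (I : Ideal (MvPolynomial σ K)) (Z : Set σ)
    (h : ∀ g ∈ I, rho K Z g ∈ I) (z : σ) (hz : z ∉ Z) (hI : X z ∉ I) : X z ∉ I ⊔ KZ K Z := by
  rw [sup_KZ I Z h, Ideal.mem_comap, rho_X_notMem hz]; exact hI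

theorem rho_span (s : Set (MvPolynomial σ K)) (I : Ideal (MvPolynomial σ K)) (Z : Set σ)
    (h : ∀ g ∈ s, rho K Z g ∈ I) : ∀ g ∈ Ideal.span s, rho K Z g ∈ I := by
  intro g hg
  have : Ideal.span s ≤ I.comap (rho K Z) := by
    rw [Ideal.span_le]; exact h
  exact this hg

theorem KZ_insert (Z : Set σ) (z : σ) : KZ K (insert z Z) = KZ K Z ⊔ Ideal.span {X z} := by
  rw [KZ, Set.image_insert_eq, Ideal.span_insert, sup_comm]; rfl

theorem KZ_union (Z Z' : Set σ) : KZ K (Z ∪ Z') = KZ K Z ⊔ KZ K Z' := by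
  rw [KZ, Set.image_union, Ideal.span_union]; rfl

theorem pd_kill (I : Ideal (MvPolynomial σ K)) (hI : I.IsPrime) (hX : ∀ z, X z ∉ I) (n : ℕ)
    (hn : PDL (MvPolynomial σ K) (MvPolynomial σ K ⧸ I) n) (Z : Finset σ)
    (h : ∀ Z' : Set σ, Z' ⊆ Z → ∀ g ∈ I, rho K Z' g ∈ I) :
    PDL (MvPolynomial σ K) (MvPolynomial σ K ⧸ (I ⊔ KZ K (Z : Set σ))) (n + Z.card) := by
  classical
  induction Z using Finset.induction_on with
  | empty =>
    have : I ⊔ KZ K ((∅ : Finset σ) : Set σ) = I := by simp [KZ]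
    rw [this]; simpa using hn
  | insert z Z hz ih =>
    have hs : (Z : Set σ) ⊆ (insert z Z : Finset σ) := by simp
    have := ih (fun Z' hZ' => h Z' (hZ'.trans hs))
    rw [Finset.coe_insert, KZ_insert, ← sup_assoc, Finset.card_insert_of_notMem hz, ← add_assoc]
    exact PDL.ideal_sup _ (sup_KZ_prime I hI _ (h _ hs)) _
      (sup_KZ_notMem I _ (h _ hs) z (by simpa using hz) (hX z)) this

variable (c : V → V)

def qq (K : Type) [Field K] (i : V) : MvPolynomial σ K × MvPolynomial σ K :=
  (yy τ K i, - xx τ K i)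

def NN (K : Type) [Field K] (c : V → V) (v : V) :
    Submodule (MvPolynomial σ K) (MvPolynomial σ K × MvPolynomial σ K) :=
  Submodule.prod (PC τ K c) (PC τ K c) ⊔ Submodule.span _ {q | ∃ i, c i = c v ∧ q = qq τ K i}

def XC (c : V → V) (v : V) : Set σ := {z | ∃ i, c i = c v ∧ z = τ (i, true)}

theorem DD_mem {c : V → V} {i j : V} (h : c i = c j) : DD τ K i j ∈ PC τ K c :=
  Ideal.subset_span ⟨i, j, h, rfl⟩

theorem lam_mem (c : V → V) (v : V) (q : MvPolynomial σ K × MvPolynomial σ K)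
    (hq : q ∈ NN τ K c v) : xx τ K v * q.1 + yy τ K v * q.2 ∈ PC τ K c := by
  let lam : (MvPolynomial σ K × MvPolynomial σ K) →ₗ[MvPolynomial σ K] MvPolynomial σ K :=
    (LinearMap.mulLeft _ (xx τ K v)).coprod (LinearMap.mulLeft _ (yy τ K v))
  have : NN τ K c v ≤ Submodule.comap lam (PC τ K c) := by
    refine sup_le ?_ ?_
    · rintro ⟨a, b⟩ ⟨ha, hb⟩
      exact Ideal.add_mem _ (Ideal.mul_mem_left _ _ ha) (Ideal.mul_mem_left _ _ hb)
    · rw [Submodule.span_le]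
      rintro _ ⟨i, hi, rfl⟩
      have : xx τ K v * yy τ K i + yy τ K v * (- xx τ K i) = DD τ K v i := by
        simp [DD]; ring
      show xx τ K v * yy τ K i + yy τ K v * (- xx τ K i) ∈ PC τ K c
      rw [this]
      exact DD_mem τ hi.symm
  exact this hq

theorem qq_mem {c : V → V} {v i : V} (h : c i = c v) : qq τ K i ∈ NN τ K c v :=
  Submodule.mem_sup_right (Submodule.subset_span ⟨i, h, rfl⟩)

theorem prod_mem {c : V → V} {v : V} {a b : MvPolynomial σ K} (ha : a ∈ PC τ K c)
    (hb : b ∈ PC τ K c) : (a, b) ∈ NN τ K c v :=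
  Submodule.mem_sup_left ⟨ha, hb⟩

/-- kernel of the map to the x-quotient -/
theorem NN_sup (c : V → V) (v : V) :
    NN τ K c v ⊔ Submodule.span _ {((1, 0) : MvPolynomial σ K × MvPolynomial σ K)} =
      Submodule.comap (LinearMap.snd _ _ _) (PC τ K c ⊔ KZ K (XC τ c v)) := by
  apply le_antisymm
  · refine sup_le (sup_le ?_ ?_) ?_
    · rintro ⟨a, b⟩ ⟨ha, hb⟩
      exact Ideal.mem_sup_left hb
    · rw [Submodule.span_le]
      rintro _ ⟨i, hi, rfl⟩
      exact Ideal.mem_sup_right (neg_mem (Ideal.subset_span ⟨_, ⟨i, hi, rfl⟩, rfl⟩))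
    · rw [Submodule.span_le]
      rintro _ rfl
      exact Submodule.zero_mem (PC τ K c ⊔ KZ K (XC τ c v))
  · rintro ⟨a, b⟩ hab
    have hab : b ∈ PC τ K c ⊔ KZ K (XC τ c v) := hab
    have key : ∀ b ∈ PC τ K c ⊔ KZ K (XC τ c v), ((0, b) : MvPolynomial σ K × MvPolynomial σ K) ∈
        NN τ K c v ⊔ Submodule.span (MvPolynomial σ K)
          {((1, 0) : MvPolynomial σ K × MvPolynomial σ K)} := by
      have : PC τ K c ⊔ KZ K (XC τ c v) ≤ Submodule.comap
         (LinearMap.inr (MvPolynomial σ K) (MvPolynomial σ K) (MvPolynomial σ K))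
         (NN τ K c v ⊔ Submodule.span (MvPolynomial σ K)
           {((1, 0) : MvPolynomial σ K × MvPolynomial σ K)}) := by
        refine sup_le ?_ ?_
        · intro b hb
          exact Submodule.mem_sup_left (prod_mem τ (Ideal.zero_mem _) hb)
        · rw [KZ, Ideal.span, Submodule.span_le]
          rintro _ ⟨_, ⟨i, hi, rfl⟩, rfl⟩
          have e : ((0, X (τ (i, true))) : MvPolynomial σ K × MvPolynomial σ K) =
            - qq τ K i + yy τ K i • ((1, 0) : MvPolynomial σ K × MvPolynomial σ K) := by
            simp [qq, xx]
          rw [SetLike.mem_coe, Submodule.mem_comap, LinearMap.inr_apply, e]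
          exact Submodule.add_mem _ (Submodule.mem_sup_left (neg_mem (qq_mem τ hi)))
            (Submodule.mem_sup_right (Submodule.smul_mem _ _ (Submodule.mem_span_singleton_self _)))
      intro b hb
      exact this hb
    have e : ((a, b) : MvPolynomial σ K × MvPolynomial σ K) =
        a • ((1, 0) : MvPolynomial σ K × MvPolynomial σ K) + (0, b) := by simp
    rw [e]
    exact Submodule.add_mem _ (Submodule.mem_sup_right (Submodule.smul_mem _ _
      (Submodule.mem_span_singleton_self _))) (key b hab)

def quotXC (c : V → V) (v : V) : (MvPolynomial σ K ⧸ (PC τ K c ⊔ KZ K (XC τ c v))) ≃ₗ[MvPolynomial σ K]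
    ((MvPolynomial σ K × MvPolynomial σ K) ⧸
      (NN τ K c v ⊔ Submodule.span _ {((1, 0) : MvPolynomial σ K × MvPolynomial σ K)})) := by
  let f : (MvPolynomial σ K × MvPolynomial σ K) →ₗ[MvPolynomial σ K]
    (MvPolynomial σ K ⧸ (PC τ K c ⊔ KZ K (XC τ c v))) :=
    (Submodule.mkQ _).comp (LinearMap.snd _ _ _)
  have hf : Function.Surjective f :=
    (Submodule.mkQ_surjective _).comp LinearMap.snd_surjective
  have hk : LinearMap.ker f = NN τ K c v ⊔ Submodule.span _ {((1, 0) : MvPolynomial σ K × MvPolynomial σ K)} := by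
    rw [NN_sup, LinearMap.ker_comp, Submodule.ker_mkQ]
  exact ((Submodule.quotEquivOfEq _ _ hk.symm).trans (f.quotKerEquivOfSurjective hf)).symm

def prodQ (I : Ideal (MvPolynomial σ K)) :
    ((MvPolynomial σ K ⧸ I) × (MvPolynomial σ K ⧸ I)) ≃ₗ[MvPolynomial σ K]
    ((MvPolynomial σ K × MvPolynomial σ K) ⧸ (Submodule.prod I I)) := by
  let f : (MvPolynomial σ K × MvPolynomial σ K) →ₗ[MvPolynomial σ K]
    ((MvPolynomial σ K ⧸ I) × (MvPolynomial σ K ⧸ I)) :=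
    (Submodule.mkQ I).prodMap (Submodule.mkQ I)
  have hf : Function.Surjective f :=
    (Submodule.mkQ_surjective I).prodMap (Submodule.mkQ_surjective I)
  have hk : LinearMap.ker f = Submodule.prod I I := by
    rw [LinearMap.ker_prodMap, Submodule.ker_mkQ]
  exact ((Submodule.quotEquivOfEq _ _ hk.symm).trans (f.quotKerEquivOfSurjective hf)).symm

section step
variable [DecidableEq V]
theorem NN_step (c : V → V) (v w l : V) (hvw : v ≠ w) (hc : c w = c v) (hl : ∀ i, c i ≠ l) :
    NN τ K c v = NN τ K (Function.update c w l) v ⊔ Submodule.span _ {qq τ K w} := by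
  have upd : ∀ i, i ≠ w → Function.update c w l i = c i := fun i hi => Function.update_of_ne hi _ _
  have hq : ∀ i, c i = c v → qq τ K i ∈ NN τ K (Function.update c w l) v ⊔ Submodule.span _ {qq τ K w} := by
    intro i hi
    by_cases h : i = w
    · subst h
      exact Submodule.mem_sup_right (Submodule.mem_span_singleton_self _)
    · exact Submodule.mem_sup_left (qq_mem τ (by rw [upd i h, upd v hvw, hi]))
  have hD : ∀ i j, c i = c v → c j = c v →
      (DD τ K i j, 0) ∈ NN τ K (Function.update c w l) v ⊔ Submodule.span _ {qq τ K w} ∧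
      (0, DD τ K i j) ∈ NN τ K (Function.update c w l) v ⊔ Submodule.span _ {qq τ K w} := by
    intro i j hi hj
    have e1 : ((DD τ K i j, 0) : MvPolynomial σ K × MvPolynomial σ K) =
      xx τ K i • qq τ K j - xx τ K j • qq τ K i := by
      simp [DD, qq]; ring
    have e2 : ((0, DD τ K i j) : MvPolynomial σ K × MvPolynomial σ K) =
      yy τ K i • qq τ K j - yy τ K j • qq τ K i := by
      simp [DD, qq]; constructor <;> ring
    rw [e1, e2]
    exact ⟨Submodule.sub_mem _ (Submodule.smul_mem _ _ (hq j hj)) (Submodule.smul_mem _ _ (hq i hi)),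
      Submodule.sub_mem _ (Submodule.smul_mem _ _ (hq j hj)) (Submodule.smul_mem _ _ (hq i hi))⟩
  have hD' : ∀ i j, c i = c j →
      (DD τ K i j, 0) ∈ NN τ K (Function.update c w l) v ⊔ Submodule.span _ {qq τ K w} ∧
      (0, DD τ K i j) ∈ NN τ K (Function.update c w l) v ⊔ Submodule.span _ {qq τ K w} := by
    intro i j hij
    by_cases hi : c i = c v
    · exact hD i j hi (hij ▸ hi)
    · have hiw : i ≠ w := by rintro rfl; exact hi hc
      have hjw : j ≠ w := by rintro rfl; exact hi (hij.trans hc)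
      have : DD τ K i j ∈ PC τ K (Function.update c w l) :=
        DD_mem τ (by rw [upd i hiw, upd j hjw, hij])
      exact ⟨Submodule.mem_sup_left (prod_mem τ this (Ideal.zero_mem _)),
        Submodule.mem_sup_left (prod_mem τ (Ideal.zero_mem _) this)⟩
  have uu : ∀ i j, Function.update c w l i = Function.update c w l j → c i = c j := by
    intro i j h
    by_cases hi : i = w <;> by_cases hj : j = w
    · rw [hi, hj]
    · subst hi; rw [Function.update_self, upd j hj] at h; exact absurd h.symm (hl j)
    · subst hj; rw [Function.update_self, upd i hi] at h; exact absurd h (hl i)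
    · rwa [upd i hi, upd j hj] at h
  apply le_antisymm
  · refine sup_le ?_ ?_
    · have p1 : PC τ K c ≤ Submodule.comap (LinearMap.inl _ _ _)
        (NN τ K (Function.update c w l) v ⊔ Submodule.span _ {qq τ K w}) := by
        rw [PC, Ideal.span, Submodule.span_le]
        rintro _ ⟨i, j, hij, rfl⟩
        exact (hD' i j hij).1
      have p2 : PC τ K c ≤ Submodule.comap (LinearMap.inr _ _ _)
        (NN τ K (Function.update c w l) v ⊔ Submodule.span _ {qq τ K w}) := by
        rw [PC, Ideal.span, Submodule.span_le]
        rintro _ ⟨i, j, hij, rfl⟩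
        exact (hD' i j hij).2
      rintro ⟨a, b⟩ ⟨ha, hb⟩
      have h1 : ((a, 0) : MvPolynomial σ K × MvPolynomial σ K) ∈
        NN τ K (Function.update c w l) v ⊔ Submodule.span _ {qq τ K w} := p1 (show a ∈ PC τ K c from ha)
      have h2 : ((0, b) : MvPolynomial σ K × MvPolynomial σ K) ∈
        NN τ K (Function.update c w l) v ⊔ Submodule.span _ {qq τ K w} := p2 (show b ∈ PC τ K c from hb)
      have := Submodule.add_mem _ h1 h2
      simpa using this
    · rw [Submodule.span_le]
      rintro _ ⟨i, hi, rfl⟩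
      exact hq i hi
  · refine sup_le (sup_le ?_ ?_) ?_
    · have : PC τ K (Function.update c w l) ≤ PC τ K c := by
        rw [PC, Ideal.span_le]
        rintro _ ⟨i, j, hij, rfl⟩
        exact DD_mem τ (uu i j hij)
      rintro ⟨a, b⟩ ⟨ha, hb⟩
      exact prod_mem τ (this ha) (this hb)
    · rw [Submodule.span_le]
      rintro _ ⟨i, hi, rfl⟩
      exact qq_mem τ (uu i v hi)
    · rw [Submodule.span_le]
      rintro _ rfl
      exact qq_mem τ hc

theorem XC_step (c : V → V) (v w l : V) (hvw : v ≠ w) (hc : c w = c v) (hl : ∀ i, c i ≠ l) :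
    PC τ K c ⊔ KZ K (XC τ c v) =
      (PC τ K (Function.update c w l) ⊔ KZ K (XC τ (Function.update c w l) v)) ⊔
        Ideal.span {X (τ (w, true))} := by
  have upd : ∀ i, i ≠ w → Function.update c w l i = c i := fun i hi => Function.update_of_ne hi _ _
  have hX : XC τ c v = insert (τ (w, true)) (XC τ (Function.update c w l) v) := by
    ext z
    constructor
    · rintro ⟨i, hi, rfl⟩
      by_cases h : i = w
      · subst h; exact Set.mem_insert _ _
      · exact Set.mem_insert_of_mem _ ⟨i, by rw [upd i h, upd v hvw, hi], rfl⟩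
    · rintro (rfl | ⟨i, hi, rfl⟩)
      · exact ⟨w, hc, rfl⟩
      · refine ⟨i, ?_, rfl⟩
        by_cases h : i = w
        · subst h; exact hc
        · rwa [upd i h, upd v hvw] at hi
  rw [sup_assoc, ← KZ_insert, ← hX]
  apply le_antisymm
  · refine sup_le ?_ le_sup_right
    rw [PC, Ideal.span_le]
    rintro _ ⟨i, j, hij, rfl⟩
    by_cases hi : c i = c v
    · refine Ideal.mem_sup_right (Ideal.sub_mem _ (Ideal.mul_mem_right _ _ ?_) (Ideal.mul_mem_right _ _ ?_))
      · exact Ideal.subset_span ⟨_, ⟨i, hi, rfl⟩, rfl⟩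
      · exact Ideal.subset_span ⟨_, ⟨j, hij ▸ hi, rfl⟩, rfl⟩
    · have hiw : i ≠ w := by rintro rfl; exact hi hc
      have hjw : j ≠ w := by rintro rfl; exact hi (hij.trans hc)
      exact Ideal.mem_sup_left (DD_mem τ (by rw [upd i hiw, upd j hjw, hij]))
  · refine sup_le ?_ le_sup_right
    refine le_trans ?_ le_sup_left
    rw [PC, Ideal.span_le]
    rintro _ ⟨i, j, h, rfl⟩
    apply DD_mem τ
    by_cases hi : i = w <;> by_cases hj : j = w
    · rw [hi, hj]
    · subst hi; rw [Function.update_self, upd j hj] at h; exact absurd h.symm (hl j)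
    · subst hj; rw [Function.update_self, upd i hi] at h; exact absurd h (hl i)
    · rwa [upd i hi, upd j hj] at h

theorem rho_XC (c : V → V) (v : V) : ∀ g ∈ PC τ K c, rho K (XC τ c v) g ∈ PC τ K c := by
  apply rho_span
  rintro _ ⟨i, j, hij, rfl⟩
  by_cases hi : c i = c v
  · have h1 : τ (i, true) ∈ XC τ c v := ⟨i, hi, rfl⟩
    have h2 : τ (j, true) ∈ XC τ c v := ⟨j, hij ▸ hi, rfl⟩
    simp [DD, xx, yy, rho_X_mem h1, rho_X_mem h2]
  · have h1 : τ (i, true) ∉ XC τ c v := by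
      rintro ⟨k, hk, h⟩; simp at h; subst h; exact hi hk
    have h2 : τ (j, true) ∉ XC τ c v := by
      rintro ⟨k, hk, h⟩; simp at h; subst h; exact hi (hij.trans hk)
    have h3 : ∀ i, τ (i, false) ∉ XC τ c v := by
      rintro i ⟨k, hk, h⟩; simp at h
    have : rho K (XC τ c v) (DD τ K i j) = DD τ K i j := by
      simp [DD, xx, yy, rho_X_notMem h1, rho_X_notMem h2, rho_X_notMem (h3 _)]
    rw [this]; exact DD_mem τ hij

theorem single_part (c : V → V) (v : V) (hv : ∀ i, c i = c v → i = v) (b : ℕ)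
    (h : PDL (MvPolynomial σ K) (MvPolynomial σ K ⧸ PC τ K c) (b + 1)) :
    PDL (MvPolynomial σ K) ((MvPolynomial σ K × MvPolynomial σ K) ⧸ NN τ K c v) (b + 2) ∧
    PDL (MvPolynomial σ K) (MvPolynomial σ K ⧸ (PC τ K c ⊔ KZ K (XC τ c v))) (b + 2) := by
  have hs : {q | ∃ i, c i = c v ∧ q = qq τ K i} = {qq τ K v} := by
    ext q; constructor
    · rintro ⟨i, hi, rfl⟩; rw [hv i hi]; rfl
    · rintro rfl; exact ⟨v, rfl, rfl⟩
  have hx : XC τ c v = {τ (v, true)} := by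
    ext q; constructor
    · rintro ⟨i, hi, rfl⟩; rw [hv i hi]; rfl
    · rintro rfl; exact ⟨v, rfl, rfl⟩
  constructor
  · rw [NN, hs]
    refine PDL.cyc3 _ _ (PC τ K c) (fun g => ?_) h
      ((PDL.equiv (prodQ _) (PDL.prod h h)).mono (Nat.le_succ _))
    constructor
    · rintro ⟨h1, h2⟩
      have h1 : g * yy τ K v ∈ PC τ K c := h1
      exact ((PC_prime τ c).mem_or_mem h1).resolve_right (yy_notMem τ c v)
    · intro hg
      exact ⟨Ideal.mul_mem_right _ _ hg, Ideal.mul_mem_right _ _ hg⟩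
  · rw [hx, KZ, Set.image_singleton]
    exact PDL.ideal_sup _ (PC_prime τ c) _ (X_notMem τ c _) h

theorem inj_part (c : V → V) (hinj : Function.Injective c) :
    PDL (MvPolynomial σ K) (MvPolynomial σ K ⧸ PC τ K c) 1 := by
  have hP : PC τ K c = ⊥ := by
    rw [PC, Ideal.span_eq_bot]
    rintro _ ⟨i, j, hij, rfl⟩
    rw [hinj hij]; simp [DD]
  rw [hP]; exact PDL.zero_quot

theorem base_main [Fintype V] : ∀ (b : ℕ) (c : V → V),
    Fintype.card V ≤ b + (Finset.univ.image c).card →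
    PDL (MvPolynomial σ K) (MvPolynomial σ K ⧸ PC τ K c) (b + 1) ∧ ∀ v,
    PDL (MvPolynomial σ K) ((MvPolynomial σ K × MvPolynomial σ K) ⧸ NN τ K c v) (b + 2) ∧
    PDL (MvPolynomial σ K) (MvPolynomial σ K ⧸ (PC τ K c ⊔ KZ K (XC τ c v))) (b + 2) := by
  intro b
  induction b with
  | zero =>
    intro c hc
    have hinj : Function.Injective c := by
      rw [← Set.injOn_univ, ← Finset.coe_univ]
      apply Finset.injOn_of_card_image_eq
      apply le_antisymm Finset.card_image_le
      simpa using hc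
    have h1 := inj_part (K := K) τ c hinj
    exact ⟨h1, fun v => single_part τ c v (fun i hi => hinj hi) 0 h1⟩
  | succ b ih =>
    intro c hc
    have key : ∀ v w, v ≠ w → c w = c v →
      PDL (MvPolynomial σ K) ((MvPolynomial σ K × MvPolynomial σ K) ⧸ NN τ K c v) (b + 2) ∧
      PDL (MvPolynomial σ K) (MvPolynomial σ K ⧸ (PC τ K c ⊔ KZ K (XC τ c v))) (b + 3) := by
      intro v w hvw hcw
      have hns : ¬ Function.Surjective c := by
        intro hs
        exact hvw ((Finite.injective_iff_surjective.2 hs) hcw.symm)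
      simp only [Function.Surjective, not_forall, not_exists] at hns
      obtain ⟨l, hl⟩ := hns
      have himg : Finset.univ.image (Function.update c w l) = insert l (Finset.univ.image c) := by
        ext z
        simp only [Finset.mem_image, Finset.mem_univ, true_and, Finset.mem_insert]
        constructor
        · rintro ⟨i, rfl⟩
          by_cases h : i = w
          · subst h; left; simp
          · right; exact ⟨i, by rw [Function.update_of_ne h]⟩
        · rintro (rfl | ⟨i, rfl⟩)
          · exact ⟨w, by simp⟩
          · by_cases h : i = w
            · subst h; exact ⟨v, by rw [Function.update_of_ne hvw, hcw]⟩
            · exact ⟨i, by rw [Function.update_of_ne h]⟩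
      have hcard : (Finset.univ.image (Function.update c w l)).card = (Finset.univ.image c).card + 1 := by
        rw [himg, Finset.card_insert_of_notMem]
        simpa using hl
      obtain ⟨hR, hMY⟩ := ih (Function.update c w l) (by omega)
      obtain ⟨hM, hY⟩ := hMY v
      have hne : Function.update c w l v ≠ Function.update c w l w := by
        rw [Function.update_self, Function.update_of_ne hvw]; exact hl v
      constructor
      · rw [NN_step τ c v w l hvw hcw hl]
        refine PDL.cyc3 _ _ _ (fun g => ?_) hR hM
        constructor
        · intro hg
          have := lam_mem τ _ v _ hg
          have e : xx τ K v * (g • qq τ K w).1 + yy τ K v * (g • qq τ K w).2 = g * DD τ K v w := by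
            simp [qq, DD]; ring
          rw [e] at this
          exact ((PC_prime τ _).mem_or_mem this).resolve_right (DD_notMem τ _ _ _ hne)
        · intro hg
          exact prod_mem τ (Ideal.mul_mem_right _ _ hg) (Ideal.mul_mem_right _ _ hg)
      · rw [XC_step τ c v w l hvw hcw hl]
        refine PDL.ideal_sup _ (sup_KZ_prime _ (PC_prime τ _) _ (rho_XC τ _ v)) _ ?_ hY
        refine sup_KZ_notMem _ _ (rho_XC τ _ v) _ ?_ (X_notMem τ _ _)
        rintro ⟨i, hi, h⟩
        simp at h
        subst h
        exact hne hi.symm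
    have hR : PDL (MvPolynomial σ K) (MvPolynomial σ K ⧸ PC τ K c) (b + 2) := by
      by_cases hinj : Function.Injective c
      · exact (inj_part τ c hinj).mono (by omega)
      · simp only [Function.Injective, not_forall] at hinj
        obtain ⟨v, w, h, hvw⟩ := hinj
        obtain ⟨hM, hY⟩ := key v w hvw h.symm
        refine PDL.cyc1 (NN τ K c v) (1, 0) (PC τ K c) (fun g => ?_) hM (PDL.equiv (quotXC τ c v) hY)
        constructor
        · intro hg
          have := lam_mem τ _ v _ hg
          have e : xx τ K v * (g • ((1, 0) : MvPolynomial σ K × MvPolynomial σ K)).1 +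
            yy τ K v * (g • ((1, 0) : MvPolynomial σ K × MvPolynomial σ K)).2 = g * xx τ K v := by
            simp; ring
          rw [e] at this
          exact ((PC_prime τ _).mem_or_mem this).resolve_right (xx_notMem τ _ _)
        · intro hg
          have := prod_mem (v := v) τ hg (Ideal.zero_mem (PC τ K c))
          simpa using this
    refine ⟨hR, fun v => ?_⟩
    by_cases hv : ∀ i, c i = c v → i = v
    · exact single_part τ c v hv _ hR
    · simp only [not_forall] at hv
      obtain ⟨w, hw, hwv⟩ := hv
      obtain ⟨hM, hY⟩ := key v w (Ne.symm hwv) hw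
      exact ⟨hM.mono (by omega), hY⟩

end step
end Seg

namespace Seg
variable {V σ : Type} {K : Type} [Field K] (τ : V × Bool ≃ σ)

def pv (U : Finset V) : Finset σ := (U ×ˢ (Finset.univ : Finset Bool)).map τ.toEmbedding

theorem mem_pv (U : Finset V) (i : V) (b : Bool) : τ (i, b) ∈ pv τ U ↔ i ∈ U := by
  simp [pv]

theorem DD_KZ (U : Finset V) (i j : V) (h : i ∈ U ∨ j ∈ U) : DD τ K i j ∈ KZ K (pv τ U : Set σ) := by
  have hX : ∀ i b, i ∈ U → (X (τ (i, b)) : MvPolynomial σ K) ∈ KZ K (pv τ U : Set σ) :=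
    fun i b hi => Ideal.subset_span ⟨_, (mem_pv τ U i b).2 hi, rfl⟩
  rcases h with h | h
  · exact Ideal.sub_mem _ (Ideal.mul_mem_right _ _ (hX i _ h)) (Ideal.mul_mem_left _ _ (hX i _ h))
  · exact Ideal.sub_mem _ (Ideal.mul_mem_left _ _ (hX j _ h)) (Ideal.mul_mem_right _ _ (hX j _ h))

theorem DD_self (i : V) : DD τ K i i = 0 := by simp [DD]

theorem base_kill [DecidableEq V] [Fintype V] (c : V → V) (U : Finset V) (b : ℕ)
    (hb : Fintype.card V + U.card ≤ b + (Uᶜ.image c).card) :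
    (PC τ K c ⊔ KZ K (pv τ U : Set σ)).IsPrime ∧
    PDL (MvPolynomial σ K) (MvPolynomial σ K ⧸ (PC τ K c ⊔ KZ K (pv τ U : Set σ))) (b + 1) := by
  rcases isEmpty_or_nonempty V with hV | hV
  · have hU : U = ∅ := Finset.eq_empty_of_isEmpty U
    have : PC τ K c ⊔ KZ K (pv τ U : Set σ) = PC τ K c := by
      subst hU; simp [KZ, pv]
    rw [this]
    exact ⟨PC_prime τ c, (inj_part τ c (fun i => isEmptyElim i)).mono (by omega)⟩
  let c' : V → V := fun i => if i ∈ U then i else Function.invFunOn c (Uᶜ : Finset V) (c i)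
  have c1 : ∀ i, i ∈ U → c' i = i := fun i hi => by simp [c', hi]
  have c2 : ∀ i, i ∉ U → c' i ∉ U ∧ c (c' i) = c i := by
    intro i hi
    have hex : ∃ a ∈ ((Uᶜ : Finset V) : Set V), c a = c i := ⟨i, by simpa using hi, rfl⟩
    have h1 := Function.invFunOn_mem hex
    have h2 := Function.invFunOn_eq hex
    have e : c' i = Function.invFunOn c (Uᶜ : Finset V) (c i) := by simp [c', hi]
    rw [e]
    exact ⟨by simpa using h1, h2⟩
  have c3 : ∀ i j, i ∉ U → j ∉ U → c i = c j → c' i = c' j := by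
    intro i j hi hj h
    simp [c', hi, hj, h]
  have c4 : ∀ i j, c' i = c' j → (i = j) ∨ (i ∉ U ∧ j ∉ U ∧ c i = c j) := by
    intro i j h
    by_cases hi : i ∈ U <;> by_cases hj : j ∈ U
    · left; rwa [c1 i hi, c1 j hj] at h
    · exfalso; rw [c1 i hi] at h; exact (c2 j hj).1 (h ▸ hi)
    · exfalso; rw [c1 j hj] at h; exact (c2 i hi).1 (h ▸ hj)
    · right; exact ⟨hi, hj, by rw [← (c2 i hi).2, ← (c2 j hj).2, h]⟩
  have heq : PC τ K c ⊔ KZ K (pv τ U : Set σ) = PC τ K c' ⊔ KZ K (pv τ U : Set σ) := by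
    apply le_antisymm
    · refine sup_le ?_ le_sup_right
      rw [PC, Ideal.span_le]
      rintro _ ⟨i, j, hij, rfl⟩
      by_cases h : i ∈ U ∨ j ∈ U
      · exact Ideal.mem_sup_right (DD_KZ τ U i j h)
      · push Not at h
        exact Ideal.mem_sup_left (DD_mem τ (c3 i j h.1 h.2 hij))
    · refine sup_le ?_ le_sup_right
      rw [PC, Ideal.span_le]
      rintro _ ⟨i, j, hij, rfl⟩
      rcases c4 i j hij with rfl | h
      · rw [DD_self]; exact Ideal.zero_mem _
      · exact Ideal.mem_sup_left (DD_mem τ h.2.2)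
  have hrho : ∀ Z' : Set σ, Z' ⊆ (pv τ U : Set σ) → ∀ g ∈ PC τ K c', rho K Z' g ∈ PC τ K c' := by
    intro Z' hZ'
    apply rho_span
    rintro _ ⟨i, j, hij, rfl⟩
    rcases c4 i j hij with rfl | h
    · rw [DD_self, map_zero]; exact Ideal.zero_mem _
    · have hn : ∀ i b, i ∉ U → τ (i, b) ∉ Z' := fun i b hi hz =>
        hi ((mem_pv τ U i b).1 (hZ' hz))
      have : rho K Z' (DD τ K i j) = DD τ K i j := by
        simp [DD, xx, yy, rho_X_notMem (hn i _ h.1), rho_X_notMem (hn j _ h.2.1)]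
      rw [this]; exact DD_mem τ hij
  rw [heq]
  refine ⟨sup_KZ_prime _ (PC_prime τ c') _ (hrho _ le_rfl), ?_⟩
  have hcard : U.card + (Uᶜ.image c).card ≤ (Finset.univ.image c').card := by
    have h1 : U ∪ Uᶜ.image c' ⊆ Finset.univ.image c' := by
      intro i hi
      rcases Finset.mem_union.1 hi with h | h
      · exact Finset.mem_image.2 ⟨i, Finset.mem_univ _, c1 i h⟩
      · exact Finset.image_subset_image (Finset.subset_univ _) h
    have h2 : Disjoint U (Uᶜ.image c') := by
      rw [Finset.disjoint_right]
      intro i hi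
      obtain ⟨j, hj, rfl⟩ := Finset.mem_image.1 hi
      exact (c2 j (by simpa using hj)).1
    have h3 : Uᶜ.image c ⊆ (Uᶜ.image c').image c := by
      intro l hl
      obtain ⟨j, hj, rfl⟩ := Finset.mem_image.1 hl
      exact Finset.mem_image.2 ⟨c' j, Finset.mem_image_of_mem _ hj, (c2 j (by simpa using hj)).2⟩
    have h4 := Finset.card_le_card h1
    rw [Finset.card_union_of_disjoint h2] at h4
    have h5 := (Finset.card_le_card h3).trans Finset.card_image_le
    omega
  have hle : U.card + (Uᶜ.image c).card ≤ Fintype.card V := by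
    have := Finset.card_image_le (s := Uᶜ) (f := c)
    have := Finset.card_add_card_compl U
    omega
  have hmain := (base_main (K := K) τ (Fintype.card V - (U.card + (Uᶜ.image c).card)) c' (by omega)).1
  have hk := pd_kill (PC τ K c') (PC_prime τ c') (X_notMem τ c') _ hmain (pv τ U) hrho
  refine hk.mono ?_
  have : (pv τ U).card = U.card * 2 := by simp [pv]
  omega

theorem inter_lem (J : Ideal (MvPolynomial σ K)) (T : Set (MvPolynomial σ K)) (Z : Set σ)
    (hJ : ∀ g ∈ J, rho K Z g ∈ J) (hT : ∀ t ∈ T, rho K Z t = t)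
    (hZ : ∀ z ∈ Z, ∀ t ∈ T, X z * t ∈ J) :
    J = (J ⊔ Ideal.span T) ⊓ (J ⊔ KZ K Z) := by
  apply le_antisymm (le_inf le_sup_left le_sup_left)
  rintro g ⟨h1, h2⟩
  rw [SetLike.mem_coe, sup_KZ J Z hJ, Ideal.mem_comap] at h2
  obtain ⟨j, hj, e, he, rfl⟩ := Submodule.mem_sup.1 h1
  have hk : ∀ t ∈ T, ∀ k ∈ KZ K Z, k * t ∈ J := by
    intro t ht k hk
    have : KZ K Z ≤ Submodule.comap (LinearMap.mulRight (MvPolynomial σ K) t) J := by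
      rw [KZ, Ideal.span, Submodule.span_le]
      rintro _ ⟨z, hz, rfl⟩
      exact hZ z hz t ht
    exact this hk
  have key : ∀ e ∈ Ideal.span T, (∀ k ∈ KZ K Z, k * e ∈ J) ∧ e - rho K Z e ∈ J := by
    intro e he
    induction he using Submodule.span_induction with
    | mem t ht => exact ⟨hk t ht, by rw [hT t ht, sub_self]; exact J.zero_mem⟩
    | zero => simp
    | add x y _ _ hx hy =>
      refine ⟨fun k hk => ?_, ?_⟩
      · rw [mul_add]; exact J.add_mem (hx.1 k hk) (hy.1 k hk)
      · rw [map_add, add_sub_add_comm]; exact J.add_mem hx.2 hy.2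
    | smul a x _ hx =>
      refine ⟨fun k hk => ?_, ?_⟩
      · rw [smul_eq_mul, mul_left_comm]; exact J.mul_mem_left _ (hx.1 k hk)
      · have : a • x - rho K Z (a • x) = (a - rho K Z a) * x + rho K Z a * (x - rho K Z x) := by
          rw [smul_eq_mul, map_mul]; ring
        rw [this]
        exact J.add_mem (hx.1 _ (sub_rho Z a)) (J.mul_mem_left _ hx.2)
  replace key := key e he
  rw [map_add] at h2
  have h3 : rho K Z e ∈ J := by
    have := J.sub_mem h2 (hJ j hj)
    simpa using this
  refine J.add_mem hj ?_
  have := J.add_mem key.2 h3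
  simpa using this


def JG (K : Type) [Field K] (c : V → V) (U : Finset V) (H : List (V × V)) (f : MvPolynomial σ K) :
    Set (MvPolynomial σ K) :=
  {g | (∃ i j, c i = c j ∧ g = DD τ K i j) ∨ (∃ i b, i ∈ U ∧ g = X (τ (i, b))) ∨
    (∃ p ∈ H, g = DD τ K p.1 p.2) ∨ g = f}

def JJ (K : Type) [Field K] (c : V → V) (U : Finset V) (H : List (V × V)) (f : MvPolynomial σ K) :
    Ideal (MvPolynomial σ K) := Ideal.span (JG τ K c U H f)

theorem JJ_le {c : V → V} {U : Finset V} {H : List (V × V)} {f : MvPolynomial σ K}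
    {I : Ideal (MvPolynomial σ K)} (h1 : ∀ i j, c i = c j → DD τ K i j ∈ I)
    (h2 : ∀ i b, i ∈ U → X (τ (i, b)) ∈ I) (h3 : ∀ p ∈ H, DD τ K p.1 p.2 ∈ I) (h4 : f ∈ I) :
    JJ τ K c U H f ≤ I := by
  rw [JJ, Ideal.span_le]
  rintro _ (⟨i, j, h, rfl⟩ | ⟨i, b, h, rfl⟩ | ⟨p, h, rfl⟩ | rfl)
  · exact h1 i j h
  · exact h2 i b h
  · exact h3 p h
  · exact h4

variable {c : V → V} {U : Finset V} {H : List (V × V)} {f : MvPolynomial σ K}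

theorem JJ1 {i j} (h : c i = c j) : DD τ K i j ∈ JJ τ K c U H f :=
  Ideal.subset_span (Or.inl ⟨i, j, h, rfl⟩)
theorem JJ2 {i} (b) (h : i ∈ U) : X (τ (i, b)) ∈ JJ τ K c U H f :=
  Ideal.subset_span (Or.inr (Or.inl ⟨i, b, h, rfl⟩))
theorem JJ3 {i j} (h : (i, j) ∈ H) : DD τ K i j ∈ JJ τ K c U H f :=
  Ideal.subset_span (Or.inr (Or.inr (Or.inl ⟨_, h, rfl⟩)))
theorem JJ4 : f ∈ JJ τ K c U H f :=
  Ideal.subset_span (Or.inr (Or.inr (Or.inr rfl)))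
theorem JJ5 {i j} (h : i ∈ U ∨ j ∈ U) : DD τ K i j ∈ JJ τ K c U H f := by
  rcases h with h | h
  · exact Ideal.sub_mem _ (Ideal.mul_mem_right _ _ (JJ2 τ _ h)) (Ideal.mul_mem_left _ _ (JJ2 τ _ h))
  · exact Ideal.sub_mem _ (Ideal.mul_mem_left _ _ (JJ2 τ _ h)) (Ideal.mul_mem_right _ _ (JJ2 τ _ h))

theorem JJ_mono {H' : List (V × V)} {U' : Finset V} (hU : U ⊆ U') (hH : ∀ p ∈ H, p ∈ H' ∨ p.1 ∈ U' ∨ p.2 ∈ U') :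
    JJ τ K c U H f ≤ JJ τ K c U' H' f := by
  refine JJ_le τ (fun i j h => JJ1 τ h) (fun i b h => JJ2 τ b (hU h)) (fun p hp => ?_) (JJ4 τ)
  rcases hH p hp with h | h
  · exact JJ3 τ h
  · exact JJ5 τ h

theorem rho_DD (v i j : V) : rho K (pv τ {v} : Set σ) (DD τ K i j) = DD τ K i j ∨
    rho K (pv τ {v} : Set σ) (DD τ K i j) = 0 := by
  by_cases h : i = v ∨ j = v
  · right
    exact rho_KZ _ _ (DD_KZ τ _ i j (by simpa using h))
  · left
    have hn : ∀ i b, i ≠ v → τ (i, b) ∉ (pv τ {v} : Set σ) := by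
      intro i b hi h
      have := (mem_pv τ _ _ _).1 h
      simp at this; exact hi this
    push Not at h
    simp [DD, xx, yy, rho_X_notMem (hn _ _ h.1), rho_X_notMem (hn _ _ h.2)]

theorem rho_DD' (v i j : V) (hi : i ≠ v) (hj : j ≠ v) :
    rho K (pv τ {v} : Set σ) (DD τ K i j) = DD τ K i j := by
  have hn : ∀ i b, i ≠ v → τ (i, b) ∉ (pv τ {v} : Set σ) := by
    intro i b hi h
    have := (mem_pv τ _ _ _).1 h
    simp at this; exact hi this
  simp [DD, xx, yy, rho_X_notMem (hn _ _ hi), rho_X_notMem (hn _ _ hj)]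

theorem rho_JJ (v : V) (hf : rho K (pv τ {v} : Set σ) f = f ∨ rho K (pv τ {v} : Set σ) f = 0) :
    ∀ g ∈ JJ τ K c U H f, rho K (pv τ {v} : Set σ) g ∈ JJ τ K c U H f := by
  apply rho_span
  intro g hg
  have : rho K (pv τ {v} : Set σ) g = g ∨ rho K (pv τ {v} : Set σ) g = 0 := by
    rcases hg with ⟨i, j, h, rfl⟩ | ⟨i, b, h, rfl⟩ | ⟨p, h, rfl⟩ | rfl
    · exact rho_DD τ v i j
    · by_cases h : τ (i, b) ∈ (pv τ {v} : Set σ)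
      · right; exact rho_X_mem h
      · left; exact rho_X_notMem h
    · exact rho_DD τ v _ _
    · exact hf
  rcases this with h | h
  · rw [h]; exact Ideal.subset_span hg
  · rw [h]; exact Ideal.zero_mem _

theorem list_main [DecidableEq V] [Fintype V] (f : MvPolynomial σ K)
    (hf : ∀ v, rho K (pv τ {v} : Set σ) f = f ∨ rho K (pv τ {v} : Set σ) f = 0) :
    ∀ (H : List (V × V)) (c : V → V) (U : Finset V) (N : ℕ),
    (∀ p ∈ H, p.1 ≠ p.2) → H.Pairwise (fun p q => q.1 ≠ p.1 ∧ q.1 ≠ p.2) →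
    (∀ p ∈ H, p.1 ∉ U ∧ ∀ i, c i = c p.1 → i = p.1) →
    Fintype.card V + U.card + H.length + 1 ≤ N + (Uᶜ.image c).card →
    PDL (MvPolynomial σ K) (MvPolynomial σ K ⧸ JJ τ K c U H f) (N + 1) := by
  intro H
  induction H with
  | nil =>
    intro c U N _ _ _ hN
    have hle : (Uᶜ.image c).card ≤ Fintype.card V := Finset.card_le_univ _
    obtain ⟨M, rfl⟩ : ∃ M, N = M + 1 := ⟨N - 1, by simp at hN; omega⟩
    obtain ⟨hp, hd⟩ := base_kill (K := K) τ c U M (by simp at hN; omega)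
    have e : JJ τ K c U [] f = PC τ K c ⊔ KZ K (pv τ U : Set σ) ⊔ Ideal.span {f} := by
      apply le_antisymm
      · refine JJ_le τ ?_ ?_ (by simp) (Ideal.mem_sup_right (Ideal.mem_span_singleton_self _))
        · exact fun i j h => Ideal.mem_sup_left (Ideal.mem_sup_left (DD_mem τ h))
        · exact fun i b h => Ideal.mem_sup_left (Ideal.mem_sup_right (Ideal.subset_span
            ⟨_, (mem_pv τ U i b).2 h, rfl⟩))
      · refine sup_le (sup_le ?_ ?_) ?_
        · rw [PC, Ideal.span_le]
          rintro _ ⟨i, j, h, rfl⟩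
          exact JJ1 τ h
        · rw [KZ, Ideal.span_le]
          rintro _ ⟨z, hz, rfl⟩
          obtain ⟨⟨i, b⟩, rfl⟩ := τ.surjective z
          exact JJ2 τ b ((mem_pv τ U i b).1 hz)
        · rw [Ideal.span_singleton_le_iff_mem]; exact JJ4 τ
    rw [e]
    by_cases hfP : f ∈ PC τ K c ⊔ KZ K (pv τ U : Set σ)
    · rw [sup_eq_left.2 ((Ideal.span_singleton_le_iff_mem _).2 hfP)]
      exact hd.mono (by omega)
    · exact PDL.ideal_sup _ hp _ hfP hd
  | cons p T ih =>
    obtain ⟨w, v⟩ := p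
    intro c U N h1 h2 h3 hN
    have hwv : w ≠ v := h1 (w, v) (by simp)
    have h1T : ∀ p ∈ T, p.1 ≠ p.2 := fun p hp => h1 p (by simp [hp])
    rw [List.pairwise_cons] at h2
    obtain ⟨h2a, h2T⟩ := h2
    simp only at h2a
    have hwU : w ∉ U := (h3 (w, v) (by simp)).1
    have hws : ∀ i, c i = c w → i = w := (h3 (w, v) (by simp)).2
    have h3T : ∀ p ∈ T, p.1 ∉ U ∧ ∀ i, c i = c p.1 → i = p.1 := fun p hp => h3 p (by simp [hp])
    rw [List.length_cons] at hN
    by_cases hvU : v ∈ U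
    · have e : JJ τ K c U ((w, v) :: T) f = JJ τ K c U T f := by
        apply le_antisymm
        · refine JJ_mono τ le_rfl (fun p hp => ?_)
          rcases List.mem_cons.1 hp with rfl | hp
          · right; right; exact hvU
          · left; exact hp
        · exact JJ_mono τ le_rfl (fun p hp => Or.inl (by simp [hp]))
      rw [e]
      exact ih c U N h1T h2T h3T (by omega)
    set c' : V → V := Function.update c w (c v) with hc'
    have cw : c' w = c v := Function.update_self _ _ _
    have cn : ∀ i, i ≠ w → c' i = c i := fun i hi => Function.update_of_ne hi _ _
    have h3T' : ∀ p ∈ T, p.1 ∉ insert v U ∧ ∀ i, c' i = c' p.1 → i = p.1 := by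
      intro p hp
      refine ⟨by simpa using ⟨(h2a p hp).2, (h3T p hp).1⟩, fun i hi => ?_⟩
      rw [cn p.1 (h2a p hp).1] at hi
      by_cases h : i = w
      · subst h; rw [cw] at hi
        exact absurd ((h3T p hp).2 v hi).symm (h2a p hp).2
      · rw [cn i h] at hi; exact (h3T p hp).2 i hi
    -- comparison
    have cle : ∀ i j, c i = c j → c' i = c' j := by
      intro i j h
      by_cases hi : i = w
      · subst hi; rw [hws j h.symm]
      · by_cases hj : j = w
        · subst hj; rw [hws i h]
        · rw [cn i hi, cn j hj, h]
    have hA1 : ∀ U', JJ τ K c U' ((w, v) :: T) f ≤ JJ τ K c' U' T f := by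
      intro U'
      refine JJ_le τ (fun i j h => JJ1 τ (cle i j h)) (fun i b h => JJ2 τ b h) (fun p hp => ?_) (JJ4 τ)
      rcases List.mem_cons.1 hp with rfl | hp
      · exact JJ1 τ (by rw [cw, cn v hwv.symm])
      · exact JJ3 τ hp
    have hA2 : ∀ I : Ideal (MvPolynomial σ K), JJ τ K c U ((w, v) :: T) f ≤ I →
        (∀ q, c q = c v → q ≠ v → DD τ K w q ∈ I) → JJ τ K c' U T f ≤ I := by
      intro I hI hq
      have hq' : ∀ q, c q = c v → DD τ K w q ∈ I := by
        intro q hqv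
        by_cases h : q = v
        · subst h; exact hI (JJ3 τ (by simp))
        · exact hq q hqv h
      have sw : ∀ i j, DD τ K i j = - DD τ K j i := by intro i j; simp [DD]
      refine JJ_le τ (fun i j h => ?_) (fun i b h => hI (JJ2 τ b h)) (fun p hp => hI (JJ3 τ (by simp [hp]))) (hI (JJ4 τ))
      by_cases hi : i = w <;> by_cases hj : j = w
      · rw [hi, hj, DD_self]; exact I.zero_mem
      · subst hi; rw [cw, cn j hj] at h; exact hq' j h.symm
      · subst hj; rw [cw, cn i hi] at h; rw [sw]; exact I.neg_mem (hq' i h)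
      · rw [cn i hi, cn j hj] at h; exact hI (JJ1 τ h)
    by_cases hlive : ∃ u, u ∉ U ∧ c u = c v ∧ u ≠ v
    · obtain ⟨u, huU, huv, hune⟩ := hlive
      have huw : u ≠ w := by rintro rfl; exact hwv (hws v huv.symm).symm
      have eA : JJ τ K c' U T f = JJ τ K c U ((w, v) :: T) f ⊔
          Ideal.span {g | ∃ q, c q = c v ∧ q ≠ v ∧ g = DD τ K w q} := by
        apply le_antisymm
        · exact hA2 _ le_sup_left (fun q h h' => Ideal.mem_sup_right (Ideal.subset_span ⟨q, h, h', rfl⟩))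
        · refine sup_le (hA1 U) ?_
          rw [Ideal.span_le]
          rintro _ ⟨q, hq, hqv, rfl⟩
          refine JJ1 τ ?_
          have : q ≠ w := by rintro rfl; exact hwv (hws v hq.symm).symm
          rw [cw, cn q this, hq]
      have KZle : ∀ (U' : Finset V) (cc : V → V) H, v ∈ U' → KZ K (pv τ {v} : Set σ) ≤ JJ τ K cc U' H f := by
        intro U' cc H hv
        rw [KZ, Ideal.span_le]
        rintro _ ⟨z, hz, rfl⟩
        obtain ⟨⟨i, b⟩, rfl⟩ := τ.surjective z
        have := (mem_pv τ _ i b).1 hz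
        simp at this
        subst this
        exact JJ2 τ b hv
      have Xv : ∀ b, (X (τ (v, b)) : MvPolynomial σ K) ∈ KZ K (pv τ {v} : Set σ) := fun b =>
        Ideal.subset_span ⟨_, (mem_pv τ _ _ _).2 (by simp), rfl⟩
      have gen : ∀ (cc : V → V) (H T : List (V × V)), (∀ p ∈ T, p ∈ H) → (∀ p ∈ H, p ∈ T ∨ p = (w, v)) → 
          JJ τ K cc (insert v U) T f = JJ τ K cc U H f ⊔ KZ K (pv τ {v} : Set σ) := by
        intro cc H T hTH hHT
        apply le_antisymm
        · refine JJ_le τ (fun i j h => Ideal.mem_sup_left (JJ1 τ h)) (fun i b h => ?_)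
            (fun p hp => Ideal.mem_sup_left (JJ3 τ (hTH p hp))) (Ideal.mem_sup_left (JJ4 τ))
          rcases Finset.mem_insert.1 h with rfl | h
          · exact Ideal.mem_sup_right (Xv b)
          · exact Ideal.mem_sup_left (JJ2 τ b h)
        · refine sup_le (JJ_mono τ (Finset.subset_insert _ _) (fun p hp => ?_)) (KZle _ _ _ (by simp))
          rcases hHT p hp with h | rfl
          · exact Or.inl h
          · right; right; simp
      have eB := gen c ((w, v) :: T) T (fun p hp => by simp [hp]) (fun p hp => by
        rcases List.mem_cons.1 hp with h | h
        · exact Or.inr h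
        · exact Or.inl h)
      have eAB := gen c' T T (fun p hp => hp) (fun p hp => Or.inl hp)
      have cU : (insert v U).card = U.card + 1 := Finset.card_insert_of_notMem hvU
      have i1 : (Uᶜ.image c).card ≤ (Uᶜ.image c').card + 1 := by
        refine (Finset.card_le_card (t := insert (c w) (Uᶜ.image c')) ?_).trans (Finset.card_insert_le _ _)
        intro l hl
        obtain ⟨i, hi, rfl⟩ := Finset.mem_image.1 hl
        by_cases h : i = w
        · subst h; simp
        · exact Finset.mem_insert_of_mem (Finset.mem_image.2 ⟨i, hi, cn i h⟩)
      have i2 : (Uᶜ.image c).card ≤ ((insert v U)ᶜ.image c).card := by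
        refine Finset.card_le_card ?_
        intro l hl
        obtain ⟨i, hi, rfl⟩ := Finset.mem_image.1 hl
        by_cases h : i = v
        · subst h; exact Finset.mem_image.2 ⟨u, by simp [huU, hune], huv⟩
        · exact Finset.mem_image.2 ⟨i, by simpa [h] using hi, rfl⟩
      have i3 : (Uᶜ.image c).card ≤ ((insert v U)ᶜ.image c').card + 1 := by
        refine (Finset.card_le_card (t := insert (c w) ((insert v U)ᶜ.image c')) ?_).trans (Finset.card_insert_le _ _)
        intro l hl
        obtain ⟨i, hi, rfl⟩ := Finset.mem_image.1 hl
        by_cases h : i = w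
        · subst h; simp
        · refine Finset.mem_insert_of_mem ?_
          by_cases h' : i = v
          · subst h'; exact Finset.mem_image.2 ⟨u, by simp [huU, hune], by rw [cn u huw, huv]⟩
          · exact Finset.mem_image.2 ⟨i, by simpa [h'] using hi, cn i h⟩
      have pA := ih c' U N h1T h2T (fun p hp => ⟨(h3T p hp).1, (h3T' p hp).2⟩) (by omega)
      have pB := ih c (insert v U) N h1T h2T (fun p hp => ⟨(h3T' p hp).1, (h3T p hp).2⟩) (by omega)
      have pAB := ih c' (insert v U) (N + 1) h1T h2T h3T' (by omega)
      have hJ : JJ τ K c U ((w, v) :: T) f = JJ τ K c' U T f ⊓ JJ τ K c (insert v U) T f := by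
        rw [eA, eB]
        refine inter_lem _ _ _ (rho_JJ τ v (hf v)) ?_ ?_
        · rintro _ ⟨q, hq, hqv, rfl⟩
          exact rho_DD' τ v w q hwv hqv
        · rintro z hz _ ⟨q, hq, hqv, rfl⟩
          obtain ⟨⟨i, b⟩, rfl⟩ := τ.surjective z
          have := (mem_pv τ _ i b).1 hz
          simp at this
          subst this
          have m1 : DD τ K i q ∈ JJ τ K c U ((w, i) :: T) f := JJ1 τ hq.symm
          have m2 : DD τ K w i ∈ JJ τ K c U ((w, i) :: T) f := JJ3 τ (by simp)
          cases b
          · have : X (τ (i, false)) * DD τ K w q = yy τ K w * DD τ K i q + yy τ K q * DD τ K w i := by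
              simp only [DD, xx, yy]; ring
            rw [this]
            exact Ideal.add_mem _ (Ideal.mul_mem_left _ _ m1) (Ideal.mul_mem_left _ _ m2)
          · have : X (τ (i, true)) * DD τ K w q = xx τ K w * DD τ K i q + xx τ K q * DD τ K w i := by
              simp only [DD, xx, yy]; ring
            rw [this]
            exact Ideal.add_mem _ (Ideal.mul_mem_left _ _ m1) (Ideal.mul_mem_left _ _ m2)
      refine PDL.mv _ _ _ hJ pA pB ?_
      have : JJ τ K c' U T f ⊔ JJ τ K c (insert v U) T f = JJ τ K c' (insert v U) T f := by
        rw [eAB, eB, ← sup_assoc, sup_eq_left.2 (hA1 U)]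
      rw [this]
      exact pAB
    · push Not at hlive
      have e : JJ τ K c U ((w, v) :: T) f = JJ τ K c' U T f := by
        apply le_antisymm (hA1 U)
        refine hA2 _ le_rfl (fun q hq hqv => JJ5 τ (Or.inr ?_))
        by_contra h
        exact hqv (hlive q h hq)
      rw [e]
      have i1 : (Uᶜ.image c).card ≤ (Uᶜ.image c').card + 1 := by
        refine (Finset.card_le_card (t := insert (c w) (Uᶜ.image c')) ?_).trans (Finset.card_insert_le _ _)
        intro l hl
        obtain ⟨i, hi, rfl⟩ := Finset.mem_image.1 hl
        by_cases h : i = w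
        · subst h; simp
        · exact Finset.mem_insert_of_mem (Finset.mem_image.2 ⟨i, hi, cn i h⟩)
      exact ih c' U N h1T h2T (fun p hp => ⟨(h3T p hp).1, (h3T' p hp).2⟩) (by omega)

end Seg

namespace Seg

theorem tree_list {V : Type} [DecidableEq V] [Fintype V] (T : SimpleGraph V) (hT : T.Connected) :
    ∀ k, k + 1 ≤ Fintype.card V → ∃ (H : List (V × V)) (A : Finset V), H.length = k ∧ A.card = k + 1 ∧
      (∀ p ∈ H, p.1 ∈ A ∧ p.2 ∈ A ∧ T.Adj p.1 p.2) ∧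
      H.Pairwise (fun p q => q.1 ≠ p.1 ∧ q.1 ≠ p.2) := by
  intro k
  induction k with
  | zero =>
    intro hk
    obtain ⟨r⟩ := hT.nonempty
    exact ⟨[], {r}, rfl, by simp, by simp, by simp⟩
  | succ k ih =>
    intro hk
    obtain ⟨H, A, h1, h2, h3, h4⟩ := ih (by omega)
    obtain ⟨a, ha⟩ : A.Nonempty := Finset.card_pos.1 (by omega)
    obtain ⟨b, hb⟩ : ∃ b, b ∉ A := by
      by_contra h
      push Not at h
      have : A = Finset.univ := Finset.eq_univ_iff_forall.2 h
      rw [this, Finset.card_univ] at h2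
      omega
    obtain ⟨p⟩ := hT.preconnected a b
    obtain ⟨d, _, hd1, hd2⟩ := p.exists_boundary_dart (A : Set V) ha hb
    have hd1 : d.fst ∈ A := hd1
    have hd2 : d.snd ∉ A := hd2
    refine ⟨H ++ [(d.snd, d.fst)], insert d.snd A, by simp [h1], ?_, ?_, ?_⟩
    · rw [Finset.card_insert_of_notMem hd2, h2]
    · intro p hp
      rcases List.mem_append.1 hp with hp | hp
      · obtain ⟨q1, q2, q3⟩ := h3 p hp
        exact ⟨Finset.mem_insert_of_mem q1, Finset.mem_insert_of_mem q2, q3⟩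
      · simp at hp; subst hp
        exact ⟨by simp, by simp [hd1], d.adj.symm⟩
    · rw [List.pairwise_append]
      refine ⟨h4, by simp, ?_⟩
      intro p hp q hq
      simp at hq; subst hq
      obtain ⟨q1, q2, q3⟩ := h3 p hp
      constructor
      · rintro h; simp only at h; rw [h] at hd2; exact hd2 q1
      · rintro h; simp only at h; rw [h] at hd2; exact hd2 q2

theorem tree_list' {V : Type} [DecidableEq V] [Fintype V] (T : SimpleGraph V) (hT : T.IsTree) :
    ∃ (H : List (V × V)), H.length + 1 = Fintype.card V ∧
      (∀ p ∈ H, T.Adj p.1 p.2) ∧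
      H.Pairwise (fun p q => q.1 ≠ p.1 ∧ q.1 ≠ p.2) ∧
      ∀ i j, T.Adj i j → (i, j) ∈ H ∨ (j, i) ∈ H := by
  classical
  have hc : 0 < Fintype.card V := by
    obtain ⟨r⟩ := hT.connected.nonempty
    exact Fintype.card_pos_iff.2 ⟨r⟩
  obtain ⟨H, A, h1, h2, h3, h4⟩ := tree_list T hT.connected (Fintype.card V - 1) (by omega)
  refine ⟨H, by omega, fun p hp => (h3 p hp).2.2, h4, ?_⟩
  have hnd : (H.map (fun p => s(p.1, p.2))).Nodup := by
    rw [List.Nodup, List.pairwise_map]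
    refine h4.imp ?_
    rintro ⟨a, b⟩ ⟨c, d⟩ ⟨q1, q2⟩ h
    simp only [ne_eq] at q1 q2 h
    rw [Sym2.eq_iff] at h
    rcases h with h | h
    · exact q1 h.1.symm
    · exact q2 h.2.symm
  have hsub : (H.map (fun p => s(p.1, p.2))).toFinset ⊆ T.edgeFinset := by
    intro e he
    simp only [List.mem_toFinset, List.mem_map] at he
    obtain ⟨p, hp, rfl⟩ := he
    simpa using (h3 p hp).2.2
  have heq := Finset.eq_of_subset_of_card_le hsub (by
    rw [List.toFinset_card_of_nodup hnd, List.length_map, h1]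
    have := hT.card_edgeFinset
    omega)
  intro i j hij
  have : s(i, j) ∈ T.edgeFinset := by simpa using hij
  rw [← heq] at this
  simp only [List.mem_toFinset, List.mem_map] at this
  obtain ⟨⟨a, b⟩, hp, h⟩ := this
  rw [Sym2.eq_iff] at h
  rcases h with ⟨rfl, rfl⟩ | ⟨rfl, rfl⟩
  · left; exact hp
  · right; exact hp

def tau {V : Type} (ε : V → Bool) : V × Bool ≃ V ⊕ V where
  toFun p := if p.2 = ε p.1 then Sum.inl p.1 else Sum.inr p.1
  invFun z := Sum.elim (fun i => (i, ε i)) (fun i => (i, !ε i)) z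
  left_inv := by
    rintro ⟨i, b⟩
    by_cases h : b = ε i
    · simp [h]
    · simp [h]; cases b <;> cases hε : ε i <;> simp_all
  right_inv := by
    rintro (i | i)
    · simp
    · simp

def ff (K : Type) [Field K] {V : Type} (i j : V) : MvPolynomial (V ⊕ V) K :=
  X (Sum.inl i) * X (Sum.inl j) - X (Sum.inr i) * X (Sum.inr j)

theorem DD_ff (K : Type) [Field K] {V : Type} (ε : V → Bool) (i j : V) (h : ε i ≠ ε j) :
    DD (tau ε) K i j = ff K i j ∨ DD (tau ε) K i j = - ff K i j := by
  cases hi : ε i <;> cases hj : ε j <;> simp_all [DD, xx, yy, ff, tau]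
  · right; ring
  · left; ring

theorem ff_symm (K : Type) [Field K] {V : Type} (i j : V) : ff K i j = ff K j i := by
  simp [ff]; ring

theorem upper (K : Type) [Field K] (n : ℕ) (G : SimpleGraph (Fin n))
    (hconn : G.Connected)
    (hcycle : ∃ (u : Fin n) (w : G.Walk u u), w.IsCycle ∧ Odd w.length)
    (huniq : ∀ (u v : Fin n) (w : G.Walk u u) (w' : G.Walk v v),
      w.IsCycle → w'.IsCycle → w.edges.toFinset = w'.edges.toFinset) :
    PDL (MvPolynomial (Fin n ⊕ Fin n) K)
      (MvPolynomial (Fin n ⊕ Fin n) K ⧸ parityBinomialEdgeIdeal K G) (n + 1) := by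
  classical
  obtain ⟨u, w, hw, -⟩ := hcycle
  obtain ⟨e, he⟩ : ∃ e, e ∈ w.edges := by
    apply List.exists_mem_of_ne_nil
    intro h
    have h1 := hw.three_le_length
    rw [← SimpleGraph.Walk.length_edges, h] at h1
    simp at h1
  induction e using Sym2.ind with | _ a b
  have hab : G.Adj a b := w.adj_of_mem_edges he
  have hnb : ¬ G.IsBridge s(a, b) := fun h => h.notMem_edges_of_isCycle hw he
  set T := G.deleteEdges {s(a, b)} with hTdef
  have hTc : T.Connected := hconn.connected_delete_edge_of_not_isBridge hnb
  have hTle : T ≤ G := SimpleGraph.deleteEdges_le _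
  have hTa : T.IsAcyclic := by
    intro v p hp
    have h1 := huniq u v w (p.mapLe hTle) hw (hp.mapLe hTle)
    have h2 : s(a, b) ∈ (p.mapLe hTle).edges.toFinset := by
      rw [← h1]; simpa using he
    rw [SimpleGraph.Walk.edges_mapLe_eq_edges] at h2
    have := p.adj_of_mem_edges (by simpa using h2)
    simp [hTdef] at this
  have hTt : T.IsTree := ⟨hTc, hTa⟩
  obtain ⟨H, hl, hadj, hpw, hall⟩ := tree_list' T hTt
  obtain ⟨C⟩ := hTt.colorable_two
  let ε : Fin n → Bool := fun i => decide (C i = 0)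
  have hε : ∀ i j, T.Adj i j → ε i ≠ ε j := by
    intro i j hij
    have := C.valid hij
    simp only [ε, ne_eq, decide_eq_decide]
    have hi := C i
    generalize C i = x at *
    generalize C j = y at *
    revert this; revert x y; decide
  have hf : ∀ v, rho K (pv (tau ε) {v} : Set _) (ff K a b) = ff K a b ∨
      rho K (pv (tau ε) {v} : Set _) (ff K a b) = 0 := by
    intro v
    have hm : ∀ i, (Sum.inl i ∈ (pv (tau ε) {v} : Set (Fin n ⊕ Fin n)) ↔ i = v) ∧
        (Sum.inr i ∈ (pv (tau ε) {v} : Set (Fin n ⊕ Fin n)) ↔ i = v) := by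
      intro i
      have e1 : (Sum.inl i : Fin n ⊕ Fin n) = tau ε (i, ε i) := by simp [tau]
      have e2 : (Sum.inr i : Fin n ⊕ Fin n) = tau ε (i, !ε i) := by simp [tau]
      rw [e1, e2, Finset.mem_coe, Finset.mem_coe, mem_pv, mem_pv]
      simp
    by_cases h : a = v ∨ b = v
    · right
      rcases h with rfl | rfl
      · simp [ff, rho_X_mem ((hm a).1.2 rfl), rho_X_mem ((hm a).2.2 rfl)]
      · simp [ff, rho_X_mem ((hm b).1.2 rfl), rho_X_mem ((hm b).2.2 rfl)]
    · left
      push Not at h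
      have k1 := fun h' => h.1 ((hm a).1.1 h')
      have k2 := fun h' => h.1 ((hm a).2.1 h')
      have k3 := fun h' => h.2 ((hm b).1.1 h')
      have k4 := fun h' => h.2 ((hm b).2.1 h')
      simp [ff, rho_X_notMem k1, rho_X_notMem k2, rho_X_notMem k3, rho_X_notMem k4]
  have hmain := list_main (K := K) (tau ε) (ff K a b) hf H id ∅ n
    (fun p hp => (hadj p hp).ne) hpw (fun p hp => ⟨by simp, fun i hi => hi⟩)
    (by rw [Finset.image_id]; simp at hl ⊢; omega)
  have hI : parityBinomialEdgeIdeal K G = JJ (tau ε) K id ∅ H (ff K a b) := by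
    have memG : ∀ i j, G.Adj i j → ff K i j ∈ parityBinomialEdgeIdeal K G := fun i j h =>
      Ideal.subset_span ⟨i, j, h, rfl⟩
    apply le_antisymm
    · rw [parityBinomialEdgeIdeal, Ideal.span_le]
      rintro _ ⟨i, j, hij, rfl⟩
      change ff K i j ∈ JJ (tau ε) K id ∅ H (ff K a b)
      by_cases h : s(i, j) = s(a, b)
      · rw [Sym2.eq_iff] at h
        rcases h with ⟨rfl, rfl⟩ | ⟨rfl, rfl⟩
        · exact JJ4 _
        · rw [ff_symm]; exact JJ4 _
      · have hT : T.Adj i j := by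
          rw [hTdef, SimpleGraph.deleteEdges_adj]; exact ⟨hij, h⟩
        have aux : ∀ i j, T.Adj i j → (i, j) ∈ H → ff K i j ∈ JJ (tau ε) K id ∅ H (ff K a b) := by
          intro i j hT hH
          have m : DD (tau ε) K i j ∈ JJ (tau ε) K id ∅ H (ff K a b) := JJ3 _ hH
          rcases DD_ff K ε i j (hε i j hT) with h | h
          · rwa [h] at m
          · rw [h] at m; exact neg_mem_iff.1 m
        rcases hall i j hT with h | h
        · exact aux i j hT h
        · rw [ff_symm K i j]; exact aux j i hT.symm h
    · refine JJ_le _ ?_ (by simp) ?_ (memG a b hab)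
      · intro i j h
        simp only [id] at h
        rw [h, DD_self]; exact Ideal.zero_mem _
      · intro p hp
        rcases DD_ff K ε p.1 p.2 (hε _ _ (hadj p hp)) with h | h
        · rw [h]; exact memG _ _ (hTle (hadj p hp))
        · rw [h]; exact neg_mem (memG _ _ (hTle (hadj p hp)))
  rw [hI]
  exact hmain

end Seg

namespace Seg
variable {σ K : Type} [Field K] {I : Ideal (MvPolynomial σ K)}

abbrev dl (F : MinimalGradedFreeResolutionOfQuotient I) (i : ℕ) :
    (Fin (F.rank (i + 1)) → MvPolynomial σ K) →ₗ[MvPolynomial σ K] (Fin (F.rank i) → MvPolynomial σ K) :=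
  (F.diff i).mulVecLin

theorem pd_free (r : ℕ) (n : ℕ) : PDL (MvPolynomial σ K) (Fin r → MvPolynomial σ K) (n + 1) :=
  (PDL.of_projective).mono (by omega)

theorem ker_dl (F : MinimalGradedFreeResolutionOfQuotient I) (i : ℕ) :
    LinearMap.ker (dl F i) = LinearMap.range (dl F (i + 1)) := by
  ext v
  rw [LinearMap.mem_ker, LinearMap.mem_range, Matrix.mulVecLin_apply, F.exact_succ i v]
  simp only [Matrix.mulVecLin_apply, eq_comm]

theorem range_zero (F : MinimalGradedFreeResolutionOfQuotient I) (n : ℕ)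
    (h : PDL (MvPolynomial σ K) (MvPolynomial σ K ⧸ I) (n + 2)) :
    PDL (MvPolynomial σ K) (LinearMap.range (dl F 0)) (n + 1) := by
  let g : (Fin (F.rank 0) → MvPolynomial σ K) →ₗ[MvPolynomial σ K] (MvPolynomial σ K ⧸ I) :=
    (Submodule.mkQ I).comp (Fintype.linearCombination (MvPolynomial σ K) F.gen)
  have hg : ∀ v, g v = Submodule.Quotient.mk (∑ e, v e * F.gen e) := by
    intro v; simp [g, Fintype.linearCombination_apply]
  refine PDL.ses1 (LinearMap.range (dl F 0)).subtype g (Submodule.subtype_injective _) ?_ ?_ (pd_free _ n) h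
  · intro x
    obtain ⟨x, rfl⟩ := Submodule.Quotient.mk_surjective _ x
    obtain ⟨c, hc⟩ := F.gen_span x
    refine ⟨c, ?_⟩
    rw [hg, eq_comm, Submodule.Quotient.eq]
    exact hc
  · intro v
    rw [hg, Submodule.Quotient.mk_eq_zero, F.exact_zero v]
    simp [eq_comm]

theorem range_succ (F : MinimalGradedFreeResolutionOfQuotient I) (n i : ℕ)
    (h : PDL (MvPolynomial σ K) (LinearMap.range (dl F i)) (n + 2)) :
    PDL (MvPolynomial σ K) (LinearMap.range (dl F (i + 1))) (n + 1) := by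
  refine PDL.ses1 (LinearMap.range (dl F (i + 1))).subtype (dl F i).rangeRestrict
    (Submodule.subtype_injective _) (LinearMap.surjective_rangeRestrict _) ?_ (pd_free _ n) h
  intro v
  have := ker_dl F i
  rw [← LinearMap.mem_ker, LinearMap.ker_rangeRestrict, this]
  simp

theorem range_all (F : MinimalGradedFreeResolutionOfQuotient I) (n : ℕ)
    (h : PDL (MvPolynomial σ K) (MvPolynomial σ K ⧸ I) (n + 2)) (i : ℕ) :
    PDL (MvPolynomial σ K) (LinearMap.range (dl F i)) (n - i + 1) := by
  induction i with
  | zero => exact range_zero F n h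
  | succ i ih =>
    refine range_succ F _ i (ih.mono ?_)
    omega

/-- rank vanishes above `n + 1` -/
theorem rank_le (F : MinimalGradedFreeResolutionOfQuotient I) (n : ℕ)
    (h : PDL (MvPolynomial σ K) (MvPolynomial σ K ⧸ I) (n + 2)) (m : ℕ) (hm : n + 1 < m) :
    F.rank m = 0 := by
  obtain ⟨N, hN⟩ := F.fin_length
  -- descending induction
  have step : ∀ m, n + 1 < m → F.rank (m + 1) = 0 → F.rank m = 0 := by
    intro m hm hz
    obtain ⟨k, rfl⟩ : ∃ k, m = k + 2 := ⟨m - 2, by omega⟩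
    by_contra hne
    have hp : PDL (MvPolynomial σ K) (LinearMap.range (dl F k)) 1 :=
      (range_all F n h k).mono (by omega)
    have hproj := hp.projective
    obtain ⟨s, hs⟩ := Module.projective_lifting_property (dl F k).rangeRestrict LinearMap.id
      (LinearMap.surjective_rangeRestrict _)
    -- id - s ∘ d maps onto the kernel
    have hinj : Function.Injective (dl F (k + 1)) := by
      rw [← LinearMap.ker_eq_bot, ker_dl, eq_bot_iff]
      rintro _ ⟨v, rfl⟩
      have : v = 0 := by
        funext e
        exact (Fin.cast hz e).elim0
      rw [this, map_zero]; exact Submodule.zero_mem _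
    have hK : ∀ v, v - s ((dl F k).rangeRestrict v) ∈ LinearMap.range (dl F (k + 1)) := by
      intro v
      rw [← ker_dl, LinearMap.mem_ker, map_sub, sub_eq_zero]
      have := congrArg Subtype.val (LinearMap.congr_fun hs ((dl F k).rangeRestrict v))
      simpa using this.symm
    let π : (Fin (F.rank (k + 1)) → MvPolynomial σ K) →ₗ[MvPolynomial σ K]
        LinearMap.range (dl F (k + 1)) :=
      (LinearMap.id - s.comp (dl F k).rangeRestrict).codRestrict _ hK
    let e := LinearEquiv.ofInjective (dl F (k + 1)) hinj
    let r : (Fin (F.rank (k + 1)) → MvPolynomial σ K) →ₗ[MvPolynomial σ K]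
        (Fin (F.rank (k + 2)) → MvPolynomial σ K) := e.symm.toLinearMap.comp π
    have hr : ∀ v, r (dl F (k + 1) v) = v := by
      intro v
      have : π (dl F (k + 1) v) = e v := by
        apply Subtype.ext
        have hz : (dl F k).rangeRestrict (dl F (k + 1) v) = 0 := by
          apply Subtype.ext
          have : dl F (k + 1) v ∈ LinearMap.ker (dl F k) := by
            rw [ker_dl]; exact ⟨v, rfl⟩
          exact this
        change dl F (k + 1) v - s ((dl F k).rangeRestrict (dl F (k + 1) v)) = dl F (k + 1) v
        rw [hz, map_zero, sub_zero]
      change e.symm (π (dl F (k + 1) v)) = v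
      rw [this, LinearEquiv.symm_apply_apply]
    let e0 : Fin (F.rank (k + 2)) := ⟨0, Nat.pos_of_ne_zero hne⟩
    have h1 := congrFun (hr (Pi.single e0 1)) e0
    have h2 : dl F (k + 1) (Pi.single e0 1) = fun i => F.diff (k + 1) i e0 := by
      simp [Matrix.mulVecLin_apply, Matrix.mulVec_single_one]; rfl
    rw [h2, LinearMap.pi_apply_eq_sum_univ r, Pi.single_eq_same] at h1
    have h3 := congrArg constantCoeff h1
    rw [Finset.sum_apply, map_sum] at h3
    simp [F.minimal] at h3
  by_contra hne
  have : ∀ j, F.rank (m + j) ≠ 0 := by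
    intro j
    induction j with
    | zero => exact hne
    | succ j ih => exact fun h0 => ih (step (m + j) (by omega) h0)
  exact this N (hN _ (by omega))

end Seg

namespace Seg
section reg
variable {R : Type} [CommRing R]

def VZ (Z : Ideal R) (r : ℕ) (v : Fin r → R) : Prop := ∀ k, v k ∈ Z

theorem VZ.add {Z : Ideal R} {r : ℕ} {v w : Fin r → R} (hv : VZ Z r v) (hw : VZ Z r w) :
    VZ Z r (v + w) := fun k => Z.add_mem (hv k) (hw k)
theorem VZ.sub {Z : Ideal R} {r : ℕ} {v w : Fin r → R} (hv : VZ Z r v) (hw : VZ Z r w) :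
    VZ Z r (v - w) := fun k => Z.sub_mem (hv k) (hw k)
theorem VZ.smul {Z : Ideal R} {r : ℕ} {v : Fin r → R} (a : R) (hv : VZ Z r v) :
    VZ Z r (a • v) := fun k => Z.mul_mem_left _ (hv k)
theorem VZ.map {Z : Ideal R} {r s : ℕ} {v : Fin r → R} (D : Matrix (Fin s) (Fin r) R)
    (hv : VZ Z r v) : VZ Z s (D.mulVec v) := fun k => by
  rw [Matrix.mulVec, dotProduct]
  exact Z.sum_mem (fun j _ => Z.mul_mem_left _ (hv j))
theorem VZ_sup {Z : Ideal R} {r : ℕ} {z : R} {v : Fin r → R} :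
    VZ (Z ⊔ Ideal.span {z}) r v ↔ ∃ u, VZ Z r (v - z • u) := by
  constructor
  · intro h
    have : ∀ k, ∃ u, v k - z * u ∈ Z := by
      intro k
      obtain ⟨a, ha, b, hb, e⟩ := Submodule.mem_sup.1 (h k)
      obtain ⟨u, rfl⟩ := Ideal.mem_span_singleton'.1 hb
      exact ⟨u, by rw [← e]; simpa [mul_comm] using ha⟩
    choose u hu using this
    exact ⟨u, hu⟩
  · rintro ⟨u, hu⟩ k
    have := Ideal.add_mem (Z ⊔ Ideal.span {z}) (Ideal.mem_sup_left (hu k))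
      (Ideal.mem_sup_right (Ideal.mul_mem_right (u k) _ (Ideal.mem_span_singleton_self z)))
    simpa using this

def Reg : Ideal R → List R → Prop
  | _, [] => True
  | Z, z :: zs => (∀ g, z * g ∈ Z → g ∈ Z) ∧ Reg (Z ⊔ Ideal.span {z}) zs

theorem depth_lem : ∀ (zs : List R) (Z : Ideal R) (r : ℕ → ℕ)
    (d : (i : ℕ) → Matrix (Fin (r i)) (Fin (r (i + 1))) R),
    Reg Z zs →
    (∀ i v, (d i).mulVec ((d (i + 1)).mulVec v) = 0) →
    (∀ i v, VZ Z _ ((d i).mulVec v) → ∃ t, VZ Z _ (v - (d (i + 1)).mulVec t)) →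
    (∀ i, zs.length ≤ i → r i = 0) →
    ∀ a : Fin (r 0) → R, (∀ z ∈ zs, ∃ b, VZ Z _ (z • a - (d 0).mulVec b)) →
    ∃ b, VZ Z _ (a - (d 0).mulVec b) := by
  intro zs
  induction zs with
  | nil =>
    intro Z r d _ _ _ hr a _
    exact ⟨0, fun k => (Fin.cast (hr 0 (by simp)) k).elim0⟩
  | cons z zs ih =>
    intro Z r d hreg hc hex hr a ha
    obtain ⟨hz, hreg⟩ := hreg
    have hcan : ∀ r (v : Fin r → R), VZ Z r (z • v) → VZ Z r v := fun r v hv k => hz _ (hv k)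
    obtain ⟨b, hb⟩ := ha z (by simp)
    have main := ih (Z ⊔ Ideal.span {z}) (fun i => r (i + 1)) (fun i => d (i + 1)) hreg
      (fun i v => hc (i + 1) v) ?_ (fun i hi => hr (i + 1) (by simp; omega)) b ?_
    · obtain ⟨t, ht⟩ := main
      rw [VZ_sup] at ht
      obtain ⟨b', hb'⟩ := ht
      refine ⟨b', hcan _ _ ?_⟩
      have h1 := VZ.map (d 0) hb'
      simp only [Matrix.mulVec_sub, Matrix.mulVec_smul] at h1
      rw [hc 0 t] at h1
      have := hb.add h1
      convert this using 1
      rw [smul_sub]; abel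
    · intro i v hv
      rw [VZ_sup] at hv
      obtain ⟨u, hu⟩ := hv
      have h1 := VZ.map (d i) hu
      simp only [Matrix.mulVec_sub, Matrix.mulVec_smul] at h1
      rw [hc i v, zero_sub, ← smul_neg] at h1
      have h2 := hcan _ _ h1
      rw [← Matrix.mulVec_neg] at h2
      obtain ⟨t, ht⟩ := hex i _ h2
      have h3 : VZ Z _ ((d (i + 1)).mulVec (v + z • t)) := by
        have := hu.sub (ht.smul z)
        convert this using 1
        rw [Matrix.mulVec_add, Matrix.mulVec_smul, smul_sub, smul_neg]; abel
      obtain ⟨s, hs⟩ := hex (i + 1) _ h3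
      refine ⟨s, VZ_sup.2 ⟨-t, ?_⟩⟩
      convert hs using 1
      rw [smul_neg]; abel
    · intro w hw
      obtain ⟨c, hcc⟩ := ha w (by simp [hw])
      have h1 : VZ Z _ ((d 0).mulVec (w • b - z • c)) := by
        have := (hcc.smul z).sub (hb.smul w)
        convert this using 1
        rw [Matrix.mulVec_sub, Matrix.mulVec_smul, Matrix.mulVec_smul, smul_sub, smul_sub, smul_comm z w a]
        abel
      obtain ⟨t, ht⟩ := hex 0 _ h1
      refine ⟨t, VZ_sup.2 ⟨c, ?_⟩⟩
      convert ht using 1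
      abel
end reg

section zz
variable {K : Type} [Field K] {n : ℕ}

def zz (K : Type) [Field K] {n : ℕ} (i : Fin n) : MvPolynomial (Fin n ⊕ Fin n) K :=
  X (Sum.inl i) - X (Sum.inr i)

def th (K : Type) [Field K] (A : Finset (Fin n)) :
    MvPolynomial (Fin n ⊕ Fin n) K →ₐ[K] MvPolynomial (Fin n ⊕ Fin n) K :=
  aeval (Sum.elim (fun i => if i ∈ A then X (Sum.inr i) else X (Sum.inl i)) (fun i => X (Sum.inr i)))

def ZA (K : Type) [Field K] (A : Finset (Fin n)) : Ideal (MvPolynomial (Fin n ⊕ Fin n) K) :=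
  Ideal.span (zz K '' A)

theorem ZA_eq (A : Finset (Fin n)) : ZA K A = RingHom.ker (th K A) := by
  apply le_antisymm
  · rw [ZA, Ideal.span_le]
    rintro _ ⟨i, hi, rfl⟩
    have hi : i ∈ A := hi
    rw [SetLike.mem_coe, RingHom.mem_ker]
    simp [zz, th, hi]
  · have key : ∀ g : MvPolynomial (Fin n ⊕ Fin n) K, g - th K A g ∈ ZA K A := by
      intro g
      induction g using MvPolynomial.induction_on with
      | C a => simp [th]
      | add p q hp hq => rw [map_add, add_sub_add_comm]; exact Ideal.add_mem _ hp hq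
      | mul_X p z hp =>
        have hX : X z - th K A (X z) ∈ ZA K A := by
          rcases z with i | i
          · by_cases hi : i ∈ A
            · simp only [th, aeval_X, Sum.elim_inl, hi, if_true]
              exact Ideal.subset_span ⟨i, hi, rfl⟩
            · simp [th, hi]
          · simp [th]
        have e : p * X z - th K A (p * X z) = (p - th K A p) * X z + th K A p * (X z - th K A (X z)) := by
          rw [map_mul]; ring
        rw [e]
        exact Ideal.add_mem _ (Ideal.mul_mem_right _ _ hp) (Ideal.mul_mem_left _ _ hX)
    intro g hg
    have := key g
    rw [RingHom.mem_ker] at hg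
    rwa [hg, sub_zero] at this

theorem ZA_reg : ∀ (L : List (Fin n)) (A : Finset (Fin n)), L.Nodup → (∀ i ∈ L, i ∉ A) →
    Reg (ZA K A) (L.map (zz K)) := by
  intro L
  induction L with
  | nil => intro A _ _; trivial
  | cons i L ih =>
    intro A hnd hA
    rw [List.nodup_cons] at hnd
    refine ⟨?_, ?_⟩
    · intro g hg
      have hp : (ZA K A).IsPrime := by rw [ZA_eq]; exact RingHom.ker_isPrime _
      refine (hp.mem_or_mem hg).resolve_left ?_
      rw [ZA_eq, RingHom.mem_ker]
      have : th K A (zz K i) = zz K i := by simp [zz, th, hA i (by simp)]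
      rw [this, zz, sub_eq_zero]
      intro h
      have := X_injective h
      simp at this
    · have : ZA K A ⊔ Ideal.span {zz K i} = ZA K (insert i A) := by
        rw [ZA, ZA, Finset.coe_insert, Set.image_insert_eq, Ideal.span_insert, sup_comm]
      rw [this]
      refine ih _ hnd.2 (fun j hj => ?_)
      simp only [Finset.mem_insert, not_or]
      exact ⟨fun h => hnd.1 (h ▸ hj), hA j (by simp [hj])⟩

def PP (K : Type) [Field K] (n : ℕ) : MvPolynomial (Fin n ⊕ Fin n) K := ∏ z, X z

def Sat (I : Ideal (MvPolynomial (Fin n ⊕ Fin n) K)) : Ideal (MvPolynomial (Fin n ⊕ Fin n) K) where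
  carrier := {g | ∃ k, PP K n ^ k * g ∈ I}
  zero_mem' := ⟨0, by simp⟩
  add_mem' := by
    rintro a b ⟨k, hk⟩ ⟨l, hl⟩
    refine ⟨k + l, ?_⟩
    have : PP K n ^ (k + l) * (a + b) = PP K n ^ l * (PP K n ^ k * a) + PP K n ^ k * (PP K n ^ l * b) := by
      rw [pow_add]; ring
    rw [this]
    exact I.add_mem (I.mul_mem_left _ hk) (I.mul_mem_left _ hl)
  smul_mem' := by
    rintro c a ⟨k, hk⟩
    refine ⟨k, ?_⟩
    rw [smul_eq_mul, mul_left_comm]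
    exact I.mul_mem_left _ hk

theorem Sat_le (I : Ideal (MvPolynomial (Fin n ⊕ Fin n) K)) : I ≤ Sat I := fun g hg => ⟨0, by simpa using hg⟩

theorem Sat_cancel (I : Ideal (MvPolynomial (Fin n ⊕ Fin n) K)) (z) (g) (h : X z * g ∈ Sat I) : g ∈ Sat I := by
  obtain ⟨k, hk⟩ := h
  refine ⟨k + 1, ?_⟩
  obtain ⟨Q, hQ⟩ : (X z : MvPolynomial (Fin n ⊕ Fin n) K) ∣ PP K n := Finset.dvd_prod_of_mem _ (Finset.mem_univ z)
  have : PP K n ^ (k + 1) * g = Q * (PP K n ^ k * (X z * g)) := by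
    rw [pow_succ]; nth_rw 2 [hQ]; ring
  rw [this]
  exact I.mul_mem_left _ hk

theorem walk_mem (G : SimpleGraph (Fin n)) {i j : Fin n} (p : G.Walk i j) :
    (Even p.length → X (Sum.inl i) * X (Sum.inr j) - X (Sum.inl j) * X (Sum.inr i) ∈
      Sat (parityBinomialEdgeIdeal K G)) ∧
    (Odd p.length → ff K i j ∈ Sat (parityBinomialEdgeIdeal K G)) := by
  induction p with
  | nil => simp
  | @cons i k j h p ih =>
    have hG : ff K i k ∈ Sat (parityBinomialEdgeIdeal K G) :=
      Sat_le _ (Ideal.subset_span ⟨i, k, h, rfl⟩)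
    rw [SimpleGraph.Walk.length_cons]
    constructor
    · intro he
      have ho : Odd p.length := by
        rw [Nat.even_add_one] at he; exact Nat.not_even_iff_odd.1 he
      apply Sat_cancel _ (Sum.inr k)
      have e : (X (Sum.inr k) * (X (Sum.inl i) * X (Sum.inr j) - X (Sum.inl j) * X (Sum.inr i)) :
        MvPolynomial (Fin n ⊕ Fin n) K) = X (Sum.inl j) * ff K i k - X (Sum.inl i) * ff K k j := by
        simp only [ff]; ring
      rw [e]
      exact Ideal.sub_mem _ (Ideal.mul_mem_left _ _ hG) (Ideal.mul_mem_left _ _ (ih.2 ho))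
    · intro ho
      have he : Even p.length := by
        rw [Nat.odd_add_one] at ho; exact Nat.not_odd_iff_even.1 ho
      apply Sat_cancel _ (Sum.inl k)
      have e : (X (Sum.inl k) * ff K i j :
        MvPolynomial (Fin n ⊕ Fin n) K) = X (Sum.inl j) * ff K i k -
          X (Sum.inr i) * (X (Sum.inl k) * X (Sum.inr j) - X (Sum.inl j) * X (Sum.inr k)) := by
        simp only [ff]; ring
      rw [e]
      exact Ideal.sub_mem _ (Ideal.mul_mem_left _ _ hG) (Ideal.mul_mem_left _ _ (ih.1 he))

theorem witness (G : SimpleGraph (Fin n)) (hconn : G.Connected) (u : Fin n) (w : G.Walk u u)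
    (hw : Odd w.length) : ∃ k, ∀ i : Fin n,
      zz K i * (PP K n ^ k * (X (Sum.inl u) + X (Sum.inr u))) ∈ parityBinomialEdgeIdeal K G := by
  have key : ∀ i, zz K i * (X (Sum.inl u) + X (Sum.inr u)) ∈ Sat (parityBinomialEdgeIdeal K G) := by
    intro i
    obtain ⟨p⟩ := hconn.preconnected i u
    have hh : ∃ p q : G.Walk i u, Even p.length ∧ Odd q.length := by
      rcases Nat.even_or_odd p.length with h | h
      · exact ⟨p, p.append w, h, by rw [SimpleGraph.Walk.length_append]; exact h.add_odd hw⟩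
      · exact ⟨p.append w, p, by rw [SimpleGraph.Walk.length_append]; exact h.add_odd hw, h⟩
    obtain ⟨p, q, hp, hq⟩ := hh
    have e : zz K i * (X (Sum.inl u) + X (Sum.inr u)) = (X (Sum.inl i) * X (Sum.inr u) - X (Sum.inl u) * X (Sum.inr i))
      + ff K i u := by simp only [zz, ff]; ring
    rw [e]
    exact Ideal.add_mem _ ((walk_mem G p).1 hp) ((walk_mem G q).2 hq)
  choose k hk using key
  refine ⟨Finset.univ.sup k, fun i => ?_⟩
  have hle : k i ≤ Finset.univ.sup k := Finset.le_sup (Finset.mem_univ i)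
  have : zz K i * (PP K n ^ Finset.univ.sup k * (X (Sum.inl u) + X (Sum.inr u))) =
    PP K n ^ (Finset.univ.sup k - k i) * (PP K n ^ k i * (zz K i * (X (Sum.inl u) + X (Sum.inr u)))) := by
    rw [← mul_assoc (PP K n ^ _) (PP K n ^ _), ← pow_add, Nat.sub_add_cancel hle]; ring
  rw [this]
  exact Ideal.mul_mem_left _ _ (hk i)

theorem witness_not (G : SimpleGraph (Fin n)) (u : Fin n) (k : ℕ) :
    PP K n ^ k * (X (Sum.inl u) + X (Sum.inr u)) ∉ parityBinomialEdgeIdeal K G := by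
  intro h
  let t : MvPolynomial (Fin n ⊕ Fin n) K →ₐ[K] Polynomial K :=
    aeval (Sum.elim (fun _ => Polynomial.X) (fun _ => 1))
  have hle : parityBinomialEdgeIdeal K G ≤ (Ideal.span {(Polynomial.X ^ 2 - 1 : Polynomial K)}).comap t := by
    rw [parityBinomialEdgeIdeal, Ideal.span_le]
    rintro _ ⟨i, j, _, rfl⟩
    have : t (X (Sum.inl i) * X (Sum.inl j) - X (Sum.inr i) * X (Sum.inr j)) = Polynomial.X ^ 2 - 1 := by
      simp [t]; ring
    rw [SetLike.mem_coe, Ideal.mem_comap, this]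
    exact Ideal.mem_span_singleton_self _
  have h1 := hle h
  rw [Ideal.mem_comap, Ideal.mem_span_singleton] at h1
  have h2 : t (PP K n ^ k * (X (Sum.inl u) + X (Sum.inr u))) = (Polynomial.X ^ n) ^ k * (Polynomial.X + 1) := by
    simp [t, PP]
  rw [h2] at h1
  obtain ⟨q, hq⟩ := h1
  have hne : (Polynomial.X + 1 : Polynomial K) ≠ 0 := by
    have := Polynomial.X_add_C_ne_zero (1 : K)
    simpa using this
  have h3 : (Polynomial.X ^ n) ^ k = (Polynomial.X - 1) * q := by
    apply mul_right_cancel₀ hne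
    rw [hq]; ring
  have := congrArg (Polynomial.eval 1) h3
  simp at this

theorem lower (G : SimpleGraph (Fin n)) (hconn : G.Connected) (u : Fin n) (w : G.Walk u u)
    (hw : Odd w.length) (F : MinimalGradedFreeResolutionOfQuotient (parityBinomialEdgeIdeal K G)) :
    ∃ i, n ≤ i ∧ F.rank i ≠ 0 := by
  by_contra hcon
  push Not at hcon
  obtain ⟨k, hk⟩ := witness (K := K) G hconn u w hw
  refine witness_not G u k (K := K) ?_
  set a := PP K n ^ k * (X (Sum.inl u) + X (Sum.inr u)) with ha
  obtain ⟨v, hv⟩ := F.gen_span a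
  have hbot : ZA K (∅ : Finset (Fin n)) = ⊥ := by simp [ZA]
  have hVZ : ∀ r (v : Fin r → MvPolynomial (Fin n ⊕ Fin n) K), VZ (ZA K (∅ : Finset (Fin n))) r v ↔ v = 0 := by
    intro r v
    rw [hbot, funext_iff]; rfl
  have := depth_lem ((List.finRange n).map (zz K)) (ZA K ∅) F.rank F.diff
    (ZA_reg _ _ (List.nodup_finRange n) (by simp))
    (fun i v => (F.exact_succ i _).2 ⟨v, rfl⟩)
    (fun i v h => by
      rw [hVZ] at h
      obtain ⟨t, ht⟩ := (F.exact_succ i v).1 h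
      exact ⟨t, by rw [hVZ, ht, sub_self]⟩)
    (fun i hi => hcon i (by simpa using hi)) v
    (fun z hz => by
      obtain ⟨i, -, rfl⟩ := List.mem_map.1 hz
      have h1 : ∑ e, (zz K i • v) e * F.gen e ∈ parityBinomialEdgeIdeal K G := by
        have e : ∑ e, (zz K i • v) e * F.gen e = zz K i * a - zz K i * (a - ∑ e, v e * F.gen e) := by
          rw [← mul_sub, sub_sub_cancel, Finset.mul_sum]
          exact Finset.sum_congr rfl (fun e _ => by rw [Pi.smul_apply, smul_eq_mul, mul_assoc])
        rw [e]
        exact Ideal.sub_mem _ (hk i) (Ideal.mul_mem_left _ _ hv)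
      obtain ⟨b, hb⟩ := (F.exact_zero _).1 h1
      exact ⟨b, by rw [hVZ, hb, sub_self]⟩)
  obtain ⟨b, hb⟩ := this
  rw [hVZ, sub_eq_zero] at hb
  have h2 := (F.exact_zero v).2 ⟨b, hb⟩
  have := Ideal.add_mem _ hv h2
  simpa using this

end zz
end Seg

/-- **Projective dimension of the parity binomial edge ideal of odd unicyclic
graphs.**  Let `G` be a connected graph on `[n]` containing exactly one cycle
(all cycles of `G` have the same edge set), this cycle being of odd length.
Then `pd (S/𝓘_G) = n`. -/
theorem projDim_parityBinomialEdgeIdeal_odd_unicyclic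
    (K : Type) [Field K] (n : ℕ) (G : SimpleGraph (Fin n))
    (hconn : G.Connected)
    (hcycle : ∃ (u : Fin n) (w : G.Walk u u), w.IsCycle ∧ Odd w.length)
    (huniq : ∀ (u v : Fin n) (w : G.Walk u u) (w' : G.Walk v v),
      w.IsCycle → w'.IsCycle → w.edges.toFinset = w'.edges.toFinset)
    (F : MinimalGradedFreeResolutionOfQuotient (parityBinomialEdgeIdeal K G)) :
    F.projDim = n := by
  have hup := Seg.upper K n G hconn hcycle huniq
  obtain ⟨u, w, hw, ho⟩ := hcycle
  obtain ⟨m, rfl⟩ : ∃ m, n = m + 1 := ⟨n - 1, by have := u.pos; omega⟩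
  have hle : ∀ i ∈ {i : ℕ | F.rank i ≠ 0}, i ≤ m + 1 := by
    intro i hi
    by_contra h
    exact hi (Seg.rank_le F m hup i (by omega))
  obtain ⟨i, hi, hr⟩ := Seg.lower G hconn u w ho F
  rw [MinimalGradedFreeResolutionOfQuotient.projDim]
  apply le_antisymm
  · exact csSup_le ⟨i, hr⟩ hle
  · exact hi.trans (le_csSup ⟨_, hle⟩ hr)


end
end

section
/- Let K be a field and G a tree on the vertex set [n]. Then the second total Betti number of S/L_G, where L_G is the Lovász–Saks–Schrijver ideal of G, is concentrated in degree 4 and is given by β_2(S/L_G) = β_{2,4}(S/L_G) = binom(n−1, 2) + Σ_{v ∈ V(G)} binom(deg_G(v), 3). -/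
open MvPolynomial

noncomputable section

/-- The Lovász–Saks–Schrijver ideal of a simple graph `G` on vertex set `V`:
`L_G = (x_i x_j + y_i y_j : {i,j} ∈ E(G))` in
`K[x_v, y_v : v ∈ V] = MvPolynomial (V ⊕ V) K`. -/
def lssIdeal (K : Type) [Field K] {V : Type} (G : SimpleGraph V) :
    Ideal (MvPolynomial (V ⊕ V) K) :=
  Ideal.span {f | ∃ i j, G.Adj i j ∧
    f = X (Sum.inl i) * X (Sum.inl j) + X (Sum.inr i) * X (Sum.inr j)}

/-- The graded Betti number `β_{i,j}` read off from a minimal graded free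
resolution: the number of copies of `S(-j)` in the `i`-th free module. -/
def MinimalGradedFreeResolutionOfQuotient.betti {σ K : Type} [Field K]
    {I : Ideal (MvPolynomial σ K)}
    (F : MinimalGradedFreeResolutionOfQuotient I) (i j : ℕ) : ℕ :=
  (Finset.univ.filter fun e : Fin (F.rank i) => F.twist i e = j).card

section partA

variable {σ K : Type} [Field K]

lemma hc_mul (i d : ℕ) (p f : MvPolynomial σ K) (hf : f.IsHomogeneous d) :
    homogeneousComponent (i + d) (p * f) = homogeneousComponent i p * f := by
  induction p using MvPolynomial.induction_on' with
  | monomial u a =>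
    have hm : (monomial u a : MvPolynomial σ K).IsHomogeneous u.degree :=
      isHomogeneous_monomial a rfl
    rw [homogeneousComponent_of_mem (hm.mul hf), homogeneousComponent_of_mem hm]
    by_cases h : i = u.degree <;> simp [h]
  | add p q h1 h2 =>
    rw [add_mul, map_add, map_add, add_mul, h1, h2]

def Indep {ι τ : Type} [Fintype ι] (g : ι → τ → MvPolynomial σ K) : Prop :=
  ∀ a : ι → K, (∀ t, ∑ k, C (a k) * g k t = 0) → ∀ k, a k = 0

lemma hc_two_sum {ι : Type} [Fintype ι] (p g : ι → MvPolynomial σ K)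
    (hg : ∀ k, (g k).IsHomogeneous 2) :
    homogeneousComponent 2 (∑ k, p k * g k) = ∑ k, C (constantCoeff (p k)) * g k := by
  rw [map_sum]
  refine Finset.sum_congr rfl fun k _ => ?_
  have := hc_mul 0 2 (p k) (g k) (hg k)
  rw [zero_add] at this
  rw [this, homogeneousComponent_zero]
  rfl

lemma indep_const {ι τ : Type} [Fintype ι] (g : ι → τ → MvPolynomial σ K)
    (hg : ∀ k t, (g k t).IsHomogeneous 2) (hi : Indep g) (p : ι → MvPolynomial σ K)
    (hp : ∀ t, ∑ k, p k * g k t = 0) (k : ι) : constantCoeff (p k) = 0 := by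
  refine hi (fun k => constantCoeff (p k)) (fun t => ?_) k
  rw [← hc_two_sum p (fun k => g k t) (fun k => hg k t), hp t, map_zero]

lemma nak {τ : Type} [Fintype τ] {N s : ℕ} (g : Fin N → τ → MvPolynomial σ K)
    (hg : ∀ k t, (g k t).IsHomogeneous 2) (hi : Indep g)
    (D : Matrix τ (Fin s) (MvPolynomial σ K))
    (hsame : ∀ z : τ → MvPolynomial σ K,
      (∃ w : Fin N → MvPolynomial σ K, ∀ t, z t = ∑ k, w k * g k t) ↔ ∃ w, z = D.mulVec w)
    (hker : ∀ w, D.mulVec w = 0 → ∀ c, constantCoeff (w c) = 0) :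
    s = N ∧ ∃ (P : Matrix (Fin N) (Fin s) K) (Q : Matrix (Fin s) (Fin N) K),
      P * Q = 1 ∧ Q * P = 1 ∧
      ∀ t c, homogeneousComponent 2 (D t c) = ∑ k, C (P k c) * g k t := by
  classical
  have h1 : ∀ c, ∃ w : Fin N → MvPolynomial σ K, ∀ t, D t c = ∑ k, w k * g k t := by
    intro c
    refine (hsame (fun t => D t c)).2 ⟨Pi.single c 1, ?_⟩
    ext1 t
    simp [Matrix.mulVec, dotProduct, Pi.single_apply]
  have h2 : ∀ k, ∃ w : Fin s → MvPolynomial σ K, ∀ t, g k t = ∑ c, w c * D t c := by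
    intro k
    obtain ⟨w, hw⟩ := (hsame (g k)).1 ⟨Pi.single k 1, by simp [Pi.single_apply]⟩
    refine ⟨w, fun t => ?_⟩
    rw [hw]
    simp [Matrix.mulVec, dotProduct, mul_comm]
  choose p hp using h1
  choose q hq using h2
  let P : Matrix (Fin N) (Fin s) K := fun k c => constantCoeff (p c k)
  let Q : Matrix (Fin s) (Fin N) K := fun c k => constantCoeff (q k c)
  have hPQ : P * Q = 1 := by
    ext k l
    have h3 := indep_const g hg hi (fun k => (∑ c, q l c * p c k) - (1 : Matrix (Fin N) (Fin N) (MvPolynomial σ K)) k l) (by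
      intro t
      simp only [sub_mul, Finset.sum_sub_distrib, Finset.sum_mul]
      rw [Finset.sum_comm]
      simp only [mul_assoc, ← Finset.mul_sum, ← hp, ← hq]
      simp [Matrix.one_apply]) k
    simp only [map_sub, map_sum, map_mul, sub_eq_zero] at h3
    rw [Matrix.mul_apply]
    simp only [P, Q]
    rw [Finset.sum_congr rfl fun c _ => mul_comm _ _, h3]
    simp [Matrix.one_apply, apply_ite]
  have hQP : Q * P = 1 := by
    ext c d
    have h3 := hker (fun c => (∑ k, p d k * q k c) - (1 : Matrix (Fin s) (Fin s) (MvPolynomial σ K)) c d) (by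
      ext1 t
      simp only [Matrix.mulVec, dotProduct, mul_sub, Finset.sum_sub_distrib, Finset.mul_sum]
      rw [Finset.sum_comm]
      have : ∀ k, ∑ c, D t c * (p d k * q k c) = p d k * g k t := by
        intro k
        rw [hq, Finset.mul_sum]
        exact Finset.sum_congr rfl fun c _ => by ring
      simp only [this, ← hp]
      simp [Matrix.one_apply]) c
    simp only [map_sub, map_sum, map_mul, sub_eq_zero] at h3
    rw [Matrix.mul_apply]
    simp only [P, Q]
    rw [Finset.sum_congr rfl fun c _ => mul_comm _ _, h3]
    simp [Matrix.one_apply, apply_ite]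
  refine ⟨?_, P, Q, hPQ, hQP, fun t c => ?_⟩
  · have := Matrix.square_of_invertible P Q hPQ hQP
    simpa using this.symm
  · rw [hp c t, hc_two_sum _ _ (fun k => hg k t)]

lemma nak_deg {τ : Type} {N s : ℕ} (g : Fin N → τ → MvPolynomial σ K)
    (hi : Indep g)
    (D : Matrix τ (Fin s) (MvPolynomial σ K))
    (P : Matrix (Fin N) (Fin s) K) (Q : Matrix (Fin s) (Fin N) K) (hQP : Q * P = 1)
    (hD : ∀ t c, homogeneousComponent 2 (D t c) = ∑ k, C (P k c) * g k t)
    (c : Fin s) (d : ℕ) (hd : ∀ t, (D t c).IsHomogeneous d) : d = 2 := by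
  by_contra hne
  have h1 := hi (fun k => P k c) (fun t => by
    rw [← hD, homogeneousComponent_of_mem (hd t), if_neg (Ne.symm hne)])
  have h2 := congrFun (congrFun hQP c) c
  rw [Matrix.mul_apply] at h2
  simp [h1] at h2

end partA
section partB

variable {σ K : Type} [Field K]

def SyzBasis {m : ℕ} (f : Fin m → MvPolynomial σ K) (N : ℕ) : Prop :=
  ∃ Z : Fin N → Fin m → MvPolynomial σ K, (∀ k t, (Z k t).IsHomogeneous 2) ∧ Indep Z ∧
    ∀ z : Fin m → MvPolynomial σ K, (∑ t, z t * f t = 0) ↔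
      ∃ w : Fin N → MvPolynomial σ K, ∀ t, z t = ∑ k, w k * Z k t

lemma cc_mulVec {r s : Type} [Fintype s] (D : Matrix r s (MvPolynomial σ K))
    (h : ∀ i j, constantCoeff (D i j) = 0) (w : s → MvPolynomial σ K) (i : r) :
    constantCoeff (D.mulVec w i) = 0 := by
  simp [Matrix.mulVec, dotProduct, h]

lemma betti_of_syz (I : Ideal (MvPolynomial σ K)) (m N : ℕ) (f : Fin m → MvPolynomial σ K)
    (hf : ∀ k, (f k).IsHomogeneous 2) (hfi : Indep (fun k (_ : Unit) => f k))
    (hspan : ∀ p, p ∈ I ↔ ∃ w : Fin m → MvPolynomial σ K, p = ∑ k, w k * f k)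
    (hsyz : SyzBasis f N) (F : MinimalGradedFreeResolutionOfQuotient I) :
    F.rank 2 = N ∧ ∀ c, F.twist 2 c = 4 := by
  classical
  have hI : ∀ p ∈ I, constantCoeff p = 0 := by
    intro p hp
    obtain ⟨w, rfl⟩ := (hspan p).1 hp
    have : ∀ k, constantCoeff (f k) = 0 := fun k => (hf k).coeff_eq_zero (by simp)
    simp [this]
  -- stage 0
  obtain ⟨c0, hc0⟩ := F.gen_span 1
  have h0 := hI _ hc0
  obtain ⟨e0, he0⟩ : ∃ e0, constantCoeff (F.gen e0) ≠ 0 := by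
    by_contra! hcon
    simp [hcon] at h0
  have ht0 : F.twist 0 e0 = 0 := by
    by_contra hne
    exact he0 ((F.gen_homog e0).coeff_eq_zero (by simpa using Ne.symm hne))
  obtain ⟨a, ha⟩ : ∃ a : K, F.gen e0 = C a := by
    have := F.gen_homog e0
    rw [ht0] at this
    exact ⟨_, (totalDegree_eq_zero_iff_eq_C.1 ((totalDegree_zero_iff_isHomogeneous _).2 this))⟩
  have ha0 : a ≠ 0 := by simpa [ha] using he0
  have huniq : ∀ e, e = e0 := by
    intro e
    by_contra hne
    obtain ⟨w, hw⟩ := (F.exact_zero (Pi.single e 1 - Pi.single e0 (F.gen e * C a⁻¹))).1 (by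
      have : ∑ x, (Pi.single e 1 - Pi.single e0 (F.gen e * C a⁻¹) : Fin (F.rank 0) → MvPolynomial σ K) x * F.gen x = 0 := by
        simp only [Pi.sub_apply, sub_mul, Finset.sum_sub_distrib, Pi.single_apply, ite_mul, zero_mul,
          Finset.sum_ite_eq', Finset.mem_univ, if_true, one_mul]
        rw [ha, mul_assoc, ← C_mul, inv_mul_cancel₀ ha0]; simp
      rw [this]; exact I.zero_mem)
    have h3 := cc_mulVec _ (F.minimal 0) w e
    rw [← hw] at h3
    simp [hne] at h3
  have hsum : ∀ h : Fin (F.rank 0) → MvPolynomial σ K, ∑ e, h e = h e0 := fun h =>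
    Fintype.sum_eq_single e0 (fun e he => absurd (huniq e) he)
  have hmem : ∀ p, p ∈ I ↔ ∃ w, p = (F.diff 0).mulVec w e0 := by
    intro p
    have h1 := F.exact_zero (fun _ => p)
    rw [hsum, ha] at h1
    have h2 : p * C a ∈ I ↔ p ∈ I := by
      refine ⟨fun h => ?_, fun h => I.mul_mem_right _ h⟩
      have := I.mul_mem_right (C a⁻¹) h
      rwa [mul_assoc, ← C_mul, mul_inv_cancel₀ ha0, C_1, mul_one] at this
    rw [← h2, h1]
    refine exists_congr fun w => ⟨fun h => congrFun h e0, fun h => ?_⟩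
    ext1 e
    rw [huniq e]; exact h
  have hk0 : ∀ w, (F.diff 0).mulVec w e0 = 0 ↔ (F.diff 0).mulVec w = 0 := fun w =>
    ⟨fun h => by ext1 e; rw [huniq e]; exact h, fun h => congrFun h e0⟩
  -- stage 1
  obtain ⟨hr1, P, Q, hPQ, hQP, hD⟩ := nak (fun k (_ : Unit) => f k) (fun k _ => hf k) hfi
    (fun _ c => F.diff 0 e0 c) (by
      intro z
      have h1 := (hspan (z ())).symm.trans (hmem (z ()))
      constructor
      · rintro ⟨w, hw⟩
        obtain ⟨w', hw'⟩ := h1.1 ⟨w, hw ()⟩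
        exact ⟨w', by ext1 t; exact hw'⟩
      · rintro ⟨w, hw⟩
        obtain ⟨w', hw'⟩ := h1.2 ⟨w, congrFun hw ()⟩
        exact ⟨w', fun _ => hw'⟩) (by
      intro w hw c
      obtain ⟨w', rfl⟩ := (F.exact_succ 0 w).1 ((hk0 w).1 (congrFun hw ()))
      exact cc_mulVec _ (F.minimal 1) _ _)
  have hhom0 : ∀ c, (F.diff 0 e0 c).IsHomogeneous (F.twist 1 c) := by
    intro c
    rcases F.diff_homog 0 e0 c with h | ⟨_, h⟩
    · rw [h]; exact isHomogeneous_zero _ _ _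
    · rwa [ht0] at h
  have ht1 : ∀ c, F.twist 1 c = 2 := fun c =>
    nak_deg _ hfi _ P Q hQP hD c _ (fun _ => hhom0 c)
  have hD0 : ∀ c, F.diff 0 e0 c = ∑ k, C (P k c) * f k := by
    intro c
    rw [← hD () c, homogeneousComponent_eq_self]
    have := hhom0 c
    rwa [ht1] at this
  -- stage 2
  obtain ⟨Z, hZ, hZi, hZs⟩ := hsyz
  set P' : Matrix (Fin m) (Fin (F.rank 1)) (MvPolynomial σ K) := P.map C with hP'
  set Q' : Matrix (Fin (F.rank 1)) (Fin m) (MvPolynomial σ K) := Q.map C with hQ'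
  have hPQ' : P' * Q' = 1 := by
    rw [hP', hQ', ← Matrix.map_mul, hPQ, Matrix.map_one _ C_0 C_1]
  have hQP' : Q' * P' = 1 := by
    rw [hP', hQ', ← Matrix.map_mul, hQP, Matrix.map_one _ C_0 C_1]
  have hdz : ∀ z, (F.diff 0).mulVec z e0 = ∑ k, (P'.mulVec z) k * f k := by
    intro z
    simp only [Matrix.mulVec, dotProduct, hD0, Finset.sum_mul, hP', Matrix.map_apply]
    rw [Finset.sum_comm]
    exact Finset.sum_congr rfl fun _ _ => Finset.sum_congr rfl fun _ _ => by ring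
  obtain ⟨hr2, P2, Q2, hPQ2, hQP2, hD2⟩ := nak Z hZ hZi (P' * F.diff 1) (by
      intro z
      rw [← hZs z]
      have h1 : ∑ t, z t * f t = (F.diff 0).mulVec (Q'.mulVec z) e0 := by
        rw [hdz, Matrix.mulVec_mulVec, hPQ', Matrix.one_mulVec]
      rw [h1, hk0, F.exact_succ 0]
      refine exists_congr fun w => ?_
      rw [← Matrix.mulVec_mulVec]
      constructor
      · intro h
        rw [← h, Matrix.mulVec_mulVec, hPQ', Matrix.one_mulVec]
      · intro h
        rw [h, Matrix.mulVec_mulVec, hQP', Matrix.one_mulVec]) (by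
      intro w hw c
      have h2 : (F.diff 1).mulVec w = 0 := by
        have := congrArg (Q'.mulVec) hw
        rwa [← Matrix.mulVec_mulVec, Matrix.mulVec_mulVec, hQP', Matrix.one_mulVec,
          Matrix.mulVec_zero] at this
      obtain ⟨w', rfl⟩ := (F.exact_succ 1 w).1 h2
      exact cc_mulVec _ (F.minimal 2) _ _)
  refine ⟨hr2, fun c => ?_⟩
  have := nak_deg Z hZi _ P2 Q2 hQP2 hD2 c (F.twist 2 c - 2) (by
    intro t
    rw [Matrix.mul_apply]
    refine IsHomogeneous.sum _ _ _ fun d _ => ?_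
    refine IsHomogeneous.C_mul ?_ _
    rcases F.diff_homog 1 d c with h | ⟨_, h⟩
    · rw [h]; exact isHomogeneous_zero _ _ _
    · rwa [ht1] at h)
  omega

end partB
section partC

variable {σ K : Type} [Field K]

lemma cone {m N₁ N₂ : ℕ} (f : Fin m → MvPolynomial σ K) (hf : ∀ k, (f k).IsHomogeneous 2)
    (g : MvPolynomial σ K) (hg : g.IsHomogeneous 2) (hs : SyzBasis f N₁)
    (h : Fin N₂ → MvPolynomial σ K) (hh : ∀ k, (h k).IsHomogeneous 2)
    (hhi : Indep (fun k (_ : Unit) => h k))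
    (hcol : ∀ p, (∃ w : Fin m → MvPolynomial σ K, p * g = ∑ k, w k * f k) ↔
      ∃ w : Fin N₂ → MvPolynomial σ K, p = ∑ k, w k * h k) :
    SyzBasis (Fin.cons g f : Fin (m + 1) → MvPolynomial σ K) (N₁ + N₂) := by
  obtain ⟨Z, hZ, hZi, hZs⟩ := hs
  have h1 : ∀ l, ∃ w : Fin m → MvPolynomial σ K, (∀ k, (w k).IsHomogeneous 2) ∧
      h l * g = ∑ k, w k * f k := by
    intro l
    obtain ⟨w, hw⟩ := (hcol (h l)).2 ⟨Pi.single l 1, by simp [Pi.single_apply]⟩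
    refine ⟨fun k => homogeneousComponent 2 (w k),
      fun k => homogeneousComponent_isHomogeneous _ _, ?_⟩
    have h2 := congrArg (homogeneousComponent (2 + 2)) hw
    rw [hc_mul _ _ _ _ hg, homogeneousComponent_eq_self (hh l), map_sum] at h2
    rw [h2]
    exact Finset.sum_congr rfl fun k _ => hc_mul _ _ _ _ (hf k)
  choose z hz1 hz2 using h1
  refine ⟨Fin.append (fun k => Fin.cons 0 (Z k)) (fun l => Fin.cons (h l) (fun k => - z l k)),
    ?_, ?_, ?_⟩
  · intro k t
    refine Fin.addCases (fun k => ?_) (fun k => ?_) k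
    · rw [Fin.append_left]
      refine Fin.cases ?_ (fun t => ?_) t
      · simpa using isHomogeneous_zero _ _ _
      · simpa using hZ k t
    · rw [Fin.append_right]
      refine Fin.cases ?_ (fun t => ?_) t
      · simpa using hh k
      · simpa using (hz1 k t).neg
  · intro a ha
    have h2 : ∀ l, a (Fin.natAdd N₁ l) = 0 := by
      refine hhi _ fun _ => ?_
      have := ha 0
      simpa [Fin.sum_univ_add] using this
    have h3 : ∀ l, a (Fin.castAdd N₂ l) = 0 := by
      refine hZi _ fun t => ?_
      have := ha t.succ
      simpa [Fin.sum_univ_add, h2] using this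
    intro k
    exact Fin.addCases h3 h2 k
  · intro y
    rw [Fin.sum_univ_succ]
    simp only [Fin.cons_zero, Fin.cons_succ]
    constructor
    · intro hy
      obtain ⟨v, hv⟩ := (hcol (y 0)).1 ⟨fun k => - y k.succ, by
        simp only [neg_mul, Finset.sum_neg_distrib]; linear_combination hy⟩
      obtain ⟨w, hw⟩ := (hZs (fun t => y t.succ + ∑ l, v l * z l t)).1 (by
        simp only [add_mul, Finset.sum_add_distrib, Finset.sum_mul]
        rw [Finset.sum_comm]
        have : ∀ l, ∑ t, v l * z l t * f t = v l * h l * g := by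
          intro l
          rw [mul_assoc, hz2, Finset.mul_sum]
          exact Finset.sum_congr rfl fun _ _ => by ring
        simp only [this, ← Finset.sum_mul, ← hv]
        linear_combination hy)
      refine ⟨Fin.append w v, fun t => ?_⟩
      rw [Fin.sum_univ_add]
      simp only [Fin.append_left, Fin.append_right]
      refine Fin.cases ?_ (fun t => ?_) t
      · simp [← hv]
      · simp [← hw]
    · rintro ⟨w, hw⟩
      simp only [Fin.sum_univ_add, Fin.append_left, Fin.append_right] at hw
      have hw0 := hw 0
      simp only [Fin.cons_zero, mul_zero, Finset.sum_const_zero, zero_add] at hw0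
      have h4 := (hZs (fun t => ∑ k, w (Fin.castAdd N₂ k) * Z k t)).2 ⟨_, fun t => rfl⟩
      have h5 : ∀ t : Fin m, y t.succ = ∑ k, w (Fin.castAdd N₂ k) * Z k t -
          ∑ l, w (Fin.natAdd N₁ l) * z l t := by
        intro t
        rw [hw]; simp [sub_eq_add_neg]
      simp only [h5, sub_mul, Finset.sum_sub_distrib]
      rw [h4, hw0]
      simp only [Finset.sum_mul]
      have : ∀ l, ∑ t, w (Fin.natAdd N₁ l) * z l t * f t = w (Fin.natAdd N₁ l) * h l * g := by
        intro l
        rw [mul_assoc, hz2, Finset.mul_sum]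
        exact Finset.sum_congr rfl fun _ _ => by ring
      rw [Finset.sum_comm]
      simp only [this]
      ring

def eps (z : σ) : MvPolynomial σ K →ₐ[K] MvPolynomial σ K :=
  open Classical in aeval (fun i => if i = z then 0 else X i)

@[simp] lemma eps_self (z : σ) : eps z (X z : MvPolynomial σ K) = 0 := by simp [eps]

lemma eps_ne {z i : σ} (h : i ≠ z) : eps z (X i : MvPolynomial σ K) = X i := by simp [eps, h]

lemma eps_div (z : σ) (p : MvPolynomial σ K) : ∃ q, p = eps z p + X z * q := by
  induction p using MvPolynomial.induction_on with
  | C a => exact ⟨0, by simp [eps]⟩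
  | add p q hp hq =>
    obtain ⟨p', hp⟩ := hp
    obtain ⟨q', hq⟩ := hq
    exact ⟨p' + q', by rw [map_add]; linear_combination hp + hq⟩
  | mul_X p i hp =>
    obtain ⟨p', hp⟩ := hp
    by_cases h : i = z
    · subst h
      exact ⟨p, by simp [mul_comm]⟩
    · exact ⟨p' * X i, by rw [map_mul, eps_ne h]; linear_combination X i * hp⟩

lemma eps_totalDegree (z : σ) (p : MvPolynomial σ K) :
    (eps z p).totalDegree ≤ p.totalDegree := by
  conv_lhs => rw [p.as_sum, map_sum]
  refine (totalDegree_finsetSum_le fun s hs => ?_)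
  have h1 : (monomial s (coeff s p)).IsHomogeneous s.degree := isHomogeneous_monomial _ rfl
  have h2 : (eps z (monomial s (coeff s p))).IsHomogeneous (1 * s.degree) := by
    refine h1.aeval _ (fun i => ?_)
    split_ifs
    · exact isHomogeneous_zero _ _ _
    · exact isHomogeneous_X _ _
  refine h2.totalDegree_le.trans ?_
  rw [one_mul]
  exact le_totalDegree hs

def FreeOf (z : σ) (J : Ideal (MvPolynomial σ K)) : Prop :=
  ∀ g ∈ J, ∃ g' ∈ J, g = eps z g + X z * g'

lemma freeOf_span (z : σ) (s : Set (MvPolynomial σ K)) (hs : ∀ f ∈ s, eps z f = f) :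
    FreeOf z (Ideal.span s) := by
  intro g hg
  induction hg using Submodule.span_induction with
  | mem x hx => exact ⟨0, Ideal.zero_mem _, by simp [hs x hx]⟩
  | zero => exact ⟨0, Ideal.zero_mem _, by simp⟩
  | add x y _ _ hx hy =>
    obtain ⟨x', hx', hx⟩ := hx
    obtain ⟨y', hy', hy⟩ := hy
    exact ⟨x' + y', Ideal.add_mem _ hx' hy', by rw [map_add]; linear_combination hx + hy⟩
  | smul a x hm hx =>
    obtain ⟨x', hx', hx⟩ := hx
    obtain ⟨a', ha⟩ := eps_div z a
    refine ⟨eps z a * x' + a' * x, Ideal.add_mem _ (Ideal.mul_mem_left _ _ hx')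
      (Ideal.mul_mem_left _ _ hm), ?_⟩
    rw [smul_eq_mul, map_mul]
    linear_combination x * ha + eps z a * hx

lemma FreeOf.eps_mem {z : σ} {J : Ideal (MvPolynomial σ K)} (h : FreeOf z J)
    {g : MvPolynomial σ K} (hg : g ∈ J) : eps z g ∈ J := by
  obtain ⟨g', hg', he⟩ := h g hg
  have : eps z g = g - X z * g' := by linear_combination -he
  rw [this]
  exact J.sub_mem hg (J.mul_mem_left _ hg')

lemma FreeOf.cancel {z : σ} {J : Ideal (MvPolynomial σ K)} (h : FreeOf z J)
    {g : MvPolynomial σ K} (hg : X z * g ∈ J) : g ∈ J := by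
  obtain ⟨g', hg', he⟩ := h _ hg
  rw [map_mul, eps_self, zero_mul, zero_add] at he
  rwa [mul_left_cancel₀ (X_ne_zero z) he]

/-- `a x_v + b y_v`-type element is regular. -/
lemma regular_of_free {z w : σ} {J : Ideal (MvPolynomial σ K)} (hz : FreeOf z J)
    (hw : FreeOf w J) (hzw : w ≠ z) (a b : MvPolynomial σ K) (ha : eps z a = a)
    (hreg : ∀ p, a * p ∈ J → p ∈ J) (p : MvPolynomial σ K)
    (hp : p * (a * X w + b * X z) ∈ J) : p ∈ J := by
  induction hd : p.totalDegree using Nat.strong_induction_on generalizing p with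
  | _ d ih =>
    have h1 : eps z p ∈ J := by
      have := hz.eps_mem hp
      simp only [map_mul, map_add, eps_self, mul_zero, add_zero, ha, eps_ne hzw] at this
      refine hreg _ (hw.cancel ?_)
      convert this using 1; ring
    obtain ⟨q, hq⟩ := eps_div z p
    by_cases hq0 : q = 0
    · rw [hq, hq0]; simpa using h1
    have h2 : q ∈ J := by
      refine ih q.totalDegree ?_ q ?_ rfl
      · have h3 : X z * q = p - eps z p := by linear_combination -hq
        have h4 : (X z * q).totalDegree = 1 + q.totalDegree := by
          rw [totalDegree_mul_of_isDomain (X_ne_zero z) hq0, totalDegree_X]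
        have h5 := (totalDegree_sub p (eps z p)).trans (max_le le_rfl (eps_totalDegree z p))
        rw [← h3] at h5
        omega
      · refine hz.cancel ?_
        have : X z * (q * (a * X w + b * X z)) =
            p * (a * X w + b * X z) - eps z p * (a * X w + b * X z) := by
          linear_combination -(a * X w + b * X z) * hq
        rw [this]
        exact J.sub_mem hp (J.mul_mem_right _ h1)
    rw [hq]
    exact J.add_mem h1 (J.mul_mem_left _ h2)

end partC
section partD

set_option linter.unusedSectionVars false

variable {V K : Type} [Field K] [DecidableEq V]

def vr (b : Bool) (v : V) : V ⊕ V := if b then Sum.inl v else Sum.inr v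

variable (K) in
def xv (b : Bool) (v : V) : MvPolynomial (V ⊕ V) K := X (vr b v)

variable (K) in
def ed (u v : V) : MvPolynomial (V ⊕ V) K :=
  X (Sum.inl u) * X (Sum.inl v) + X (Sum.inr u) * X (Sum.inr v)

lemma ed_eq (b : Bool) (u v : V) : ed K u v = xv K b u * xv K b v + xv K (!b) u * xv K (!b) v := by
  cases b <;> simp [ed, xv, vr, add_comm]

lemma ed_comm (u v : V) : ed K u v = ed K v u := by simp only [ed]; ring

lemma vr_inj {b b' : Bool} {v v' : V} (h : vr b v = vr b' v') : b = b' ∧ v = v' := by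
  cases b <;> cases b' <;> simp_all [vr]

lemma eps_xv (b b' : Bool) (i v : V) (h : v ≠ i) : eps (vr b i) (xv K b' v) = xv K b' v :=
  eps_ne fun h' => h (vr_inj h').2

lemma eps_xv_not (b : Bool) (i : V) : eps (vr b i) (xv K (!b) i) = xv K (!b) i :=
  eps_ne fun h' => by simpa using (vr_inj h').1

lemma eps_xv_not2 (b : Bool) (i : V) : eps (vr (!b) i) (xv K b i) = xv K b i :=
  eps_ne fun h' => by simpa using (vr_inj h').1

lemma eps_xv_self (b : Bool) (i : V) : eps (vr b i) (xv K b i) = 0 := eps_self _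

lemma alt_mem {V R : Type} [CommRing R] (J : Ideal R) (s M : V → V → R)
    (hs : ∀ j k, s j k = - s k j) (hs0 : ∀ j, s j j = 0) (W : Finset V)
    (hM : ∀ j ∈ W, ∀ k ∈ W, M j k - M k j ∈ J) : ∑ j ∈ W, ∑ k ∈ W, s j k * M j k ∈ J := by
  classical
  induction W using Finset.induction_on with
  | empty => simp
  | insert i W hi ih =>
    have ih' := ih fun j hj k hk =>
      hM j (Finset.mem_insert_of_mem hj) k (Finset.mem_insert_of_mem hk)
    have h1 : ∑ j ∈ insert i W, ∑ k ∈ insert i W, s j k * M j k =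
        ∑ k ∈ W, s i k * (M i k - M k i) + ∑ j ∈ W, ∑ k ∈ W, s j k * M j k := by
      simp only [Finset.sum_insert hi, hs0, zero_mul, zero_add, Finset.sum_add_distrib, mul_sub,
        Finset.sum_sub_distrib]
      have : ∑ x ∈ W, s x i * M x i = - ∑ x ∈ W, s i x * M x i := by
        rw [← Finset.sum_neg_distrib]
        exact Finset.sum_congr rfl fun x _ => by rw [hs x i]; ring
      rw [this]; ring
    rw [h1]
    refine J.add_mem (J.sum_mem fun k hk => J.mul_mem_left _ ?_) ih'
    exact hM i (Finset.mem_insert_self _ _) k (Finset.mem_insert_of_mem hk)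

def Good (J : Ideal (MvPolynomial (V ⊕ V) K)) (W : Finset V) (b : V → Bool) : Prop :=
  ∀ c : V → MvPolynomial (V ⊕ V) K, ∑ j ∈ W, c j * xv K (b j) j ∈ J →
    ∃ (s : V → V → MvPolynomial (V ⊕ V) K) (a : V → MvPolynomial (V ⊕ V) K),
      (∀ j k, s j k = - s k j) ∧ (∀ j, s j j = 0) ∧
      ∀ j ∈ W, c j = ∑ k ∈ W, s j k * xv K (b k) k + a j ∧ a j * xv K (b j) j ∈ J ∧
        a j * xv K (!b j) j ∈ J

/-- relation between `J = J_G` and `J' = J_{G - i}`, with `U` the neighbours of `i`. -/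
structure LExt (J J' : Ideal (MvPolynomial (V ⊕ V) K)) (i : V) (U : Finset V) : Prop where
  free : ∀ b, FreeOf (vr b i) J'
  le : J' ≤ J
  mem : ∀ k ∈ U, ed K i k ∈ J
  dec : ∀ p ∈ J, ∃ q : V → MvPolynomial (V ⊕ V) K, p - ∑ k ∈ U, q k * ed K i k ∈ J'
  ne : ∀ k ∈ U, k ≠ i

lemma annswap {J J' : Ideal (MvPolynomial (V ⊕ V) K)} {i : V} {U : Finset V} (h : LExt J J' i U)
    (β : Bool) (hg : Good J' U (fun _ => !β)) (c : MvPolynomial (V ⊕ V) K)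
    (hc : c * xv K β i ∈ J) : c * xv K (!β) i ∈ J := by
  obtain ⟨q, hq⟩ := h.dec _ hc
  set ε := eps (K := K) (vr β i) with hε
  have hdiv : ∀ k, ∃ q', q k = ε (q k) + xv K β i * q' := fun k => eps_div _ _
  choose q' hq' using hdiv
  have h1 : ε (c * xv K β i - ∑ k ∈ U, q k * ed K i k) =
      - (xv K (!β) i * ∑ k ∈ U, ε (q k) * xv K (!β) k) := by
    rw [map_sub, map_mul, eps_xv_self, mul_zero, zero_sub, map_sum, Finset.mul_sum]
    congr 1
    refine Finset.sum_congr rfl fun k hk => ?_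
    rw [map_mul, ed_eq β, map_add, map_mul, map_mul, eps_xv_self, eps_xv_not, eps_xv _ (!β) _ _ (h.ne k hk)]
    ring
  have h2 : xv K (!β) i * ∑ k ∈ U, ε (q k) * xv K (!β) k ∈ J' := by
    have := (h.free β).eps_mem hq
    rw [← hε, h1] at this
    exact neg_mem_iff.1 this
  obtain ⟨s, a, hs, hs0, hsa⟩ := hg (fun k => ε (q k)) ((h.free (!β)).cancel h2)
  have h3 : c - ∑ k ∈ U, ε (q k) * xv K β k - ∑ k ∈ U, q' k * ed K i k ∈ J' := by
    refine (h.free β).cancel ?_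
    have h4 : X (vr β i) * (c - ∑ k ∈ U, ε (q k) * xv K β k - ∑ k ∈ U, q' k * ed K i k) =
        (c * xv K β i - ∑ k ∈ U, q k * ed K i k) +
          xv K (!β) i * ∑ k ∈ U, ε (q k) * xv K (!β) k := by
      have h5 : ∑ k ∈ U, q k * ed K i k = xv K β i * ∑ k ∈ U, ε (q k) * xv K β k +
          xv K β i * ∑ k ∈ U, q' k * ed K i k +
          xv K (!β) i * ∑ k ∈ U, ε (q k) * xv K (!β) k := by
        rw [Finset.mul_sum, Finset.mul_sum, Finset.mul_sum, ← Finset.sum_add_distrib,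
          ← Finset.sum_add_distrib]
        refine Finset.sum_congr rfl fun k hk => ?_
        have := ed_eq (K := K) β i k
        linear_combination ed K i k * hq' k + ε (q k) * this
      rw [h5, show X (vr β i) = xv K β i from rfl]
      ring
    rw [h4]
    exact J'.add_mem hq h2
  have h6 : (∑ k ∈ U, ε (q k) * xv K β k) * xv K (!β) i ∈ J := by
    have h7 : (∑ k ∈ U, ε (q k) * xv K β k) * xv K (!β) i =
        (∑ k ∈ U, ∑ l ∈ U, s k l * (xv K (!β) l * xv K β k * xv K (!β) i)) +
          ∑ k ∈ U, a k * xv K β k * xv K (!β) i := by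
      rw [Finset.sum_mul, ← Finset.sum_add_distrib]
      refine Finset.sum_congr rfl fun k hk => ?_
      rw [(hsa k hk).1, add_mul, add_mul, Finset.sum_mul, Finset.sum_mul]
      congr 1
      exact Finset.sum_congr rfl fun l _ => by ring
    rw [h7]
    refine J.add_mem (alt_mem J s _ hs hs0 U fun k hk l hl => ?_) (J.sum_mem fun k hk => ?_)
    · have : xv K (!β) l * xv K β k * xv K (!β) i - xv K (!β) k * xv K β l * xv K (!β) i =
          xv K β k * ed K i l - xv K β l * ed K i k := by
        rw [ed_eq β, ed_eq β]; ring
      rw [this]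
      exact J.sub_mem (J.mul_mem_left _ (h.mem l hl)) (J.mul_mem_left _ (h.mem k hk))
    · have := (hsa k hk).2.2
      simp only [Bool.not_not] at this
      exact J.mul_mem_right _ (h.le this)
  have h8 : c * xv K (!β) i = (c - ∑ k ∈ U, ε (q k) * xv K β k - ∑ k ∈ U, q' k * ed K i k) *
      xv K (!β) i + (∑ k ∈ U, ε (q k) * xv K β k) * xv K (!β) i +
      (∑ k ∈ U, q' k * ed K i k) * xv K (!β) i := by ring
  rw [h8]
  exact J.add_mem (J.add_mem (J.mul_mem_right _ (h.le h3)) h6)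
    (J.mul_mem_right _ (J.sum_mem fun k hk => J.mul_mem_left _ (h.mem k hk)))

lemma good_step {J J' : Ideal (MvPolynomial (V ⊕ V) K)} {i : V} {U W : Finset V}
    (h : LExt J J' i U) (b : V → Bool) (hiW : i ∉ W) (hUW : Disjoint W U)
    (hg1 : Good J' U (fun _ => !b i)) (hg2 : Good J' W b)
    (hg3 : Good J' (W ∪ U) (fun v => if v ∈ W then b v else !b i)) :
    Good J (insert i W) b := by
  intro c hc
  rw [Finset.sum_insert hiW] at hc
  obtain ⟨q, hq⟩ := h.dec _ hc
  have hWne : ∀ j ∈ W, j ≠ i := fun j hj hji => hiW (hji ▸ hj)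
  have hUnW : ∀ k ∈ U, k ∉ W := fun k hk hk' => Finset.disjoint_left.1 hUW hk' hk
  set ε := eps (K := K) (vr (b i) i) with hε
  set δ := eps (K := K) (vr (!b i) i) with hδ
  set ξ := xv K (b i) i with hξ
  set η := xv K (!b i) i with hη
  have h2 : ∑ j ∈ W, ε (c j) * xv K (b j) j - η * ∑ k ∈ U, ε (q k) * xv K (!b i) k ∈ J' := by
    have := (h.free (b i)).eps_mem hq
    rw [← hε] at this
    convert this using 1
    rw [map_sub, map_add, map_mul, hξ, eps_xv_self, mul_zero, zero_add, map_sum, map_sum,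
      Finset.mul_sum]
    congr 1
    · refine Finset.sum_congr rfl fun j hj => ?_
      rw [map_mul, hε, eps_xv _ _ _ _ (hWne j hj)]
    · refine Finset.sum_congr rfl fun k hk => ?_
      rw [map_mul, ed_eq (b i), map_add, map_mul, map_mul, hε, eps_xv_self, eps_xv_not,
        eps_xv _ (!b i) _ _ (h.ne k hk), hη]
      ring
  have h3 : ∑ j ∈ W, δ (ε (c j)) * xv K (b j) j ∈ J' := by
    have := (h.free (!b i)).eps_mem h2
    rw [← hδ] at this
    convert this using 1
    rw [map_sub, map_mul, hη, hδ, eps_xv_self, zero_mul, sub_zero, map_sum]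
    refine Finset.sum_congr rfl fun j hj => ?_
    rw [map_mul, eps_xv _ _ _ _ (hWne j hj)]
  have hd1 : ∀ j, ∃ c', ε (c j) = δ (ε (c j)) + η * c' := fun k => eps_div _ _
  have hd2 : ∀ j, ∃ c', c j = ε (c j) + ξ * c' := fun k => eps_div _ _
  choose c' hc' using hd1
  choose c'' hc'' using hd2
  have h4 : ∑ j ∈ W, c' j * xv K (b j) j - ∑ k ∈ U, ε (q k) * xv K (!b i) k ∈ J' := by
    refine (h.free (!b i)).cancel ?_
    convert J'.sub_mem h2 h3 using 1
    have : ∑ j ∈ W, ε (c j) * xv K (b j) j = ∑ j ∈ W, δ (ε (c j)) * xv K (b j) j +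
        η * ∑ j ∈ W, c' j * xv K (b j) j := by
      rw [Finset.mul_sum, ← Finset.sum_add_distrib]
      refine Finset.sum_congr rfl fun j hj => ?_
      linear_combination xv K (b j) j * hc' j
    rw [this, show X (vr (!b i) i) = η from rfl]
    ring
  obtain ⟨s0, a0, hs0, hs00, hsa0⟩ := hg2 _ h3
  obtain ⟨s, a, hs, hss, hsa⟩ := hg3 (fun v => if v ∈ W then c' v else - ε (q v)) (by
    rw [Finset.sum_union hUW]
    convert h4 using 1
    rw [sub_eq_add_neg, ← Finset.sum_neg_distrib]
    congr 1
    · exact Finset.sum_congr rfl fun j hj => by simp [hj]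
    · exact Finset.sum_congr rfl fun j hj => by simp [hUnW j hj])
  have hsW : ∀ j ∈ W, c' j = ∑ k ∈ W, s j k * xv K (b k) k +
      ∑ k ∈ U, s j k * xv K (!b i) k + a j ∧ a j * xv K (b j) j ∈ J' ∧
        a j * xv K (!b j) j ∈ J' := by
    intro j hj
    have := hsa j (Finset.mem_union_left _ hj)
    simp only [hj, if_true] at this
    refine ⟨?_, this.2⟩
    rw [this.1, Finset.sum_union hUW]
    congr 2
    · exact Finset.sum_congr rfl fun j hj => by simp [hj]
    · exact Finset.sum_congr rfl fun j hj => by simp [hUnW j hj]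
  let T : V → MvPolynomial (V ⊕ V) K := fun j => c'' j - ∑ k ∈ U, s j k * xv K (b i) k
  let A : V → MvPolynomial (V ⊕ V) K := fun j => a0 j + η * a j + ∑ k ∈ U, s j k * ed K i k
  have hcj : ∀ j ∈ W, c j = T j * ξ + ∑ k ∈ W, (s0 j k + η * s j k) * xv K (b k) k + A j := by
    intro j hj
    have e1 : ∑ k ∈ W, (s0 j k + η * s j k) * xv K (b k) k = ∑ k ∈ W, s0 j k * xv K (b k) k +
        η * ∑ k ∈ W, s j k * xv K (b k) k := by
      rw [Finset.mul_sum, ← Finset.sum_add_distrib]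
      exact Finset.sum_congr rfl fun _ _ => by ring
    have e2 : ∑ k ∈ U, s j k * ed K i k = ξ * (∑ k ∈ U, s j k * xv K (b i) k) +
        η * ∑ k ∈ U, s j k * xv K (!b i) k := by
      rw [Finset.mul_sum, Finset.mul_sum, ← Finset.sum_add_distrib]
      exact Finset.sum_congr rfl fun k _ => by rw [ed_eq (b i)]; ring
    simp only [T, A]
    rw [e1, e2]
    linear_combination hc'' j + hc' j + (hsa0 j hj).1 + η * (hsW j hj).1
  have hUJ : ∀ j, ∑ k ∈ U, s j k * ed K i k ∈ J := fun j =>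
    J.sum_mem fun k hk => J.mul_mem_left _ (h.mem k hk)
  have hA : ∀ j ∈ W, A j * xv K (b j) j ∈ J ∧ A j * xv K (!b j) j ∈ J := by
    intro j hj
    have e : ∀ y, A j * y = a0 j * y + η * (a j * y) + (∑ k ∈ U, s j k * ed K i k) * y := by
      intro y; simp only [A]; ring
    constructor
    · rw [e]
      exact J.add_mem (J.add_mem (h.le (hsa0 j hj).2.1) (J.mul_mem_left _ (h.le (hsW j hj).2.1)))
        (J.mul_mem_right _ (hUJ j))
    · rw [e]
      exact J.add_mem (J.add_mem (h.le (hsa0 j hj).2.2) (J.mul_mem_left _ (h.le (hsW j hj).2.2)))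
        (J.mul_mem_right _ (hUJ j))
  have hAi : (c i + ∑ k ∈ W, T k * xv K (b k) k) * ξ ∈ J := by
    have e : (c i + ∑ k ∈ W, T k * xv K (b k) k) * ξ = (c i * ξ + ∑ j ∈ W, c j * xv K (b j) j) -
        (∑ j ∈ W, ∑ k ∈ W, (s0 j k + η * s j k) * (xv K (b j) j * xv K (b k) k)) -
        ∑ j ∈ W, A j * xv K (b j) j := by
      have : ∑ j ∈ W, c j * xv K (b j) j = (∑ k ∈ W, T k * xv K (b k) k) * ξ +
        (∑ j ∈ W, ∑ k ∈ W, (s0 j k + η * s j k) * (xv K (b j) j * xv K (b k) k)) +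
        ∑ j ∈ W, A j * xv K (b j) j := by
        rw [Finset.sum_mul, ← Finset.sum_add_distrib, ← Finset.sum_add_distrib]
        refine Finset.sum_congr rfl fun j hj => ?_
        rw [hcj j hj, add_mul, add_mul, Finset.sum_mul]
        congr 2
        · ring
        · exact Finset.sum_congr rfl fun _ _ => by ring
      rw [this]; ring
    rw [e]
    refine J.sub_mem (J.sub_mem hc (alt_mem J _ _ (fun j k => ?_) (fun j => ?_) W fun j _ k _ => ?_))
      (J.sum_mem fun j hj => (hA j hj).1)
    · rw [hs0 j k, hs j k]; ring
    · rw [hs00, hss]; ring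
    · rw [mul_comm, sub_self]; exact J.zero_mem
  refine ⟨fun j k => if j = i then (if k = i then 0 else - T k) else
      if k = i then T j else s0 j k + η * s j k,
    fun j => if j = i then c i + ∑ k ∈ W, T k * xv K (b k) k else A j, ?_, ?_, ?_⟩
  · intro j k
    by_cases hj : j = i <;> by_cases hk : k = i <;> simp [hj, hk]
    rw [hs0 j k, hs j k]; ring
  · intro j
    by_cases hj : j = i <;> simp [hj, hs00, hss]
  · intro j hj
    rcases Finset.mem_insert.1 hj with rfl | hj
    · refine ⟨?_, by simpa using hAi, by simpa using annswap h (b j) hg1 _ hAi⟩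
      rw [Finset.sum_insert hiW]
      have : ∑ k ∈ W, (if j = j then (if k = j then 0 else - T k) else
        if k = j then T j else s0 j k + η * s j k) * xv K (b k) k = - ∑ k ∈ W, T k * xv K (b k) k := by
        rw [← Finset.sum_neg_distrib]
        exact Finset.sum_congr rfl fun k hk => by simp [hWne k hk]
      rw [this]
      simp
    · have hji := hWne j hj
      simp only [if_neg hji]
      refine ⟨?_, hA j hj⟩
      rw [Finset.sum_insert hiW, if_pos rfl]
      refine (hcj j hj).trans ?_
      congr 2
      exact Finset.sum_congr rfl fun k hk => by simp [hWne k hk]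

end partD
section partE

set_option linter.unusedSectionVars false

variable {V K : Type} [Field K] [DecidableEq V] [Fintype V]

open Classical in
def nb (G : SimpleGraph V) (i : V) : Finset V := Finset.univ.filter (G.Adj i)

lemma mem_nb {G : SimpleGraph V} {i k : V} : k ∈ nb G i ↔ G.Adj i k := by simp [nb]

lemma ed_mem {G : SimpleGraph V} {i k : V} (h : G.Adj i k) : ed K i k ∈ lssIdeal K G :=
  Ideal.subset_span ⟨i, k, h, rfl⟩

lemma eps_ed (b : Bool) (i j k : V) (hj : j ≠ i) (hk : k ≠ i) : eps (vr b i) (ed K j k) = ed K j k := by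
  rw [ed_eq true, map_add, map_mul, map_mul, eps_xv _ _ _ _ hj, eps_xv _ _ _ _ hk,
    eps_xv _ _ _ _ hj, eps_xv _ _ _ _ hk]

lemma lss_free {G : SimpleGraph V} {i : V} (h : ∀ k, ¬ G.Adj i k) (b : Bool) :
    FreeOf (vr b i) (lssIdeal K G) := by
  refine freeOf_span _ _ ?_
  rintro f ⟨j, k, hjk, rfl⟩
  refine eps_ed b i j k ?_ ?_
  · rintro rfl; exact h _ hjk
  · rintro rfl; exact h _ hjk.symm

lemma lext (G : SimpleGraph V) (i : V) :
    LExt (lssIdeal K G) (lssIdeal K (G.deleteIncidenceSet i)) i (nb G i) where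
  free := lss_free fun k hk => (SimpleGraph.deleteIncidenceSet_adj.1 hk).2.1 rfl
  le := by
    refine Ideal.span_le.2 ?_
    rintro f ⟨j, k, hjk, rfl⟩
    exact ed_mem (SimpleGraph.deleteIncidenceSet_adj.1 hjk).1
  mem := fun k hk => ed_mem (mem_nb.1 hk)
  ne := fun k hk => (mem_nb.1 hk).ne'
  dec := by
    intro p hp
    induction hp using Submodule.span_induction with
    | mem f hf =>
      obtain ⟨j, k, hjk, rfl⟩ := hf
      change ∃ q : V → MvPolynomial (V ⊕ V) K, ed K j k - _ ∈ _
      by_cases hj : j = i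
      · subst hj
        refine ⟨fun l => if l = k then 1 else 0, ?_⟩
        simp [ite_mul, Finset.sum_ite_eq', mem_nb.2 hjk]
      by_cases hk : k = i
      · subst hk
        refine ⟨fun l => if l = j then 1 else 0, ?_⟩
        simp [ite_mul, Finset.sum_ite_eq', mem_nb.2 hjk.symm, ed_comm j k]
      · refine ⟨0, ?_⟩
        simpa using ed_mem (SimpleGraph.deleteIncidenceSet_adj.2 ⟨hjk, hj, hk⟩)
    | zero => exact ⟨0, by simp⟩
    | add x y _ _ hx hy =>
      obtain ⟨q, hq⟩ := hx
      obtain ⟨r, hr⟩ := hy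
      refine ⟨q + r, ?_⟩
      convert Ideal.add_mem _ hq hr using 1
      simp only [Pi.add_apply, add_mul, Finset.sum_add_distrib]; ring
    | smul a x _ hx =>
      obtain ⟨q, hq⟩ := hx
      refine ⟨fun k => a * q k, ?_⟩
      convert Ideal.mul_mem_left _ a hq using 1
      simp only [smul_eq_mul, mul_sub, Finset.mul_sum, mul_assoc]

lemma del_le_bridge (G : SimpleGraph V) (i k : V) :
    G.deleteIncidenceSet i ≤ G.deleteEdges {s(i, k)} := by
  intro a b h
  rw [SimpleGraph.deleteIncidenceSet_adj] at h
  rw [SimpleGraph.deleteEdges_adj]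
  refine ⟨h.1, ?_⟩
  simp only [Set.mem_singleton_iff, Sym2.eq_iff]
  rintro (⟨h1, _⟩ | ⟨_, h2⟩)
  · exact h.2.1 h1
  · exact h.2.2 h2

lemma nb_nonreach {G : SimpleGraph V} (hG : G.IsAcyclic) {i k l : V} (hk : G.Adj i k)
    (hl : G.Adj i l) (hkl : k ≠ l) : ¬ (G.deleteIncidenceSet i).Reachable k l := by
  intro hr
  have hb := SimpleGraph.isAcyclic_iff_forall_adj_isBridge.1 hG hk
  rw [SimpleGraph.isBridge_iff] at hb
  refine hb ?_
  have h1 : (G.deleteEdges {s(i, k)}).Adj i l := by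
    rw [SimpleGraph.deleteEdges_adj]
    refine ⟨hl, ?_⟩
    simp only [Set.mem_singleton_iff, Sym2.eq_iff]
    rintro (⟨_, h1⟩ | ⟨h2, _⟩)
    · exact hkl h1.symm
    · exact hk.ne h2
  exact h1.reachable.trans (hr.symm.mono (del_le_bridge G i k))

lemma good_forest (n : ℕ) : ∀ (G : SimpleGraph V) (D W : Finset V), Dᶜ.card = n → G.IsAcyclic →
    (∀ d ∈ D, ∀ k, ¬ G.Adj d k) → Disjoint W D →
    (∀ j ∈ W, ∀ k ∈ W, j ≠ k → ¬ G.Reachable j k) → ∀ b, Good (lssIdeal K G) W b := by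
  induction n with
  | zero =>
    intro G D W hD hG hiso hWD hW b c hc
    have : W = ∅ := by
      rw [Finset.card_eq_zero, Finset.compl_eq_empty_iff] at hD
      subst hD
      exact Finset.eq_empty_of_forall_notMem fun x hx => Finset.disjoint_left.1 hWD hx (Finset.mem_univ x)
    subst this
    exact ⟨0, 0, by simp, by simp, by simp⟩
  | succ n ih =>
    intro G D W hD hG hiso hWD hW b
    rcases W.eq_empty_or_nonempty with rfl | ⟨i, hi⟩
    · intro c hc
      exact ⟨0, 0, by simp, by simp, by simp⟩
    have hiD : i ∉ D := Finset.disjoint_left.1 hWD hi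
    have hcard : (insert i D)ᶜ.card = n := by
      rw [Finset.compl_insert, Finset.card_erase_of_mem (by simpa using hiD), hD]; rfl
    have hle := G.deleteIncidenceSet_le i
    have hG' : (G.deleteIncidenceSet i).IsAcyclic := hG.anti hle
    have hiso' : ∀ d ∈ insert i D, ∀ k, ¬ (G.deleteIncidenceSet i).Adj d k := by
      intro d hd k hdk
      rw [SimpleGraph.deleteIncidenceSet_adj] at hdk
      rcases Finset.mem_insert.1 hd with rfl | hd
      · exact hdk.2.1 rfl
      · exact hiso d hd k hdk.1
    have hU : Disjoint (nb G i) (insert i D) := by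
      rw [Finset.disjoint_left]
      intro k hk hk'
      rw [mem_nb] at hk
      rcases Finset.mem_insert.1 hk' with rfl | hd
      · exact hk.ne rfl
      · exact hiso k hd i hk.symm
    have hW' : Disjoint (W.erase i) (insert i D) := by
      rw [Finset.disjoint_left] at *
      intro k hk hk'
      rw [Finset.mem_erase] at hk
      rcases Finset.mem_insert.1 hk' with rfl | hd
      · exact hk.1 rfl
      · exact hWD hk.2 hd
    have hUU : ∀ j ∈ nb G i, ∀ k ∈ nb G i, j ≠ k → ¬ (G.deleteIncidenceSet i).Reachable j k :=
      fun j hj k hk hjk => nb_nonreach hG (mem_nb.1 hj) (mem_nb.1 hk) hjk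
    have hWW : ∀ j ∈ W.erase i, ∀ k ∈ W.erase i, j ≠ k →
        ¬ (G.deleteIncidenceSet i).Reachable j k := fun j hj k hk hjk h =>
      hW j (Finset.mem_of_mem_erase hj) k (Finset.mem_of_mem_erase hk) hjk (h.mono hle)
    have hWU : ∀ j ∈ W.erase i, ∀ k ∈ nb G i, ¬ (G.deleteIncidenceSet i).Reachable j k :=
      fun j hj k hk h => hW j (Finset.mem_of_mem_erase hj) i hi (Finset.ne_of_mem_erase hj)
        ((h.mono hle).trans (mem_nb.1 hk).symm.reachable)
    rw [← Finset.insert_erase hi]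
    refine good_step (lext G i) b (Finset.notMem_erase _ _) ?_ ?_ ?_ ?_
    · rw [Finset.disjoint_left]
      exact fun k hk hk' => hWU k hk k hk' (SimpleGraph.Reachable.refl _)
    · exact ih _ _ _ hcard hG' hiso' hU hUU _
    · exact ih _ _ _ hcard hG' hiso' hW' hWW _
    · refine ih _ _ _ hcard hG' hiso' (Finset.disjoint_union_left.2 ⟨hW', hU⟩) ?_ _
      intro j hj k hk hjk
      rcases Finset.mem_union.1 hj with hj | hj <;> rcases Finset.mem_union.1 hk with hk | hk
      · exact hWW j hj k hk hjk
      · exact hWU j hj k hk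
      · exact fun h => hWU k hk j hj h.symm
      · exact hUU j hj k hk hjk

lemma good_nb {G : SimpleGraph V} (hG : G.IsAcyclic) (i : V) (b : V → Bool) :
    Good (lssIdeal K (G.deleteIncidenceSet i)) (nb G i) b :=
  good_forest _ _ ∅ _ rfl (hG.anti (G.deleteIncidenceSet_le i)) (by simp) (by simp)
    (fun _ hj _ hk hjk => nb_nonreach hG (mem_nb.1 hj) (mem_nb.1 hk) hjk) b

lemma exists_leaf {G : SimpleGraph V} (hG : G.IsAcyclic) {a b : V} (hab : G.Adj a b) :
    ∃ v u, G.Adj v u ∧ ∀ w, G.Adj v w → w = u := by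
  have : Nonempty V := ⟨a⟩
  have ⟨u, v, p, hp, hmax⟩ := SimpleGraph.Walk.exists_isPath_forall_isPath_length_le_length G
  have h1 : 1 ≤ p.length := by
    have := hmax a b hab.toWalk (by simp [hab.ne])
    simpa using this
  have hnil : ¬p.Nil := by
    intro h
    rw [← SimpleGraph.Walk.length_eq_zero_iff] at h
    omega
  refine ⟨u, _, p.adj_snd hnil, fun w hadj ↦ ?_⟩
  apply hG.eq_snd_of_adj_start hp hadj
  have : ¬(p.cons hadj.symm).IsPath := by grind [SimpleGraph.Walk.length_cons]
  grind [hp.cons]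

end partE
section partE2

set_option linter.unusedSectionVars false

variable {V K : Type} [Field K] [DecidableEq V]

variable (K) in
def mn (j k : V) : MvPolynomial (V ⊕ V) K :=
  xv K true j * xv K false k - xv K true k * xv K false j

lemma eps_mn (b : Bool) (i j k : V) (hj : j ≠ i) (hk : k ≠ i) : eps (vr b i) (mn K j k) = mn K j k := by
  rw [mn, map_sub, map_mul, map_mul, eps_xv _ _ _ _ hj, eps_xv _ _ _ _ hk,
    eps_xv _ _ _ _ hj, eps_xv _ _ _ _ hk]

variable (K) in
def mnI (U : Finset V) : Ideal (MvPolynomial (V ⊕ V) K) :=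
  Ideal.span {p | ∃ j ∈ U, ∃ k ∈ U, p = mn K j k}

lemma mn_mem {U : Finset V} {j k : V} (hj : j ∈ U) (hk : k ∈ U) : mn K j k ∈ mnI K U :=
  Ideal.subset_span ⟨j, hj, k, hk, rfl⟩

lemma mnI_dec (U : Finset V) {p : MvPolynomial (V ⊕ V) K} (hp : p ∈ mnI K U) :
    ∃ r : V → V → MvPolynomial (V ⊕ V) K, p = ∑ j ∈ U, ∑ k ∈ U, r j k * mn K j k := by
  induction hp using Submodule.span_induction with
  | mem f hf =>
    obtain ⟨j, hj, k, hk, rfl⟩ := hf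
    refine ⟨fun j' k' => if j' = j then if k' = k then 1 else 0 else 0, ?_⟩
    rw [Finset.sum_eq_single_of_mem j hj, Finset.sum_eq_single_of_mem k hk]
    · simp
    · intro b _ hb; simp [hb]
    · intro b _ hb; simp [hb]
  | zero => exact ⟨0, by simp⟩
  | add x y _ _ hx hy =>
    obtain ⟨q, hq⟩ := hx
    obtain ⟨r, hr⟩ := hy
    refine ⟨q + r, ?_⟩
    rw [hq, hr]
    simp only [Pi.add_apply, add_mul, Finset.sum_add_distrib]
  | smul a x _ hx =>
    obtain ⟨q, hq⟩ := hx
    refine ⟨fun j k => a * q j k, ?_⟩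
    rw [hq]
    simp only [smul_eq_mul, Finset.mul_sum, mul_assoc]

set_option maxHeartbeats 2000000 in
lemma reg_x {J J'' : Ideal (MvPolynomial (V ⊕ V) K)} {u : V} {U : Finset V} (h : LExt J J'' u U)
    (hg : Good J'' U (fun _ => false)) (p : MvPolynomial (V ⊕ V) K)
    (hp : xv K true u * p ∈ J ⊔ mnI K U) : p ∈ J ⊔ mnI K U := by
  obtain ⟨p1, hp1, p2, hp2, hp12⟩ := Submodule.mem_sup.1 hp
  obtain ⟨q, hq⟩ := h.dec _ hp1
  obtain ⟨r, hr⟩ := mnI_dec U hp2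
  set x := xv K true u with hx
  set y := xv K false u with hy
  set ε := eps (K := K) (vr true u) with hε
  set δ := eps (K := K) (vr false u) with hδ
  have hεx : ε x = 0 := eps_xv_self _ _
  have hεy : ε y = y := eps_xv_not true u
  have hδy : δ y = 0 := eps_xv_self _ _
  have hεk : ∀ b, ∀ k ∈ U, ε (xv K b k) = xv K b k := fun b k hk => eps_xv _ _ _ _ (h.ne k hk)
  have hδk : ∀ b, ∀ k ∈ U, δ (xv K b k) = xv K b k := fun b k hk => eps_xv _ _ _ _ (h.ne k hk)
  have hεm : ∀ j ∈ U, ∀ k ∈ U, ε (mn K j k) = mn K j k := fun j hj k hk =>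
    eps_mn _ _ _ _ (h.ne j hj) (h.ne k hk)
  have hδm : ∀ j ∈ U, ∀ k ∈ U, δ (mn K j k) = mn K j k := fun j hj k hk =>
    eps_mn _ _ _ _ (h.ne j hj) (h.ne k hk)
  have d1 : ∀ k, ∃ q', q k = ε (q k) + x * q' := fun k => eps_div _ _
  choose q' hq' using d1
  have d2 : ∀ j k, ∃ q', r j k = ε (r j k) + x * q' := fun j k => eps_div _ _
  choose r2 hr2 using d2
  have d3 : ∀ j k, ∃ q', ε (r j k) = δ (ε (r j k)) + y * q' := fun j k => eps_div _ _
  choose r1 hr1 using d3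
  have hed : ∀ k, ed K u k = x * xv K true k + y * xv K false k := fun k => ed_eq true u k
  have H0 : x * p - ∑ k ∈ U, q k * ed K u k - ∑ j ∈ U, ∑ k ∈ U, r j k * mn K j k ∈ J'' := by
    rw [← hr, ← hp12]
    convert hq using 1
    ring
  have H1 : y * ∑ k ∈ U, ε (q k) * xv K false k + ∑ j ∈ U, ∑ k ∈ U, ε (r j k) * mn K j k ∈ J'' := by
    have := (h.free true).eps_mem H0
    rw [← hε, map_sub, map_sub, map_mul, hεx, map_sum, map_sum] at this
    rw [← neg_mem_iff]
    convert this using 1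
    have e1 : ∑ k ∈ U, ε (q k * ed K u k) = y * ∑ k ∈ U, ε (q k) * xv K false k := by
      rw [Finset.mul_sum]
      refine Finset.sum_congr rfl fun k hk => ?_
      rw [hed, map_mul, map_add, map_mul, map_mul, hεx, hεy, hεk _ k hk, hεk _ k hk]
      ring
    have e2 : ∑ j ∈ U, ε (∑ k ∈ U, r j k * mn K j k) = ∑ j ∈ U, ∑ k ∈ U, ε (r j k) * mn K j k := by
      refine Finset.sum_congr rfl fun j hj => ?_
      rw [map_sum]
      refine Finset.sum_congr rfl fun k hk => ?_
      rw [map_mul, hεm j hj k hk]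
    rw [e1, e2]
    ring
  have H2 : ∑ j ∈ U, ∑ k ∈ U, δ (ε (r j k)) * mn K j k ∈ J'' := by
    have := (h.free false).eps_mem H1
    rw [← hδ, map_add, map_mul, hδy, zero_mul, zero_add, map_sum] at this
    convert this using 1
    refine Finset.sum_congr rfl fun j hj => ?_
    rw [map_sum]
    refine Finset.sum_congr rfl fun k hk => ?_
    rw [map_mul, hδm j hj k hk]
  have H3 : ∑ k ∈ U, ε (q k) * xv K false k + ∑ j ∈ U, ∑ k ∈ U, r1 j k * mn K j k ∈ J'' := by
    refine (h.free false).cancel ?_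
    change y * _ ∈ J''
    convert J''.sub_mem H1 H2 using 1
    rw [mul_add, add_sub_assoc, ← Finset.sum_sub_distrib]
    congr 1
    rw [Finset.mul_sum]
    refine Finset.sum_congr rfl fun j hj => ?_
    rw [Finset.mul_sum, ← Finset.sum_sub_distrib]
    refine Finset.sum_congr rfl fun k hk => ?_
    linear_combination -mn K j k * hr1 j k
  have H4 : p - ∑ k ∈ U, ε (q k) * xv K true k - ∑ k ∈ U, q' k * ed K u k
      - ∑ j ∈ U, ∑ k ∈ U, r2 j k * mn K j k ∈ J'' := by
    refine (h.free true).cancel ?_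
    change x * _ ∈ J''
    convert J''.add_mem H0 H1 using 1
    have e1 : ∑ k ∈ U, q k * ed K u k = x * ∑ k ∈ U, ε (q k) * xv K true k
        + x * ∑ k ∈ U, q' k * ed K u k + y * ∑ k ∈ U, ε (q k) * xv K false k := by
      rw [Finset.mul_sum, Finset.mul_sum, Finset.mul_sum, ← Finset.sum_add_distrib,
        ← Finset.sum_add_distrib]
      refine Finset.sum_congr rfl fun k hk => ?_
      linear_combination ed K u k * hq' k + ε (q k) * hed k
    have e2 : ∑ j ∈ U, ∑ k ∈ U, r j k * mn K j k = x * ∑ j ∈ U, ∑ k ∈ U, r2 j k * mn K j k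
        + ∑ j ∈ U, ∑ k ∈ U, ε (r j k) * mn K j k := by
      rw [Finset.mul_sum, ← Finset.sum_add_distrib]
      refine Finset.sum_congr rfl fun j hj => ?_
      rw [Finset.mul_sum, ← Finset.sum_add_distrib]
      refine Finset.sum_congr rfl fun k hk => ?_
      linear_combination mn K j k * hr2 j k
    rw [e1, e2]
    ring
  have H5 : ∑ k ∈ U, (ε (q k) + ∑ j ∈ U, (r1 j k - r1 k j) * xv K true j) * xv K false k ∈ J'' := by
    convert H3 using 1
    simp only [add_mul, Finset.sum_add_distrib, sub_mul, Finset.sum_sub_distrib, mn, mul_sub,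
      Finset.sum_mul]
    have e1 : ∑ k ∈ U, ∑ j ∈ U, r1 j k * xv K true j * xv K false k =
        ∑ j ∈ U, ∑ k ∈ U, r1 j k * (xv K true j * xv K false k) := by
      rw [Finset.sum_comm]
      exact Finset.sum_congr rfl fun j _ => Finset.sum_congr rfl fun k _ => by ring
    have e2 : ∑ k ∈ U, ∑ j ∈ U, r1 k j * xv K true j * xv K false k =
        ∑ j ∈ U, ∑ k ∈ U, r1 j k * (xv K true k * xv K false j) :=
      Finset.sum_congr rfl fun j _ => Finset.sum_congr rfl fun k _ => by ring
    rw [e1, e2]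
  obtain ⟨s, a, hs, hs0, hsa⟩ := hg _ H5
  have hmem : ∀ {z}, z ∈ J'' → z ∈ J ⊔ mnI K U := fun hz =>
    Ideal.mem_sup_left (h.le hz)
  have H6 : ∑ k ∈ U, ε (q k) * xv K true k ∈ J ⊔ mnI K U := by
    have e : ∑ k ∈ U, ε (q k) * xv K true k =
        ∑ k ∈ U, ∑ l ∈ U, s k l * (xv K false l * xv K true k) + ∑ k ∈ U, a k * xv K true k
        - ∑ k ∈ U, ∑ j ∈ U, (r1 j k - r1 k j) * (xv K true j * xv K true k) := by
      rw [← Finset.sum_add_distrib, ← Finset.sum_sub_distrib]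
      refine Finset.sum_congr rfl fun k hk => ?_
      have := (hsa k hk).1
      rw [← eq_sub_iff_add_eq] at this
      rw [this, sub_mul, add_mul, Finset.sum_mul, Finset.sum_mul]
      congr 2
      · congr 1
        funext j; ring
      · funext j; ring
    rw [e]
    refine Ideal.sub_mem _ (Ideal.add_mem _ ?_ ?_) ?_
    · refine alt_mem _ s _ hs hs0 U fun k hk l hl => ?_
      convert Ideal.mem_sup_right (mn_mem hk hl) using 1
      rw [mn]; ring
    · exact Ideal.sum_mem _ fun k hk => hmem (hsa k hk).2.2
    · refine alt_mem _ (fun k j => r1 j k - r1 k j) (fun k j => xv K true j * xv K true k) ?_ ?_ U ?_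
      · intro j k; ring
      · intro j; ring
      · intro j _ k _
        convert Ideal.zero_mem _ using 1
        ring
  have e : p = (p - ∑ k ∈ U, ε (q k) * xv K true k - ∑ k ∈ U, q' k * ed K u k
      - ∑ j ∈ U, ∑ k ∈ U, r2 j k * mn K j k) + ∑ k ∈ U, ε (q k) * xv K true k
      + ∑ k ∈ U, q' k * ed K u k + ∑ j ∈ U, ∑ k ∈ U, r2 j k * mn K j k := by ring
  rw [e]
  refine Ideal.add_mem _ (Ideal.add_mem _ (Ideal.add_mem _ (hmem H4) H6) ?_) ?_
  · exact Ideal.sum_mem _ fun k hk => Ideal.mul_mem_left _ _ (Ideal.mem_sup_left (h.mem k hk))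
  · exact Ideal.sum_mem _ fun j hj => Ideal.sum_mem _ fun k hk =>
      Ideal.mul_mem_left _ _ (Ideal.mem_sup_right (mn_mem hj hk))

lemma FreeOf.sup {σ : Type} {z : σ} {I J : Ideal (MvPolynomial σ K)} (hI : FreeOf z I)
    (hJ : FreeOf z J) : FreeOf z (I ⊔ J) := by
  intro g hg
  obtain ⟨a, ha, b, hb, rfl⟩ := Submodule.mem_sup.1 hg
  obtain ⟨a', ha', ea⟩ := hI a ha
  obtain ⟨b', hb', eb⟩ := hJ b hb
  refine ⟨a' + b', Ideal.add_mem _ (Ideal.mem_sup_left ha') (Ideal.mem_sup_right hb'), ?_⟩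
  rw [map_add, mul_add]
  linear_combination ea + eb

variable [Fintype V]

lemma colon {G : SimpleGraph V} (hG : G.IsAcyclic) {u v : V} (huv : u ≠ v)
    (hv : ∀ k, ¬ G.Adj v k) (p : MvPolynomial (V ⊕ V) K) :
    p * ed K u v ∈ lssIdeal K G ↔ p ∈ lssIdeal K G ⊔ mnI K (nb G u) := by
  constructor
  · intro hp
    have hf : ∀ b, FreeOf (vr b v) (lssIdeal K G ⊔ mnI K (nb G u)) := by
      intro b
      refine (lss_free hv b).sup (freeOf_span _ _ ?_)
      rintro f ⟨j, hj, k, hk, rfl⟩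
      refine eps_mn _ _ _ _ ?_ ?_
      · rintro rfl; exact hv _ (mem_nb.1 hj).symm
      · rintro rfl; exact hv _ (mem_nb.1 hk).symm
    refine regular_of_free (hf false) (hf true) (fun h => by simpa using (vr_inj h).1)
      (xv K true u) (xv K false u) (eps_xv _ _ _ _ huv)
      (reg_x (lext G u) (good_nb hG u _)) p ?_
    exact Ideal.mem_sup_left hp
  · intro hp
    obtain ⟨a, ha, b, hb, rfl⟩ := Submodule.mem_sup.1 hp
    rw [add_mul]
    refine Ideal.add_mem _ (Ideal.mul_mem_right _ _ ha) ?_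
    obtain ⟨r, rfl⟩ := mnI_dec _ hb
    rw [Finset.sum_mul]
    refine Ideal.sum_mem _ fun j hj => ?_
    rw [Finset.sum_mul]
    refine Ideal.sum_mem _ fun k hk => ?_
    have : r j k * mn K j k * ed K u v =
        r j k * ((xv K true v * xv K false k - xv K false v * xv K true k) * ed K u j
        - (xv K true v * xv K false j - xv K false v * xv K true j) * ed K u k) := by
      rw [mn, ed_eq true, ed_eq true u j, ed_eq true u k, Bool.not_true]
      ring
    rw [this]
    exact Ideal.mul_mem_left _ _ (Ideal.sub_mem _ (Ideal.mul_mem_left _ _ (ed_mem (mem_nb.1 hj)))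
      (Ideal.mul_mem_left _ _ (ed_mem (mem_nb.1 hk))))

end partE2
section partF

set_option linter.unusedSectionVars false

variable {V K : Type} [Field K] [DecidableEq V] [Fintype V]

lemma ed_hom (a b : V) : (ed K a b).IsHomogeneous 2 :=
  ((isHomogeneous_X K _).mul (isHomogeneous_X K _)).add
    ((isHomogeneous_X K _).mul (isHomogeneous_X K _))

lemma mn_hom (a b : V) : (mn K a b).IsHomogeneous 2 :=
  ((isHomogeneous_X K _).mul (isHomogeneous_X K _)).sub
    ((isHomogeneous_X K _).mul (isHomogeneous_X K _))

variable (K) in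
def pt (j k : V) : V ⊕ V → K := Sum.elim (Pi.single j 1) (Pi.single k 1)

lemma eval_ed (j k a b : V) (hab : a ≠ b) : eval (pt K j k) (ed K a b) = 0 := by
  have h1 : ¬ (a = j ∧ b = j) := fun h => hab (h.1.trans h.2.symm)
  have h2 : ¬ (a = k ∧ b = k) := fun h => hab (h.1.trans h.2.symm)
  simp only [ed, pt, map_add, map_mul, eval_X, Sum.elim_inl, Sum.elim_inr, Pi.single_apply]
  split_ifs <;> simp_all

lemma eval_mn (j k a b : V) : eval (pt K j k) (mn K a b) =
    (if a = j ∧ b = k then 1 else 0) - (if b = j ∧ a = k then 1 else 0) := by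
  simp only [mn, xv, vr, pt, map_sub, map_mul, eval_X, Sum.elim_inl, Sum.elim_inr, Pi.single_apply,
    if_true, Bool.false_eq_true, if_false]
  congr 1 <;> split_ifs <;> simp_all

lemma ed_ne_zero (a b : V) : ed K a b ≠ 0 := by
  intro h
  have := congrArg (eval (Sum.elim (fun _ => 1) (fun _ => 0) : V ⊕ V → K)) h
  simp [ed] at this

lemma exists_mns (U : Finset V) : ∃ g : Fin (U.card.choose 2) → V × V,
    (∀ e, (g e).1 ≠ (g e).2) ∧ (∀ e e', e ≠ e' →
      eval (pt K (g e).1 (g e).2) (mn K (g e').1 (g e').2) = 0) ∧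
    mnI K U = Ideal.span (Set.range fun e => mn K (g e).1 (g e).2) := by
  have hc : (U.powersetCard 2).card = U.card.choose 2 := Finset.card_powersetCard 2 U
  let φ := (Finset.equivFinOfCardEq hc).symm
  have hp : ∀ e, ∃ p : V × V, p.1 ≠ p.2 ∧ (φ e : Finset V) = {p.1, p.2} := by
    intro e
    obtain ⟨x, y, hxy, h⟩ := Finset.card_eq_two.1 (Finset.mem_powersetCard.1 (φ e).2).2
    exact ⟨(x, y), hxy, h⟩
  choose g hg1 hg2 using hp
  refine ⟨g, hg1, ?_, le_antisymm ?_ ?_⟩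
  · intro e e' hee
    rw [eval_mn]
    have hne : (φ e : Finset V) ≠ φ e' := fun h => hee (φ.injective (Subtype.ext h))
    rw [hg2, hg2] at hne
    rw [if_neg, if_neg, sub_zero]
    · rintro ⟨h1, h2⟩; rw [h1, h2, Finset.pair_comm] at hne; exact hne rfl
    · rintro ⟨h1, h2⟩; rw [h1, h2] at hne; exact hne rfl
  · refine Ideal.span_le.2 ?_
    rintro p ⟨j, hj, k, hk, rfl⟩
    by_cases hjk : j = k
    · subst hjk
      simp [mn]
    have hm : ({j, k} : Finset V) ∈ U.powersetCard 2 := by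
      rw [Finset.mem_powersetCard]
      refine ⟨?_, Finset.card_pair hjk⟩
      intro x hx
      simp only [Finset.mem_insert, Finset.mem_singleton] at hx
      rcases hx with rfl | rfl <;> assumption
    obtain ⟨e, he⟩ := φ.surjective ⟨_, hm⟩
    have h2 := hg2 e
    rw [he] at h2
    simp only at h2
    have hmem : mn K (g e).1 (g e).2 ∈ Ideal.span (Set.range fun e => mn K (g e).1 (g e).2) :=
      Ideal.subset_span ⟨e, rfl⟩
    have h3 : j = (g e).1 ∨ j = (g e).2 := by
      have : j ∈ ({j, k} : Finset V) := by simp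
      rw [h2] at this; simpa using this
    have h4 : k = (g e).1 ∨ k = (g e).2 := by
      have : k ∈ ({j, k} : Finset V) := by simp
      rw [h2] at this; simpa using this
    rcases h3 with h3 | h3 <;> rcases h4 with h4 | h4
    · exact absurd (h3.trans h4.symm) hjk
    · rw [h3, h4]; exact hmem
    · rw [h3, h4]
      have : mn K (g e).2 (g e).1 = - mn K (g e).1 (g e).2 := by rw [mn, mn]; ring
      rw [this]; exact neg_mem hmem
    · exact absurd (h3.trans h4.symm) hjk
  · refine Ideal.span_le.2 ?_
    rintro p ⟨e, rfl⟩
    have hs := (Finset.mem_powersetCard.1 (φ e).2).1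
    rw [hg2] at hs
    exact mn_mem (hs (by simp)) (hs (by simp))

lemma main_ind (m : ℕ) : ∀ G : SimpleGraph V, G.IsAcyclic → G.edgeSet.ncard = m →
    ∃ f : Fin m → MvPolynomial (V ⊕ V) K, (∀ k, ∃ a b, G.Adj a b ∧ f k = ed K a b) ∧
      Indep (fun k (_ : Unit) => f k) ∧ lssIdeal K G = Ideal.span (Set.range f) ∧
      SyzBasis f (m.choose 2 + ∑ v, ((G.neighborSet v).ncard).choose 3) := by
  induction m with
  | zero =>
    intro G hG hm
    have hno : ∀ a b, ¬ G.Adj a b := by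
      intro a b hab
      rw [Set.ncard_eq_zero (Set.toFinite _)] at hm
      have : s(a, b) ∈ G.edgeSet := hab
      rw [hm] at this
      exact this
    have hN : Nat.choose 0 2 + ∑ v, ((G.neighborSet v).ncard).choose 3 = 0 := by
      have : ∀ v, G.neighborSet v = ∅ := fun v => Set.eq_empty_of_forall_notMem fun w => hno v w
      simp [this]
    refine ⟨Fin.elim0, fun k => k.elim0, fun a _ k => k.elim0, ?_, ?_⟩
    · rw [lssIdeal]
      congr 1
      ext p
      constructor
      · rintro ⟨a, b, h, _⟩
        exact absurd h (hno a b)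
      · rintro ⟨k, _⟩
        exact k.elim0
    · rw [hN]
      refine ⟨Fin.elim0, fun k => k.elim0, fun a _ k => k.elim0, fun z => ?_⟩
      simp
  | succ m ih =>
    intro G hG hm
    have hne : G.edgeSet.Nonempty := by
      rw [← Set.ncard_pos (Set.toFinite _)]; omega
    obtain ⟨⟨a, b⟩, hab⟩ := hne
    obtain ⟨v, u, hvu, hleaf⟩ := exists_leaf hG (show G.Adj a b from hab)
    set G' := G.deleteIncidenceSet v with hG'
    have hadj : ∀ {a b}, G'.Adj a b ↔ G.Adj a b ∧ a ≠ v ∧ b ≠ v :=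
      SimpleGraph.deleteIncidenceSet_adj
    have hac : G'.IsAcyclic := hG.anti (G.deleteIncidenceSet_le v)
    have hE : G.edgeSet = insert s(u, v) G'.edgeSet := by
      ext e
      induction e with
      | h a b =>
        rw [Set.mem_insert_iff, SimpleGraph.mem_edgeSet, SimpleGraph.mem_edgeSet, hadj, Sym2.eq_iff]
        constructor
        · intro h
          by_cases ha : a = v
          · subst ha; exact Or.inl (Or.inr ⟨rfl, hleaf b h⟩)
          by_cases hb : b = v
          · subst hb; exact Or.inl (Or.inl ⟨hleaf a h.symm, rfl⟩)
          exact Or.inr ⟨h, ha, hb⟩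
        · rintro ((⟨rfl, rfl⟩ | ⟨rfl, rfl⟩) | h)
          · exact hvu.symm
          · exact hvu
          · exact h.1
    have hm' : G'.edgeSet.ncard = m := by
      rw [hE, Set.ncard_insert_of_notMem _ (Set.toFinite _)] at hm
      · omega
      · intro h
        exact (hadj.1 (show G'.Adj u v from h)).2.2 rfl
    obtain ⟨f, hf, hfi, hfs, hsyz⟩ := ih G' hac hm'
    have huv : u ≠ v := hvu.ne'
    have hiso : ∀ k, ¬ G'.Adj v k := fun k hk => (hadj.1 hk).2.1 rfl
    have hfh : ∀ k, (f k).IsHomogeneous 2 := by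
      intro k
      obtain ⟨a, b, _, h⟩ := hf k
      rw [h]; exact ed_hom a b
    have hfe : ∀ c k, eps (vr c v) (f k) = f k := by
      intro c k
      obtain ⟨a, b, hab, h⟩ := hf k
      rw [h]
      exact eps_ed _ _ _ _ (hadj.1 hab).2.1 (hadj.1 hab).2.2
    refine ⟨Fin.cons (ed K u v) f, ?_, ?_, ?_, ?_⟩
    · intro k
      refine Fin.cases ?_ (fun k => ?_) k
      · exact ⟨u, v, hvu.symm, rfl⟩
      · obtain ⟨a, b, hab, h⟩ := hf k
        exact ⟨a, b, (hadj.1 hab).1, by simpa using h⟩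
    · intro c hc
      have hc := hc ()
      simp only [Fin.sum_univ_succ, Fin.cons_zero, Fin.cons_succ] at hc
      have h1 := congrArg (eps (vr false v)) (congrArg (eps (vr true v)) hc)
      have e1 : eps (vr true v) (ed K u v) = xv K false u * xv K false v := by
        rw [ed_eq true, map_add, map_mul, map_mul, eps_xv_self, Bool.not_true,
          eps_xv true false v u huv]
        have := eps_xv_not (K := K) true v
        rw [Bool.not_true] at this
        rw [this]; ring
      have hC : ∀ z (r : K), eps z (C r : MvPolynomial (V ⊕ V) K) = C r := fun z r =>
        AlgHom.commutes _ r
      simp only [map_add, map_sum, map_mul, hC, hfe, e1, eps_xv_self, mul_zero, zero_add,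
        map_zero] at h1
      have h2 := hfi (fun k => c k.succ) (fun _ => h1)
      rw [h1, add_zero] at hc
      have h3 : c 0 = 0 := by
        rcases mul_eq_zero.1 hc with h | h
        · simpa using h
        · exact absurd h (ed_ne_zero u v)
      intro k
      exact Fin.cases h3 h2 k
    · rw [Fin.range_cons, Ideal.span_insert, ← hfs]
      refine le_antisymm ?_ ?_
      · refine Ideal.span_le.2 ?_
        rintro p ⟨a, b, hab, rfl⟩
        change ed K a b ∈ _
        by_cases ha : a = v
        · subst ha
          rw [hleaf b hab, ed_comm]
          exact Ideal.mem_sup_left (Ideal.subset_span rfl)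
        by_cases hb : b = v
        · subst hb
          rw [hleaf a hab.symm]
          exact Ideal.mem_sup_left (Ideal.subset_span rfl)
        exact Ideal.mem_sup_right (ed_mem (hadj.2 ⟨hab, ha, hb⟩))
      · refine sup_le ?_ (lext G v).le
        rw [Ideal.span_singleton_le_iff_mem]
        exact ed_mem hvu.symm
    · obtain ⟨g, hg1, hg2, hg3⟩ := exists_mns (K := K) (nb G' u)
      have key := cone f hfh (ed K u v) (ed_hom u v) hsyz
        (Fin.append f (fun e => mn K (g e).1 (g e).2)) ?_ ?_ ?_
      · have hd : (G'.neighborSet u).ncard = (nb G' u).card := by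
          rw [← Set.ncard_coe_finset]
          congr 1
          ext w; simp [mem_nb]
        have hN : ∀ w, ((G.neighborSet w).ncard).choose 3 = ((G'.neighborSet w).ncard).choose 3 +
            if w = u then (nb G' u).card.choose 2 else 0 := by
          intro w
          by_cases hwu : w = u
          · subst hwu
            have : G.neighborSet w = insert v (G'.neighborSet w) := by
              ext x
              rw [Set.mem_insert_iff, SimpleGraph.mem_neighborSet, SimpleGraph.mem_neighborSet, hadj]
              constructor
              · intro h
                by_cases hx : x = v
                · exact Or.inl hx
                · exact Or.inr ⟨h, huv, hx⟩
              · rintro (rfl | h)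
                · exact hvu.symm
                · exact h.1
            rw [this, Set.ncard_insert_of_notMem _ (Set.toFinite _), hd, if_pos rfl,
              Nat.choose_succ_succ, add_comm]
            intro h
            exact (hadj.1 h).2.2 rfl
          rw [if_neg hwu, add_zero]
          by_cases hwv : w = v
          · subst hwv
            have h1 : G.neighborSet w = {u} := by
              ext x
              rw [SimpleGraph.mem_neighborSet, Set.mem_singleton_iff]
              exact ⟨hleaf x, fun h => h ▸ hvu⟩
            have h2 : G'.neighborSet w = ∅ := Set.eq_empty_of_forall_notMem fun x => hiso x
            rw [h1, h2, Set.ncard_singleton, Set.ncard_empty]; rfl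
          · have : G.neighborSet w = G'.neighborSet w := by
              ext x
              rw [SimpleGraph.mem_neighborSet, SimpleGraph.mem_neighborSet, hadj]
              refine ⟨fun h => ⟨h, hwv, ?_⟩, fun h => h.1⟩
              rintro rfl
              exact hwu (hleaf w h.symm)
            rw [this]
        have hfin : m.choose 2 + ∑ v, ((G'.neighborSet v).ncard).choose 3 +
            (m + (nb G' u).card.choose 2) =
            (m + 1).choose 2 + ∑ v, ((G.neighborSet v).ncard).choose 3 := by
          simp only [hN, Finset.sum_add_distrib, Finset.sum_ite_eq', Finset.mem_univ, if_true]
          have : (m + 1).choose 2 = m + m.choose 2 := by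
            rw [Nat.choose_succ_succ, Nat.choose_one_right]
          omega
        rw [← hfin]
        exact key
      · intro k
        refine Fin.addCases (fun k => ?_) (fun k => ?_) k
        · rw [Fin.append_left]; exact hfh k
        · rw [Fin.append_right]; exact mn_hom _ _
      · intro c hc
        have hc := hc ()
        simp only [Fin.sum_univ_add, Fin.append_left, Fin.append_right] at hc
        have h1 : ∀ e, c (Fin.natAdd m e) = 0 := by
          intro e
          have h := congrArg (eval (pt K (g e).1 (g e).2)) hc
          rw [map_add, map_sum, map_sum, map_zero, Finset.sum_eq_zero, zero_add,
            Finset.sum_eq_single_of_mem e (Finset.mem_univ _)] at h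
          · rw [map_mul, eval_C, eval_mn] at h
            have := hg1 e
            simpa [this, this.symm] using h
          · intro e' _ he
            rw [map_mul, hg2 e e' he.symm, mul_zero]
          · intro k _
            obtain ⟨a, b, hab, h⟩ := hf k
            rw [map_mul, h, eval_ed _ _ _ _ hab.ne, mul_zero]
        have h2 := hfi (fun k => c (Fin.castAdd _ k)) (fun _ => by simpa [h1] using hc)
        intro k
        exact Fin.addCases h2 h1 k
      · intro p
        have hr : Ideal.span (Set.range (Fin.append f (fun e => mn K (g e).1 (g e).2))) =
            lssIdeal K G' ⊔ mnI K (nb G' u) := by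
          rw [hfs, hg3, ← Ideal.span_union]
          congr 1
          ext q
          constructor
          · rintro ⟨k, rfl⟩
            refine Fin.addCases (fun k => ?_) (fun k => ?_) k
            · rw [Fin.append_left]; exact Or.inl ⟨k, rfl⟩
            · rw [Fin.append_right]; exact Or.inr ⟨k, rfl⟩
          · rintro (⟨k, rfl⟩ | ⟨k, rfl⟩)
            · exact ⟨Fin.castAdd _ k, Fin.append_left _ _ _⟩
            · exact ⟨Fin.natAdd _ k, Fin.append_right _ _ _⟩
        have := colon hac huv hiso p
        rw [← hr, hfs, Ideal.mem_span_range_iff_exists_fun, Ideal.mem_span_range_iff_exists_fun] at this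
        simpa only [eq_comm] using this

end partF

/-- **Second Betti number of LSS ideals of trees.**
For a tree `G` on `[n]`,
`β₂(S/L_G) = β_{2,4}(S/L_G) = C(n-1, 2) + Σ_{v} C(deg_G(v), 3)`. -/
theorem betti_two_lssIdeal_tree
    (K : Type) [Field K] (n : ℕ) (G : SimpleGraph (Fin n))
    (htree : G.IsTree)
    (F : MinimalGradedFreeResolutionOfQuotient (lssIdeal K G)) :
    F.rank 2 = Nat.choose (n - 1) 2 +
        ∑ v : Fin n, Nat.choose ((G.neighborSet v).ncard) 3 ∧
      F.betti 2 4 = Nat.choose (n - 1) 2 +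
        ∑ v : Fin n, Nat.choose ((G.neighborSet v).ncard) 3 := by
  have hE : G.edgeSet.ncard = n - 1 := by
    classical
    have := htree.card_edgeFinset
    rw [Fintype.card_fin] at this
    rw [← SimpleGraph.coe_edgeFinset, Set.ncard_coe_finset]
    omega
  obtain ⟨f, hf, hfi, hfs, hsyz⟩ := main_ind (K := K) (n - 1) G htree.isAcyclic hE
  obtain ⟨h1, h2⟩ := betti_of_syz (lssIdeal K G) _ _ f (fun k => by
    obtain ⟨a, b, _, h⟩ := hf k
    rw [h]; exact ed_hom a b) hfi (fun p => by
      rw [hfs, Ideal.mem_span_range_iff_exists_fun]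
      simp only [eq_comm]) hsyz F
  refine ⟨h1, ?_⟩
  rw [MinimalGradedFreeResolutionOfQuotient.betti, Finset.filter_true_of_mem (fun c _ => h2 c),
    Finset.card_univ, Fintype.card_fin, h1]

end
end
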